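/- Let k ≥ 1 and let α₁,…,α_k : Fˣ → ℂˣ be characters. For any regular elliptic x ∈ GL_n(F) and any root ξ ∈ E of the characteristic polynomial of x in a degree-n extension E of F, K(α,ψ,x) = (-1)^{(k-1)(n+1)} · q^{(k-1)·n(n-1)/2} · K_E(α,ψ,ξ). -/

import Mathlib

open scoped BigOperators

/-- The twisted matrix Kloosterman sum
`K(α,ψ,x) = Σ_{g₁⋯g_k = x} (∏ αᵢ(det gᵢ)) ψ(tr(g₁+⋯+g_k))`. -/
noncomputable def matrixKloosterman {F : Type} [Field F] [Fintype F] [DecidableEq F]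
    {ι : Type} [Fintype ι] [DecidableEq ι] {k : ℕ}
    (α : Fin k → Fˣ →* ℂˣ) (ψ : AddChar F ℂ) (x : Matrix ι ι F) : ℂ :=
  ∑ g : Fin k → (Matrix ι ι F)ˣ,
    if ((List.ofFn g).prod : Matrix ι ι F) = x then
      (∏ i, (α i (Units.map (Matrix.detMonoidHom) (g i)) : ℂ)) *
        ψ (Matrix.trace (∑ i, ((g i : Matrix ι ι F))))
    else 0

/-- The twisted Kloosterman sum over a finite extension `E` of `F`:
`K_E(α,ψ,ξ) = Σ_{t₁⋯t_k = ξ} (∏ αᵢ(N_{E/F}(tᵢ))) ψ(Tr_{E/F}(t₁+⋯+t_k))`. -/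
noncomputable def fieldKloosterman {F : Type} [Field F] [Fintype F] {k : ℕ}
    (α : Fin k → Fˣ →* ℂˣ) (ψ : AddChar F ℂ)
    (E : Type) [Field E] [Fintype E] [DecidableEq E] [Algebra F E] (ξ : E) : ℂ :=
  ∑ t : Fin k → Eˣ,
    if ((∏ i, t i : Eˣ) : E) = ξ then
      (∏ i, (α i (Units.map (Algebra.norm F : E →* F) (t i)) : ℂ)) *
        ψ (Algebra.trace F E (∑ i, (t i : E)))
    else 0

set_option linter.unusedSectionVars false
namespace KL
open Matrix

section fourier
variable {F : Type} [Field F] [Fintype F] {ψ : AddChar F ℂ}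

lemma sum_psi_lin (hψ : ∃ a : F, ψ a ≠ 1) {V : Type*} [AddCommGroup V] [Module F V] [Fintype V]
    (l : V →ₗ[F] F) [Decidable (l = 0)] : ∑ v, ψ (l v) = if l = 0 then (Fintype.card V : ℂ) else 0 := by
  classical
  have h := AddChar.sum_eq_ite (ψ.compAddMonoidHom l.toAddMonoidHom)
  have h2 : (ψ.compAddMonoidHom l.toAddMonoidHom = 0) ↔ l = 0 := by
    constructor
    · intro h
      by_contra hl
      obtain ⟨v, hv⟩ : ∃ v, l v ≠ 0 := by
        by_contra hh; push Not at hh; exact hl (LinearMap.ext hh)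
      obtain ⟨a, ha⟩ := hψ
      apply ha
      have := DFunLike.congr_fun h ((a / l v) • v)
      simpa [hv] using this
    · intro h; subst h; ext v; simp
  simp only [h2] at h
  simpa using h

lemma sum_psi_filter (hψ : ∃ a : F, ψ a ≠ 1) {V : Type*} [AddCommGroup V] [Module F V] [Fintype V]
    (W : Submodule F V) (P : V → Prop) [DecidablePred P] (hP : ∀ v, P v ↔ v ∈ W)
    (l : V →ₗ[F] F) [Decidable (∀ v, P v → l v = 0)] :
    ∑ v with P v, ψ (l v) = if (∀ v, P v → l v = 0) then ((Finset.univ.filter P).card : ℂ) else 0 := by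
  classical
  have h1 : ∑ v with P v, ψ (l v) = ∑ v : W, ψ (l.domRestrict W v) := by
    rw [Finset.sum_subtype (p := fun v => v ∈ W)]
    · rfl
    · intro x; simp [hP]
  rw [h1, sum_psi_lin hψ]
  have h2 : l.domRestrict W = 0 ↔ ∀ v, P v → l v = 0 := by
    constructor
    · intro h v hv
      exact DFunLike.congr_fun h ⟨v, (hP v).1 hv⟩
    · intro h; ext v; exact h v ((hP _).2 v.2)
  have h3 : (Finset.univ.filter P).card = Fintype.card W := by
    rw [Fintype.card_subtype]; congr 1; ext v; simp [hP]
  simp only [h2, h3]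

/-- the linear form `tr(c ·)` -/
def trL {ι : Type*} [Fintype ι] (c : Matrix ι ι F) : Matrix ι ι F →ₗ[F] F where
  toFun a := (c * a).trace
  map_add' := by intro a b; simp [mul_add]
  map_smul' := by intro a b; simp

lemma trL_apply {ι : Type*} [Fintype ι] (c a : Matrix ι ι F) : trL c a = (c * a).trace := rfl

lemma trL_eq_zero {ι : Type*} [Fintype ι] [DecidableEq ι] (c : Matrix ι ι F) : trL c = 0 ↔ c = 0 := by
  constructor
  · intro h; exact Matrix.ext_iff_trace_mul_right.2 (fun x => by
      have := DFunLike.congr_fun h x; simpa [trL_apply] using this)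
  · rintro rfl; ext; simp [trL]

lemma sum_psi_trace (hψ : ∃ a : F, ψ a ≠ 1) {ι : Type*} [Fintype ι] [DecidableEq ι] [DecidableEq F]
    (a : Matrix ι ι F) :
    ∑ c : Matrix ι ι F, ψ ((c * a).trace) = if a = 0 then (Fintype.card (Matrix ι ι F) : ℂ) else 0 := by
  classical
  have := sum_psi_lin hψ (trL a)
  simp only [trL_eq_zero, trL_apply] at this
  rw [← this]
  apply Finset.sum_congr rfl; intro c _; rw [Matrix.trace_mul_comm]
end fourier

lemma trace_integral {G I : Type*} [Fintype G] [DecidableEq G] [Fintype I] [DecidableEq I]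
    (T : Matrix G G ℂ) (V : Matrix G I ℂ) (A : Matrix I I ℂ) (hA : ∀ i j, IsIntegral ℤ (A i j))
    (hTV : T * V = V * A) (hV : ∀ l : G → ℂ, l ᵥ* V = 0 → l = 0) : IsIntegral ℤ T.trace := by
  rw [Matrix.trace_eq_sum_roots_charpoly]
  apply IsIntegral.multiset_sum
  intro z hz
  -- charpoly of A has integral coefficients
  have hz' : T.charpoly.IsRoot z := Polynomial.isRoot_of_mem_roots hz
  have h1 : (Matrix.scalar G z - T).det = 0 := by
    rw [← Matrix.eval_charpoly]; exact hz'
  obtain ⟨l, hl0, hl⟩ := Matrix.exists_vecMul_eq_zero_iff.2 h1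
  have h2 : l ᵥ* T = z • l := by
    rw [Matrix.vecMul_sub, sub_eq_zero] at hl
    rw [← hl]; ext i; simp [Matrix.vecMul_diagonal, mul_comm]
  have hw : l ᵥ* V ≠ 0 := fun h => hl0 (hV l h)
  have h3 : (l ᵥ* V) ᵥ* A = z • (l ᵥ* V) := by
    rw [Matrix.vecMul_vecMul, ← hTV, ← Matrix.vecMul_vecMul, h2, Matrix.smul_vecMul]
  have h4 : (Matrix.scalar I z - A).det = 0 := by
    apply Matrix.exists_vecMul_eq_zero_iff.1
    refine ⟨_, hw, ?_⟩
    rw [Matrix.vecMul_sub, h3, sub_eq_zero]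
    ext i; simp [Matrix.vecMul_diagonal, mul_comm]
  rw [← Matrix.eval_charpoly] at h4
  -- lift A to integralClosure
  let A' : Matrix I I (integralClosure ℤ ℂ) := fun i j => ⟨A i j, hA i j⟩
  have hAA : A'.map (algebraMap (integralClosure ℤ ℂ) ℂ) = A := by ext i j; rfl
  have h5 : A.charpoly = A'.charpoly.map (algebraMap (integralClosure ℤ ℂ) ℂ) := by
    rw [← Matrix.charpoly_map, hAA]
  have h6 : IsIntegral (integralClosure ℤ ℂ) z := by
    refine ⟨A'.charpoly, Matrix.charpoly_monic _, ?_⟩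
    rw [h5, Polynomial.eval_map] at h4
    exact h4
  exact isIntegral_trans _ h6

end KL

set_option linter.unusedSectionVars false
namespace KL
open Matrix

section span
variable {F : Type} [Field F] [Fintype F] [DecidableEq F] {ψ : AddChar F ℂ} {n : ℕ}

def NN (k : ℕ) (m : Matrix (Fin n) (Fin n) F) : Prop := ∀ i j, m i j ≠ 0 → i < j ∧ k ≤ j.val
def CC (k : ℕ) (m : Matrix (Fin n) (Fin n) F) : Prop := ∀ i j, m i j ≠ 0 → i < j ∧ j.val = k
noncomputable instance (k : ℕ) : DecidablePred (NN (F := F) (n := n) k) := Classical.decPred _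
noncomputable instance (k : ℕ) : DecidablePred (CC (F := F) (n := n) k) := Classical.decPred _

def Jm (ε : Fin n → F) : Matrix (Fin n) (Fin n) F := fun i j => if j.val + 1 = i.val then ε i else 0

lemma NN_split (k : ℕ) (f : Matrix (Fin n) (Fin n) F → ℂ) :
    ∑ m with NN k m, f m = ∑ m with NN (k+1) m, ∑ a with CC k a, f (m + a) := by
  rw [← Finset.sum_product']
  refine Finset.sum_bij' (fun m _ => (fun i j => if j.val = k then 0 else m i j,
      fun i j => if j.val = k then m i j else 0)) (fun p _ => p.1 + p.2) ?_ ?_ ?_ ?_ ?_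
  · intro m hm
    simp only [Finset.mem_filter, Finset.mem_univ, true_and, Finset.mem_product] at hm ⊢
    refine ⟨Finset.mem_filter.2 ⟨Finset.mem_univ _, ?_⟩, Finset.mem_filter.2 ⟨Finset.mem_univ _, ?_⟩⟩
    · intro i j h
      simp only [ne_eq, ite_eq_left_iff, not_forall] at h
      obtain ⟨h1, h2⟩ := h
      have := hm i j h2
      exact ⟨this.1, by omega⟩
    · intro i j h
      simp only [ne_eq, ite_eq_right_iff, not_forall] at h
      obtain ⟨h1, h2⟩ := h
      have := hm i j h2
      exact ⟨this.1, h1⟩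
  · rintro ⟨m, a⟩ h
    simp only [Finset.mem_filter, Finset.mem_univ, true_and, Finset.mem_product] at h ⊢
    intro i j hij
    have : m i j ≠ 0 ∨ a i j ≠ 0 := by
      by_contra hh; push Not at hh; apply hij; simp [hh.1, hh.2]
    rcases this with h1 | h1
    · have := h.1 i j h1; exact ⟨this.1, by omega⟩
    · have := h.2 i j h1; exact ⟨this.1, by omega⟩
  · intro m hm
    ext i j; rw [Matrix.add_apply]; dsimp only; split_ifs <;> simp
  · rintro ⟨m, a⟩ h
    simp only [Finset.mem_filter, Finset.mem_univ, true_and, Finset.mem_product] at h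
    ext i j
    · simp only [Matrix.add_apply]
      split_ifs with hj
      · by_contra h0
        have := h.1 i j (Ne.symm h0); omega
      · have : a i j = 0 := by
          by_contra h0; exact hj (h.2 i j h0).2
        simp [this]
    · simp only [Matrix.add_apply]
      split_ifs with hj
      · have : m i j = 0 := by
          by_contra h0; have := h.1 i j h0; omega
        simp [this]
      · by_contra h0
        exact hj (h.2 i j (Ne.symm h0)).2
  · intro m hm
    congr 1
    ext i j; rw [Matrix.add_apply]; dsimp only; split_ifs <;> simp

/-- the partial sums in the induction -/
noncomputable def ZZ (ψ : AddChar F ℂ) (k : ℕ) (l : Matrix (Fin n) (Fin n) F → ℂ) (ε : Fin n → F)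
    (c y h : Matrix (Fin n) (Fin n) F) : ℂ :=
  ∑ m with NN (k+1) m, ∑ a with CC k a, ψ (-(Jm ε * m).trace - (c * a).trace) * l (y * (1 + m + a) * h)

lemma ZZ_conj (k : ℕ) (l : Matrix (Fin n) (Fin n) F → ℂ) (ε : Fin n → F)
    (c y h N : Matrix (Fin n) (Fin n) F) (hN : N * N = 0)
    (hs : ∀ i j, N i j ≠ 0 → i.val < k ∧ j.val < k) :
    ZZ ψ k l ε c y h = ZZ ψ k l ε (c * (1 + N)) (y * (1 + N)) ((1 - N) * h) := by
  have g1 : (1 + N) * (1 - N) = 1 := by simp [add_mul, mul_sub, hN]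
  have g2 : (1 - N) * (1 + N) = 1 := by simp [sub_mul, mul_add, hN]
  have hs' : ∀ i j, (-N) i j ≠ 0 → i.val < k ∧ j.val < k := by
    intro i j h; apply hs; simpa using h
  have key0 : ∀ m : Matrix (Fin n) (Fin n) F, (∀ i j, m i j ≠ 0 → k ≤ j.val) → m * N = 0 := by
    intro m hm
    ext i j
    rw [Matrix.mul_apply]
    apply Finset.sum_eq_zero
    intro t _
    by_cases h1 : m i t = 0
    · simp [h1]
    · by_cases h2 : N t j = 0
      · simp [h2]
      · have := hm i t h1; have := hs t j h2; omega
  have keyN : ∀ N : Matrix (Fin n) (Fin n) F, (∀ i j, N i j ≠ 0 → i.val < k ∧ j.val < k) →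
      ∀ m, NN (k+1) m → NN (k+1) ((1 + N) * m) := by
    intro N hs m hm i j hij
    by_cases h1 : m i j = 0
    · have : (N * m) i j ≠ 0 := by
        intro h0; apply hij; simp [add_mul, h0, h1]
      rw [Matrix.mul_apply] at this
      obtain ⟨t, _, ht⟩ := Finset.exists_ne_zero_of_sum_ne_zero this
      have a1 := hs i t (left_ne_zero_of_mul ht)
      have a2 := hm t j (right_ne_zero_of_mul ht)
      exact ⟨by rw [Fin.lt_def]; omega, a2.2⟩
    · exact hm i j h1
  have keyC : ∀ N : Matrix (Fin n) (Fin n) F, (∀ i j, N i j ≠ 0 → i.val < k ∧ j.val < k) →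
      ∀ m, CC k m → CC k ((1 + N) * m) := by
    intro N hs m hm i j hij
    by_cases h1 : m i j = 0
    · have : (N * m) i j ≠ 0 := by
        intro h0; apply hij; simp [add_mul, h0, h1]
      rw [Matrix.mul_apply] at this
      obtain ⟨t, _, ht⟩ := Finset.exists_ne_zero_of_sum_ne_zero this
      have a1 := hs i t (left_ne_zero_of_mul ht)
      have a2 := hm t j (right_ne_zero_of_mul ht)
      exact ⟨by rw [Fin.lt_def]; omega, a2.2⟩
    · exact hm i j h1
  have hJ : ∀ m : Matrix (Fin n) (Fin n) F, NN (k+1) m → (Jm ε * (N * m)).trace = 0 := by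
    intro m hm
    rw [Matrix.trace]
    apply Finset.sum_eq_zero
    intro i _
    rw [Matrix.diag_apply, Matrix.mul_apply]
    apply Finset.sum_eq_zero
    intro j _
    rw [Jm]
    split_ifs with h1
    · have : (N * m) j i = 0 := by
        rw [Matrix.mul_apply]
        apply Finset.sum_eq_zero
        intro t _
        by_cases h2 : N j t = 0
        · simp [h2]
        by_cases h3 : m t i = 0
        · simp [h3]
        have := hs j t h2; have := hm t i h3; omega
      simp [this]
    · simp
  unfold ZZ
  symm
  refine Finset.sum_bij' (fun m _ => (1 + N) * m) (fun m _ => (1 - N) * m) ?_ ?_ ?_ ?_ ?_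
  · intro m hm
    simp only [Finset.mem_filter, Finset.mem_univ, true_and] at hm ⊢
    exact keyN N hs m hm
  · intro m hm
    simp only [Finset.mem_filter, Finset.mem_univ, true_and] at hm ⊢
    rw [sub_eq_add_neg]; exact keyN (-N) hs' m hm
  · intro m _; rw [← mul_assoc, g2, one_mul]
  · intro m _; rw [← mul_assoc, g1, one_mul]
  intro m hm
  simp only [Finset.mem_filter, Finset.mem_univ, true_and] at hm
  refine Finset.sum_bij' (fun m _ => (1 + N) * m) (fun m _ => (1 - N) * m) ?_ ?_ ?_ ?_ ?_
  · intro m hm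
    simp only [Finset.mem_filter, Finset.mem_univ, true_and] at hm ⊢
    exact keyC N hs m hm
  · intro m hm
    simp only [Finset.mem_filter, Finset.mem_univ, true_and] at hm ⊢
    rw [sub_eq_add_neg]; exact keyC (-N) hs' m hm
  · intro m _; rw [← mul_assoc, g2, one_mul]
  · intro m _; rw [← mul_assoc, g1, one_mul]
  intro a ha
  simp only [Finset.mem_filter, Finset.mem_univ, true_and] at ha
  have e1 : m * N = 0 := key0 m (fun i j h => by have := (hm i j h).2; omega)
  have e2 : a * N = 0 := key0 a (fun i j h => by have := (ha i j h).2; omega)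
  have e3 : (Jm ε * ((1 + N) * m)).trace = (Jm ε * m).trace := by
    rw [add_mul, one_mul, mul_add, Matrix.trace_add, hJ m hm, add_zero]
  rw [e3, mul_assoc c]
  congr 2
  have : y * (1 + N) * (1 + m + a) * ((1 - N) * h) = y * ((1 + N) * (1 + m + a) * (1 - N)) * h := by
    simp only [mul_assoc]
  rw [this]
  congr 2
  have : (1 + m + a) * (1 - N) = (1 - N) + m + a := by
    simp only [add_mul, mul_sub, e1, e2, mul_one, one_mul, add_zero]; abel
  rw [mul_assoc, this, mul_add, mul_add, g1]

lemma ZZ_of_P (k : ℕ) (l : Matrix (Fin n) (Fin n) F → ℂ)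
    (hP : ∀ (ε : Fin n → F) (y h : Matrix (Fin n) (Fin n) F), IsUnit y → IsUnit h →
      ∑ m with NN k m, ψ (-(Jm ε * m).trace) * l (y * (1 + m) * h) = 0)
    (ε : Fin n → F) (c y h : Matrix (Fin n) (Fin n) F) (hy : IsUnit y) (hh : IsUnit h)
    (hc : ∀ i j : Fin n, i.val = k → j.val + 1 < k → c i j = 0) :
    ZZ ψ k l ε c y h = 0 := by
  let ε' : Fin n → F := fun i => if hi : i.val = k ∧ 0 < k then c i ⟨k - 1, by omega⟩ else ε i
  rw [← hP ε' y h hy hh, NN_split, ZZ]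
  apply Finset.sum_congr rfl; intro m hm
  apply Finset.sum_congr rfl; intro a ha
  simp only [Finset.mem_filter, Finset.mem_univ, true_and] at hm ha
  rw [mul_add (Jm ε'), Matrix.trace_add, neg_add, ← sub_eq_add_neg, ← add_assoc]
  congr 3
  · congr 1
    simp only [Matrix.trace, Matrix.diag_apply, Matrix.mul_apply]
    apply Finset.sum_congr rfl; intro i _
    apply Finset.sum_congr rfl; intro j _
    by_cases h0 : m j i = 0
    · simp [h0]
    have := hm j i h0
    have hi : i.val ≠ k := by omega
    simp [Jm, ε', hi]
  · simp only [Matrix.trace, Matrix.diag_apply, Matrix.mul_apply]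
    apply Finset.sum_congr rfl; intro i _
    apply Finset.sum_congr rfl; intro j _
    by_cases h0 : a j i = 0
    · simp [h0]
    have h1 := ha j i h0
    have h2 : j.val < i.val := h1.1
    congr 1
    rw [Jm]
    split_ifs with hj
    · have : i.val = k ∧ 0 < k := ⟨h1.2, by omega⟩
      simp only [ε', dif_pos this]
      congr 1; ext; simp; omega
    · exact hc i j h1.2 (by omega)

lemma ZZ_zero (k : ℕ) (l : Matrix (Fin n) (Fin n) F → ℂ)
    (hP : ∀ (ε : Fin n → F) (y h : Matrix (Fin n) (Fin n) F), IsUnit y → IsUnit h →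
      ∑ m with NN k m, ψ (-(Jm ε * m).trace) * l (y * (1 + m) * h) = 0)
    (ε : Fin n → F) (c y h : Matrix (Fin n) (Fin n) F) (hy : IsUnit y) (hh : IsUnit h) :
    ZZ ψ k l ε c y h = 0 := by
  have unit1 : ∀ N : Matrix (Fin n) (Fin n) F, N * N = 0 → IsUnit (1 + N) ∧ IsUnit (1 - N) := by
    intro N hN
    have g1 : (1 + N) * (1 - N) = 1 := by simp [add_mul, mul_sub, hN]
    have g2 : (1 - N) * (1 + N) = 1 := by simp [sub_mul, mul_add, hN]
    exact ⟨⟨⟨_, _, g1, g2⟩, rfl⟩, ⟨⟨_, _, g2, g1⟩, rfl⟩⟩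
  -- case with nonzero last coefficient
  have step : ∀ (c y h : Matrix (Fin n) (Fin n) F), IsUnit y → IsUnit h →
      (∀ i j : Fin n, i.val = k → j.val + 1 = k → c i j ≠ 0) → ZZ ψ k l ε c y h = 0 := by
    intro c y h hy hh hc
    by_cases hk : k < n ∧ 0 < k
    swap
    · apply ZZ_of_P k l hP ε c y h hy hh
      intro i j hi hj; exfalso; omega
    obtain ⟨hkn, hk0⟩ := hk
    let kk : Fin n := ⟨k, hkn⟩
    let km : Fin n := ⟨k-1, by omega⟩
    let N : Matrix (Fin n) (Fin n) F := fun i j =>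
      if i = km ∧ j.val + 1 < k then - c kk j / c kk km else 0
    have hN : N * N = 0 := by
      ext i j
      rw [Matrix.mul_apply]
      apply Finset.sum_eq_zero
      intro t _
      by_cases ht : t = km
      · have : N i t = 0 := by
          simp only [N]; rw [if_neg]; rintro ⟨_, h⟩; rw [ht] at h; simp [km] at h; omega
        simp [this]
      · have : N t j = 0 := by
          simp only [N]; rw [if_neg]; rintro ⟨h, _⟩; exact ht h
        simp [this]
    rw [ZZ_conj k l ε c y h N hN]
    · apply ZZ_of_P k l hP ε _ _ _ (hy.mul (unit1 N hN).1) ((unit1 N hN).2.mul hh)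
      intro i j hi hj
      have hik : i = kk := Fin.ext hi
      subst hik
      rw [mul_add, mul_one, Matrix.add_apply, Matrix.mul_apply, Finset.sum_eq_single km]
      · have : N km j = - c kk j / c kk km := by simp [N, hj]
        rw [this]
        have := hc kk km rfl (by simp [km]; omega)
        field_simp; ring
      · intro t _ ht
        have : N t j = 0 := by
          simp only [N]; rw [if_neg]; rintro ⟨h, _⟩; exact ht h
        simp [this]
      · simp
    · intro i j h
      simp only [N, ne_eq, ite_eq_right_iff, not_forall] at h
      obtain ⟨⟨h1, h2⟩, _⟩ := h
      subst h1
      simp [km]; omega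
  by_cases hall : ∀ i j : Fin n, i.val = k → j.val + 1 < k → c i j = 0
  · exact ZZ_of_P k l hP ε c y h hy hh hall
  by_cases hlast : ∀ i j : Fin n, i.val = k → j.val + 1 = k → c i j ≠ 0
  · exact step c y h hy hh hlast
  push Not at hall hlast
  obtain ⟨kk, j, hkk, hj, hcj⟩ := hall
  obtain ⟨kk', km, hkk', hkm, hcm⟩ := hlast
  have : kk' = kk := Fin.ext (by omega)
  subst this
  let N : Matrix (Fin n) (Fin n) F := Matrix.single j km 1
  have hjm : km ≠ j := by intro h; subst h; omega
  have hN : N * N = 0 := by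
    simp [N, hjm]
  rw [ZZ_conj k l ε c y h N hN]
  · apply step _ _ _ (hy.mul (unit1 N hN).1) ((unit1 N hN).2.mul hh)
    intro i j' hi hj'
    have : i = kk' := Fin.ext (by omega)
    subst this
    have : j' = km := Fin.ext (by omega)
    subst this
    simpa [mul_add, hcm, N] using hcj
  · intro a b hab
    simp only [N, Matrix.single_apply, ne_eq, ite_eq_right_iff, not_forall] at hab
    obtain ⟨⟨h1, h2⟩, _⟩ := hab
    subst h1; subst h2; omega

lemma P_step (hψ : ∃ a : F, ψ a ≠ 1) (k : ℕ) (l : Matrix (Fin n) (Fin n) F → ℂ)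
    (hP : ∀ (ε : Fin n → F) (y h : Matrix (Fin n) (Fin n) F), IsUnit y → IsUnit h →
      ∑ m with NN k m, ψ (-(Jm ε * m).trace) * l (y * (1 + m) * h) = 0)
    (ε : Fin n → F) (y h : Matrix (Fin n) (Fin n) F) (hy : IsUnit y) (hh : IsUnit h) :
      ∑ m with NN (k+1) m, ψ (-(Jm ε * m).trace) * l (y * (1 + m) * h) = 0 := by
  have h1 : ∑ c, ZZ ψ k l ε c y h = 0 := Finset.sum_eq_zero (fun c _ => ZZ_zero k l hP ε c y h hy hh)
  unfold ZZ at h1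
  rw [Finset.sum_comm] at h1
  have h2 : ∀ m : Matrix (Fin n) (Fin n) F, ∑ c : Matrix (Fin n) (Fin n) F, ∑ a with CC k a,
      ψ (-(Jm ε * m).trace - (c * a).trace) * l (y * (1 + m + a) * h)
      = (Fintype.card (Matrix (Fin n) (Fin n) F) : ℂ) * (ψ (-(Jm ε * m).trace) * l (y * (1 + m) * h)) := by
    intro m
    rw [Finset.sum_comm]
    rw [Finset.sum_eq_single (0 : Matrix (Fin n) (Fin n) F)]
    · simp
    · intro a _ ha
      have : ∀ c : Matrix (Fin n) (Fin n) F, ψ (-(Jm ε * m).trace - (c * a).trace) * l (y * (1 + m + a) * h)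
        = (ψ (-(Jm ε * m).trace) * l (y * (1 + m + a) * h)) * ψ ((c * (-a)).trace) := by
        intro c
        rw [sub_eq_add_neg, AddChar.map_add_eq_mul, mul_neg, Matrix.trace_neg]; ring
      simp_rw [this, ← Finset.mul_sum, sum_psi_trace hψ]
      simp [ha]
    · intro h; exfalso; apply h; exact Finset.mem_filter.2 ⟨Finset.mem_univ _, fun i j h => absurd rfl h⟩
  simp_rw [h2, ← Finset.mul_sum] at h1
  rcases mul_eq_zero.1 h1 with h | h
  · exfalso; simp at h
  · exact h

lemma span_zero (hψ : ∃ a : F, ψ a ≠ 1) (l : Matrix (Fin n) (Fin n) F → ℂ)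
    (hP : ∀ (ε : Fin n → F) (y h : Matrix (Fin n) (Fin n) F), IsUnit y → IsUnit h →
      ∑ m with NN 0 m, ψ (-(Jm ε * m).trace) * l (y * (1 + m) * h) = 0)
    (x : Matrix (Fin n) (Fin n) F) (hx : IsUnit x) : l x = 0 := by
  have : ∀ k : ℕ, ∀ (ε : Fin n → F) (y h : Matrix (Fin n) (Fin n) F), IsUnit y → IsUnit h →
      ∑ m with NN k m, ψ (-(Jm ε * m).trace) * l (y * (1 + m) * h) = 0 := by
    intro k
    induction k with
    | zero => exact hP
    | succ k ih => exact P_step hψ k l ih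
  have h := this n 0 x 1 hx isUnit_one
  have h2 : (Finset.univ.filter (NN (F := F) (n := n) n)) = {0} := by
    ext m
    simp only [Finset.mem_filter, Finset.mem_univ, true_and, Finset.mem_singleton]
    constructor
    · intro hm; ext i j
      by_contra h0
      have := (hm i j h0).2
      omega
    · rintro rfl; simp [NN]
  rw [h2] at h
  simpa using h
end span
end KL

set_option linter.unusedSectionVars false
namespace KL
open Matrix

section L1
variable {F : Type} [Field F] [Fintype F] [DecidableEq F] {ψ : AddChar F ℂ} {n : ℕ}

lemma isIntegral_psi (ψ : AddChar F ℂ) (a : F) : IsIntegral ℤ (ψ a) := by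
  have h : (ψ a) ^ (Fintype.card F) = 1 := by
    rw [← AddChar.map_nsmul_eq_pow]; simp
  exact IsIntegral.of_pow Fintype.card_pos (by rw [h]; exact isIntegral_one)

lemma NN0_iff (m : Matrix (Fin n) (Fin n) F) : NN 0 m ↔ ∀ i j, j ≤ i → m i j = 0 := by
  constructor
  · intro h i j hij
    by_contra h0; exact absurd (h i j h0).1 (not_lt.2 hij)
  · intro h i j h0
    refine ⟨?_, by omega⟩
    by_contra hlt; exact h0 (h i j (not_lt.1 hlt))

lemma NN0_mul {m m' : Matrix (Fin n) (Fin n) F} (h : NN 0 m) (h' : NN 0 m') : NN 0 (m * m') := by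
  rw [NN0_iff] at *
  intro i j hij
  rw [Matrix.mul_apply]
  apply Finset.sum_eq_zero; intro t _
  rcases le_or_gt t i with h1 | h1
  · rw [h i t h1]; simp
  · rw [h' t j (hij.trans h1.le)]; simp

lemma NN0_add {m m' : Matrix (Fin n) (Fin n) F} (h : NN 0 m) (h' : NN 0 m') : NN 0 (m + m') := by
  rw [NN0_iff] at *
  intro i j hij; simp [h i j hij, h' i j hij]

lemma NN0_zero : NN 0 (0 : Matrix (Fin n) (Fin n) F) := by
  rw [NN0_iff]; intros; rfl

lemma NN0_unit {m : Matrix (Fin n) (Fin n) F} (h : NN 0 m) : IsUnit (1 + m) := by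
  rw [Matrix.isUnit_iff_isUnit_det, Matrix.det_of_isUpperTriangular]
  · rw [NN0_iff] at h
    simp [h]
  · intro i j hij
    rw [NN0_iff] at h
    have hij' : j < i := hij
    rw [Matrix.add_apply, h i j hij'.le, Matrix.one_apply_ne (ne_of_gt hij'), add_zero]

lemma Jm_mul {ε : Fin n → F} {m m' : Matrix (Fin n) (Fin n) F} (h : NN 0 m) (h' : NN 0 m') :
    (Jm ε * (m * m')).trace = 0 := by
  rw [Matrix.trace]
  apply Finset.sum_eq_zero
  intro i _
  rw [Matrix.diag_apply, Matrix.mul_apply]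
  apply Finset.sum_eq_zero
  intro j _
  rw [Jm]
  split_ifs with h1
  · have : (m * m') j i = 0 := by
      rw [Matrix.mul_apply]
      apply Finset.sum_eq_zero
      intro t _
      by_cases h2 : m j t = 0
      · simp [h2]
      by_cases h3 : m' t i = 0
      · simp [h3]
      have a := (h j t h2).1; have b := (h' t i h3).1
      rw [Fin.lt_def] at a b; omega
    simp [this]
  · simp

/-- unitriangular group -/
def UU (F : Type) [Field F] [Fintype F] [DecidableEq F] (n : ℕ) : Subgroup (Matrix (Fin n) (Fin n) F)ˣ where
  carrier := {u | NN 0 (u.val - 1)}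
  one_mem' := by simp [NN0_zero]
  mul_mem' := by
    intro a b ha hb
    simp only [Set.mem_ofPred_eq] at *
    have : ((a * b : (Matrix (Fin n) (Fin n) F)ˣ) : Matrix (Fin n) (Fin n) F) - 1
      = (a.val - 1) * (b.val - 1) + (a.val - 1) + (b.val - 1) := by
      rw [Units.val_mul]; noncomm_ring
    rw [this]
    exact NN0_add (NN0_add (NN0_mul ha hb) ha) hb
  inv_mem' := by
    intro a ha
    simp only [Set.mem_ofPred_eq] at *
    have h1 : ∀ k : ℕ, NN 0 ((a ^ k : (Matrix (Fin n) (Fin n) F)ˣ).val - 1) := by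
      intro k
      induction k with
      | zero => simp [NN0_zero]
      | succ k ih =>
        have : ((a ^ (k+1) : (Matrix (Fin n) (Fin n) F)ˣ) : Matrix (Fin n) (Fin n) F) - 1
          = ((a^k).val - 1) * (a.val - 1) + ((a^k).val - 1) + (a.val - 1) := by
          rw [pow_succ, Units.val_mul]; noncomm_ring
        rw [this]
        exact NN0_add (NN0_add (NN0_mul ih ha) ih) ha
    have h2 : a⁻¹ = a ^ (Fintype.card (Matrix (Fin n) (Fin n) F)ˣ - 1) := by
      rw [inv_eq_iff_mul_eq_one, ← pow_succ', Nat.sub_add_cancel Fintype.card_pos, pow_card_eq_one]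
    rw [h2]; exact h1 _

lemma mem_UU (u : (Matrix (Fin n) (Fin n) F)ˣ) : u ∈ UU F n ↔ NN 0 (u.val - 1) := Iff.rfl

open Classical in
noncomputable def Fc (ψ : AddChar F ℂ) (ε : Fin n → F) (C : Matrix (Fin n) (Fin n) F) : ℂ :=
  if ∀ m, NN 0 m → (C * m).trace = (Jm ε * m).trace then ψ C.trace else 0

lemma Fc_equiv (ε : Fin n → F) (C : Matrix (Fin n) (Fin n) F) (u : (Matrix (Fin n) (Fin n) F)ˣ)
    (hu : u ∈ UU F n) : Fc ψ ε (C * u.val) = ψ (Jm ε * (u.val - 1)).trace * Fc ψ ε C := by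
  classical
  have key : ∀ (u : (Matrix (Fin n) (Fin n) F)ˣ) (C : Matrix (Fin n) (Fin n) F), u ∈ UU F n →
     (∀ m, NN 0 m → (C * m).trace = (Jm ε * m).trace) →
     (∀ m, NN 0 m → ((C * u.val) * m).trace = (Jm ε * m).trace) := by
    intro u C hu h m hm
    rw [mem_UU] at hu
    have e : u.val * m = (u.val - 1) * m + m := by noncomm_ring
    rw [mul_assoc, e, h _ (NN0_add (NN0_mul hu hm) hm), mul_add, Matrix.trace_add, Jm_mul hu hm, zero_add]
  unfold Fc
  by_cases h : ∀ m, NN 0 m → (C * m).trace = (Jm ε * m).trace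
  · rw [if_pos h, if_pos (key u C hu h), ← AddChar.map_add_eq_mul, ← h _ hu, mul_sub, mul_one,
      Matrix.trace_sub]
    congr 1; ring
  · rw [if_neg h, if_neg, mul_zero]
    intro h'
    apply h
    have := key u⁻¹ _ ((UU F n).inv_mem hu) h'
    simpa [mul_assoc] using this

lemma card_NN0 : (Finset.univ.filter (NN (F := F) (n := n) 0)).card = Fintype.card F ^ (n * (n-1) / 2) := by
  classical
  let e : {m : Matrix (Fin n) (Fin n) F // NN 0 m} ≃ ({p : Fin n × Fin n // p.1 < p.2} → F) :=
    { toFun := fun m p => m.1 p.1.1 p.1.2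
      invFun := fun f => ⟨Matrix.of fun i j => if h : i < j then f ⟨(i,j), h⟩ else 0, by
        rw [NN0_iff]; intro i j hij; rw [Matrix.of_apply, dif_neg (not_lt.2 hij)]⟩
      left_inv := by
        rintro ⟨m, hm⟩
        ext i j
        simp only [Matrix.of_apply]
        split_ifs with h
        · rfl
        · rw [NN0_iff] at hm; exact (hm i j (not_lt.1 h)).symm
      right_inv := by
        intro f
        ext ⟨⟨i, j⟩, h⟩
        have h' : i < j := h
        simp [h'] }
  rw [← Fintype.card_subtype, Fintype.card_congr e, Fintype.card_fun]
  congr 1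
  rw [Fintype.card_subtype]
  rw [← Finset.sum_range_id, ← Fin.sum_univ_eq_sum_range (fun i => i) n]
  rw [Finset.card_filter, Fintype.sum_prod_type_right]
  apply Finset.sum_congr rfl
  intro j _
  rw [← Finset.card_filter]
  have : (Finset.univ.filter (fun i : Fin n => i < j)) = Finset.Iio j := by ext; simp
  simp only [this]
  simp

theorem L1 (hψ : ∃ a : F, ψ a ≠ 1) (A : (Matrix (Fin n) (Fin n) F)ˣ) (B : Matrix (Fin n) (Fin n) F) :
    ∃ z : ℂ, IsIntegral ℤ z ∧ ∑ x : (Matrix (Fin n) (Fin n) F)ˣ,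
      ψ ((x⁻¹ : (Matrix (Fin n) (Fin n) F)ˣ).val * A.val * x.val * B).trace
        = (Fintype.card F : ℂ) ^ (n * (n-1) / 2) * z := by
  classical
  set Nn : ℂ := (Fintype.card F : ℂ) ^ (n * (n-1) / 2) with hNn
  have hN0 : Nn ≠ 0 := by rw [hNn]; apply pow_ne_zero; simp
  have hcard : ((Finset.univ.filter (NN (F := F) (n := n) 0)).card : ℂ) = Nn := by
    rw [card_NN0]; push_cast; rfl
  let r : (Matrix (Fin n) (Fin n) F)ˣ → (Matrix (Fin n) (Fin n) F)ˣ := fun g => Quotient.out (Quotient.mk (QuotientGroup.rightRel (UU F n)) g)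
  have hr1 : ∀ g, g * (r g)⁻¹ ∈ UU F n := by
    intro g
    have : (QuotientGroup.rightRel (UU F n)) (r g) g := Quotient.exact (Quotient.out_eq _)
    rwa [QuotientGroup.rightRel_apply] at this
  have hr2 : ∀ u g, u ∈ UU F n → r (u * g) = r g := by
    intro u g hu
    simp only [r]
    congr 1
    apply Quotient.sound
    change (QuotientGroup.rightRel (UU F n)) _ _
    rw [QuotientGroup.rightRel_apply]
    have : g * (u * g)⁻¹ = u⁻¹ := by group
    rw [this]; exact (UU F n).inv_mem hu
  let T : Matrix (Matrix (Fin n) (Fin n) F)ˣ (Matrix (Fin n) (Fin n) F)ˣ ℂ := Matrix.of fun x y => Nn⁻¹ * ψ ((x⁻¹ : (Matrix (Fin n) (Fin n) F)ˣ).val * A.val * y.val * B).trace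
  let V : Matrix (Matrix (Fin n) (Fin n) F)ˣ ((Matrix (Fin n) (Fin n) F)ˣ × (Fin n → F) × (Matrix (Fin n) (Fin n) F)ˣ) ℂ := Matrix.of fun x p =>
    ∑ m with NN 0 m, ψ (-(Jm p.2.1 * m).trace) * (if (x : Matrix (Fin n) (Fin n) F) = p.1.val * (1 + m) * p.2.2.val then 1 else 0)
  let AA : Matrix ((Matrix (Fin n) (Fin n) F)ˣ × (Fin n → F) × (Matrix (Fin n) (Fin n) F)ˣ) ((Matrix (Fin n) (Fin n) F)ˣ × (Fin n → F) × (Matrix (Fin n) (Fin n) F)ˣ) ℂ := Matrix.of fun p' p =>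
    if p'.1 = A * p.1 ∧ p'.2.1 = p.2.1 ∧ r p'.2.2 = p'.2.2 then
      Fc ψ p.2.1 (p.2.2.val * B * (p'.2.2⁻¹ : (Matrix (Fin n) (Fin n) F)ˣ).val) else 0
  have hIntg : IsIntegral ℤ T.trace := by
    apply trace_integral T V AA
    · intro p' p
      simp only [AA, Fc, Matrix.of_apply]
      split_ifs
      · exact isIntegral_psi _ _
      · exact isIntegral_zero
      · exact isIntegral_zero
    · ext x ⟨y, ε, h⟩
      have hL : (T * V) x (y, ε, h) = Fc ψ ε (h.val * B * (x⁻¹ : (Matrix (Fin n) (Fin n) F)ˣ).val * A.val * y.val) := by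
        set C := h.val * B * (x⁻¹ : (Matrix (Fin n) (Fin n) F)ˣ).val * A.val * y.val with hC
        rw [Matrix.mul_apply]
        simp only [T, V, Finset.mul_sum, Matrix.of_apply]
        rw [Finset.sum_comm]
        have h1 : ∀ m ∈ Finset.univ.filter (NN (F := F) (n := n) 0), ∑ x' : (Matrix (Fin n) (Fin n) F)ˣ,
            Nn⁻¹ * ψ ((x⁻¹ : (Matrix (Fin n) (Fin n) F)ˣ).val * A.val * x'.val * B).trace * (ψ (-(Jm ε * m).trace) *
              (if (x' : Matrix (Fin n) (Fin n) F) = y.val * (1 + m) * h.val then 1 else 0))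
            = Nn⁻¹ * ψ C.trace * ψ (trL (C - Jm ε) m) := by
          intro m hm
          simp only [Finset.mem_filter, Finset.mem_univ, true_and] at hm
          obtain ⟨u, hu⟩ := NN0_unit hm
          rw [← hu, Finset.sum_eq_single (y * u * h)]
          · simp only [Units.val_mul, if_true, mul_one]
            have e1 : ((x⁻¹ : (Matrix (Fin n) (Fin n) F)ˣ).val * A.val * (y.val * u.val * h.val) * B).trace = C.trace + (C * m).trace := by
              rw [← Matrix.trace_add, ← mul_one_add, ← hu, hC]
              have : (x⁻¹ : (Matrix (Fin n) (Fin n) F)ˣ).val * A.val * (y.val * u.val * h.val) * B =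
                ((x⁻¹ : (Matrix (Fin n) (Fin n) F)ˣ).val * A.val * y.val * u.val) * (h.val * B) := by simp only [mul_assoc]
              rw [this, Matrix.trace_mul_comm]
              simp only [mul_assoc]
            rw [e1, trL_apply, sub_mul, Matrix.trace_sub, sub_eq_add_neg, AddChar.map_add_eq_mul,
              AddChar.map_add_eq_mul]
            ring
          · intro x' _ hx'
            rw [if_neg]
            · simp
            · intro h0; apply hx'; ext1; rw [h0]; simp
          · simp
        rw [Finset.sum_congr rfl h1, ← Finset.mul_sum]
        let W : Submodule F (Matrix (Fin n) (Fin n) F) :=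
          { carrier := {m | NN 0 m}
            add_mem' := NN0_add
            zero_mem' := NN0_zero
            smul_mem' := by
              intro c m hm
              simp only [Set.mem_ofPred_eq, NN0_iff] at *
              intro i j hij; simp [hm i j hij] }
        rw [sum_psi_filter hψ W (NN 0) (fun v => Iff.rfl) (trL (C - Jm ε))]
        unfold Fc
        have : (∀ v, NN 0 v → trL (C - Jm ε) v = 0) ↔ ∀ m, NN 0 m → (C * m).trace = (Jm ε * m).trace := by
          simp only [trL_apply, sub_mul, Matrix.trace_sub, sub_eq_zero]
        simp only [this, hcard]
        split_ifs
        · field_simp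
        · simp
      have hR : (V * AA) x (y, ε, h) = Fc ψ ε (h.val * B * (x⁻¹ : (Matrix (Fin n) (Fin n) F)ˣ).val * A.val * y.val) := by
        rw [Matrix.mul_apply, Fintype.sum_prod_type]
        rw [Finset.sum_eq_single (A * y)]
        · rw [Fintype.sum_prod_type, Finset.sum_eq_single ε]
          · simp only [AA, V, Finset.sum_mul, Matrix.of_apply]
            rw [Finset.sum_comm]
            set g : (Matrix (Fin n) (Fin n) F)ˣ := (A * y)⁻¹ * x with hg
            -- the unique m
            have hm0 : NN 0 ((g * (r g)⁻¹ : (Matrix (Fin n) (Fin n) F)ˣ).val - 1) := hr1 g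
            rw [Finset.sum_eq_single ((g * (r g)⁻¹ : (Matrix (Fin n) (Fin n) F)ˣ).val - 1)]
            · rw [Finset.sum_eq_single (r g)]
              · have e1 : (x : Matrix (Fin n) (Fin n) F) = (A * y : (Matrix (Fin n) (Fin n) F)ˣ).val * (1 + ((g * (r g)⁻¹ : (Matrix (Fin n) (Fin n) F)ˣ).val - 1)) * (r g).val := by
                  rw [add_sub_cancel, ← Units.val_mul, ← Units.val_mul]
                  congr 1; rw [hg]; group
                have e2 : r (r g) = r g := by
                  have : r g = (g * (r g)⁻¹)⁻¹ * g := by group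
                  conv_lhs => rw [this]
                  exact hr2 _ _ ((UU F n).inv_mem (hr1 g))
                rw [if_pos e1]
                simp only [e2, true_and, and_true, if_true, mul_one]
                have e3 : h.val * B * ((r g)⁻¹ : (Matrix (Fin n) (Fin n) F)ˣ).val = (h.val * B * (g⁻¹ : (Matrix (Fin n) (Fin n) F)ˣ).val) * (g * (r g)⁻¹ : (Matrix (Fin n) (Fin n) F)ˣ).val := by
                  rw [Units.val_mul, ← mul_assoc, mul_assoc (h.val * B), ← Units.val_mul, inv_mul_cancel]; simp
                rw [e3, Fc_equiv ε _ _ (hr1 g), ← mul_assoc, ← AddChar.map_add_eq_mul, neg_add_cancel,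
                  AddChar.map_zero_eq_one, one_mul]
                congr 1
                rw [hg, _root_.mul_inv_rev, inv_inv]
                simp only [Units.val_mul, mul_assoc]
              · intro h' _ hh'
                by_cases hrr : r h' = h'
                · rw [if_neg]
                  · simp
                  · intro hx
                    rw [add_sub_cancel, ← Units.val_mul, ← Units.val_mul, Units.val_inj] at hx
                    apply hh'
                    have : g = g * (r g)⁻¹ * h' := by
                      conv_lhs => rw [hg, hx]
                      group
                    have h2 : (r g)⁻¹ * h' = 1 := by
                      have := congrArg (fun z => g⁻¹ * z) this
                      simp only [inv_mul_cancel] at this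
                      rw [this]; group
                    exact (inv_mul_eq_one.1 h2).symm
                · simp [hrr]
              · simp
            · intro m hm hne
              simp only [Finset.mem_filter, Finset.mem_univ, true_and] at hm
              apply Finset.sum_eq_zero
              intro h' _
              by_cases hrr : r h' = h'
              · rw [if_neg]
                · simp
                · intro hx
                  obtain ⟨u, hu⟩ := NN0_unit hm
                  have huU : u ∈ UU F n := by
                    rw [mem_UU, hu]; simpa using hm
                  rw [← hu, ← Units.val_mul, ← Units.val_mul, Units.val_inj] at hx
                  have h1 : g = u * h' := by rw [hg, hx]; group
                  have h2 : r g = h' := by rw [h1, hr2 _ _ huU, hrr]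
                  apply hne
                  rw [h2, h1, mul_assoc, mul_inv_cancel, mul_one, hu]; simp
              · simp [hrr]
            · intro hh
              exfalso; apply hh
              simp only [Finset.mem_filter, Finset.mem_univ, true_and]; exact hm0
          · intro ε' _ hε'
            apply Finset.sum_eq_zero
            intro h' _
            simp [AA, hε']
          · simp
        · intro y' _ hy'
          apply Finset.sum_eq_zero
          intro p _
          simp [AA, hy']
        · simp
      rw [hL, hR]
    · intro l hl
      let l' : Matrix (Fin n) (Fin n) F → ℂ := fun x => if h : IsUnit x then l h.unit else 0
      have h0 := span_zero hψ l' (by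
        rintro ε _ _ ⟨y, rfl⟩ ⟨h, rfl⟩
        have h1 := congrFun hl (y, ε, h)
        simp only [Matrix.vecMul, dotProduct, V, Matrix.of_apply, Finset.mul_sum, Pi.zero_apply] at h1
        rw [Finset.sum_comm] at h1
        rw [← h1]
        apply Finset.sum_congr rfl
        intro m hm
        simp only [Finset.mem_filter, Finset.mem_univ, true_and] at hm
        obtain ⟨u, hu⟩ := NN0_unit hm
        rw [← hu, Finset.sum_eq_single (y * u * h)]
        · have : IsUnit (y.val * u.val * h.val) := ⟨y * u * h, by simp⟩
          simp only [l', dif_pos this]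
          have h2 : this.unit = y * u * h := by ext1; simp
          rw [h2]; simp [mul_comm]
        · intro x' _ hx'
          rw [if_neg]
          · simp
          · intro h0; apply hx'; ext1; rw [h0]; simp
        · simp)
      funext x
      have := h0 x.val x.isUnit
      simpa [l'] using this
  refine ⟨T.trace, hIntg, ?_⟩
  rw [Matrix.trace]
  simp only [T, Matrix.diag_apply, Matrix.of_apply]
  rw [← Finset.mul_sum, ← mul_assoc, mul_inv_cancel₀ hN0, one_mul]
end L1
end KL

set_option linter.unusedSectionVars false
namespace KL
section qid
variable (Q : ℂ)

noncomputable def gq (j : ℕ) : ℂ := ∏ i ∈ Finset.range j, (Q ^ (i+1) - 1)⁻¹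
noncomputable def ij (j r : ℕ) : ℂ := ∏ i ∈ Finset.range j, (Q ^ r - Q ^ i)
noncomputable def Nq (r : ℕ) : ℂ := ∏ i ∈ Finset.range (r-1), (1 - Q ^ (i+1))

lemma ij_zero_of_lt {j r : ℕ} (h : r < j) : ij Q j r = 0 := by
  unfold ij; exact Finset.prod_eq_zero (Finset.mem_range.2 h) (by simp)

lemma ij_succ (j r : ℕ) : ij Q (j+1) r = ij Q j r * (Q^r - Q^j) := by
  unfold ij; rw [Finset.prod_range_succ]

lemma ij_succ_succ (j r : ℕ) : ij Q (j+1) (r+1) = (Q^(r+1) - 1) * Q^j * ij Q j r := by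
  unfold ij; rw [Finset.prod_range_succ']
  have : ∀ i ∈ Finset.range j, (Q^(r+1) - Q^(i+1)) = Q * (Q^r - Q^i) := by intro i _; ring
  rw [Finset.prod_congr rfl this, Finset.prod_mul_distrib]
  simp; ring

variable {Q}
lemma c_rec (hQ : ∀ i : ℕ, 1 ≤ i → Q ^ i ≠ 1) (j r : ℕ) :
    gq Q (j+1) * ij Q (j+1) (r+1) = gq Q (j+1) * ij Q (j+1) r + Q^r * (gq Q j * ij Q j r) := by
  rw [ij_succ_succ, ij_succ]
  have h : gq Q j = gq Q (j+1) * (Q^(j+1) - 1) := by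
    unfold gq; rw [Finset.prod_range_succ, mul_assoc, inv_mul_cancel₀, mul_one]
    exact sub_ne_zero.2 (hQ _ (by omega))
  rw [h]; ring

lemma qbinom (hQ : ∀ i : ℕ, 1 ≤ i → Q ^ i ≠ 1) (z : ℂ) (r m : ℕ) (hm : r ≤ m) :
    ∑ j ∈ Finset.range (m+1), (-z)^j * (gq Q j * ij Q j r) = ∏ i ∈ Finset.range r, (1 - z * Q^i) := by
  induction r generalizing m with
  | zero =>
    rw [Finset.sum_range_succ', Finset.sum_eq_zero]
    · simp [ij, gq]
    · intro x _; rw [ij_zero_of_lt Q (show 0 < x + 1 by omega)]; simp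
  | succ r ih =>
    obtain ⟨m, rfl⟩ : ∃ m', m = m' + 1 := ⟨m-1, by omega⟩
    rw [Finset.sum_range_succ', Finset.prod_range_succ, ← ih m (by omega)]
    simp_rw [c_rec hQ, mul_add, Finset.sum_add_distrib]
    have h1 := ih (m+1) (by omega)
    rw [← ih m (by omega), Finset.sum_range_succ'] at h1
    have h2 : ∀ x, (-z)^(x+1) * (Q^r * (gq Q x * ij Q x r)) = (-z) * Q^r * ((-z)^x * (gq Q x * ij Q x r)) := by
      intro x; ring
    simp_rw [h2, ← Finset.mul_sum]
    have h3 : ij Q 0 (r+1) = ij Q 0 r := by simp [ij]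
    rw [h3]
    linear_combination h1

lemma qbinom_one (hQ : ∀ i : ℕ, 1 ≤ i → Q ^ i ≠ 1) (r m : ℕ) (hm : r ≤ m) (hr : 1 ≤ r) :
    ∑ j ∈ Finset.range (m+1), (-1)^j * (gq Q j * ij Q j r) = 0 := by
  rw [qbinom hQ 1 r m hm]
  exact Finset.prod_eq_zero (Finset.mem_range.2 (show 0 < r by omega)) (by simp)

lemma newton (hQ : ∀ i : ℕ, 1 ≤ i → Q ^ i ≠ 1) (r m : ℕ) (hm : r ≤ m) (hr : 1 ≤ r) :
    ∑ j ∈ Finset.range m, (-1)^j * (j+1) * (gq Q (j+1) * ij Q (j+1) r) = Nq Q r := by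
  induction r, hr using Nat.le_induction generalizing m with
  | base =>
    obtain ⟨m, rfl⟩ : ∃ m', m = m' + 1 := ⟨m-1, by omega⟩
    rw [Finset.sum_range_succ', Finset.sum_eq_zero]
    · have := hQ 1 le_rfl
      have h : Q - 1 ≠ 0 := by simpa [sub_ne_zero] using this
      simp [gq, ij, Nq, h]
    · intro j _; rw [ij_zero_of_lt Q (show 1 < j + 1 + 1 by omega)]; simp
  | succ r hr ih =>
    have h0 : ∀ j ∈ Finset.range m, (-1 : ℂ)^j * ((j:ℂ)+1) * (gq Q (j+1) * ij Q (j+1) (r+1)) =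
      (-1 : ℂ)^j * ((j:ℂ)+1) * (gq Q (j+1) * ij Q (j+1) r) + (-1 : ℂ)^j * ((j:ℂ)+1) * (Q^r * (gq Q j * ij Q j r)) := by
      intro j _; rw [c_rec hQ]; ring
    rw [Finset.sum_congr rfl h0, Finset.sum_add_distrib, ih m (by omega)]
    have h1 : ∀ j ∈ Finset.range m, (-1 : ℂ)^j * ((j:ℂ)+1) * (Q^r * (gq Q j * ij Q j r)) =
      Q^r * ((-1)^j * j * (gq Q j * ij Q j r)) + Q^r * ((-1)^j * (gq Q j * ij Q j r)) := by
      intro j _; ring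
    have h1' : ∑ j ∈ Finset.range m, (-1 : ℂ)^j * ((j:ℂ)+1) * (Q^r * (gq Q j * ij Q j r)) =
      Q^r * ∑ j ∈ Finset.range m, ((-1)^j * j * (gq Q j * ij Q j r)) := by
      rw [Finset.sum_congr rfl h1, Finset.sum_add_distrib, ← Finset.mul_sum, ← Finset.mul_sum]
      obtain ⟨m, rfl⟩ : ∃ m', m = m' + 1 := ⟨m-1, by omega⟩
      rw [qbinom_one hQ r m (by omega) hr]; simp
    have h2 : ∑ j ∈ Finset.range m, ((-1:ℂ)^j * j * (gq Q j * ij Q j r)) = - Nq Q r := by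
      obtain ⟨m, rfl⟩ : ∃ m', m = m' + 1 := ⟨m-1, by omega⟩
      rw [Finset.sum_range_succ', ← ih m (by omega), ← Finset.sum_neg_distrib]
      simp only [Nat.cast_zero, mul_zero, zero_mul, add_zero]
      apply Finset.sum_congr rfl; intro j _; push_cast; ring
    have h4 : Nq Q (r+1) = Nq Q r * (1 - Q^r) := by
      unfold Nq
      obtain ⟨r, rfl⟩ : ∃ r', r = r' + 1 := ⟨r-1, by omega⟩
      simp only [Nat.add_sub_cancel]
      rw [Finset.prod_range_succ]
    rw [h4, h1', h2]; ring

lemma Nq_rel (hQ : ∀ i : ℕ, 1 ≤ i → Q ^ i ≠ 1) (r1 κ m : ℕ) (hm : κ ≤ m) (hr : 1 ≤ r1) :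
    Nq Q (r1 + κ) = Nq Q r1 * ∑ j ∈ Finset.range (m+1), (-1)^j * (gq Q j * ((Q^r1)^j * ij Q j κ)) := by
  have h := qbinom hQ (Q^r1) κ m hm
  have h1 : ∑ j ∈ Finset.range (m+1), (-1)^j * (gq Q j * ((Q^r1)^j * ij Q j κ)) =
    ∑ j ∈ Finset.range (m+1), (-(Q^r1))^j * (gq Q j * ij Q j κ) := by
    apply Finset.sum_congr rfl; intro j _; rw [neg_pow (Q^r1)]; ring
  rw [h1, h]
  unfold Nq
  obtain ⟨r, rfl⟩ : ∃ r', r1 = r' + 1 := ⟨r1-1, by omega⟩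
  have : r + 1 + κ - 1 = r + κ := by omega
  rw [this, Finset.prod_range_add, Nat.add_sub_cancel]
  congr 1
  apply Finset.prod_congr rfl; intro i _; ring

lemma gN (hQ : ∀ i : ℕ, 1 ≤ i → Q ^ i ≠ 1) (k : ℕ) (hk : 1 ≤ k) :
    (-1)^(k-1) * gq Q k * Nq Q k = (Q^k - 1)⁻¹ := by
  obtain ⟨k, rfl⟩ : ∃ r', k = r' + 1 := ⟨k-1, by omega⟩
  unfold gq Nq
  rw [Nat.add_sub_cancel, Finset.prod_range_succ]
  have : ∏ i ∈ Finset.range k, (1 - Q^(i+1)) = (-1)^k * ∏ i ∈ Finset.range k, (Q^(i+1) - 1) := by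
    rw [← Finset.card_range k, ← Finset.prod_const, Finset.card_range, ← Finset.prod_mul_distrib]
    apply Finset.prod_congr rfl; intro i _; ring
  rw [this, Finset.prod_inv_distrib]
  have h0 : ∏ i ∈ Finset.range k, (Q^(i+1) - 1) ≠ 0 :=
    Finset.prod_ne_zero_iff.2 (fun i _ => sub_ne_zero.2 (hQ _ (by omega)))
  have h1 : ((-1:ℂ)^k) * (-1)^k = 1 := by rw [← mul_pow]; simp
  have h2 := inv_mul_cancel₀ h0
  linear_combination ((Q ^ (k + 1) - 1)⁻¹) * (h1 * (∏ i ∈ Finset.range k, (Q^(i+1) - 1))⁻¹ * (∏ i ∈ Finset.range k, (Q^(i+1) - 1))+ h2)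
end qid
end KL

set_option linter.unusedSectionVars false
namespace KL
open Polynomial
section cnt
variable {F K V : Type} [Field F] [Field K] [Algebra F K] [AddCommGroup V] [Module F V]

/-- intertwiners `K → V` -/
def HX (θ : K) (X : V →ₗ[F] V) : Submodule F (K →ₗ[F] V) where
  carrier := {e | ∀ a, e (θ * a) = X (e a)}
  add_mem' := by intro a b ha hb c; simp [ha c, hb c]
  zero_mem' := by intro c; simp
  smul_mem' := by intro r a ha c; simp [ha c]

variable {θ : K} {X : V →ₗ[F] V}

instance : SMul K (HX θ X) := ⟨fun b e => ⟨e.1 ∘ₗ LinearMap.mulLeft F b, by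
  intro a; simp only [LinearMap.comp_apply, LinearMap.mulLeft_apply]
  rw [← e.2, mul_left_comm]⟩⟩

lemma HX_smul_apply (b : K) (e : HX θ X) (a : K) : (b • e : HX θ X).1 a = e.1 (b * a) := rfl

instance instModHX : Module K (HX θ X) where
  one_smul e := by ext a; simp [HX_smul_apply]
  mul_smul b c e := by ext a; simp only [HX_smul_apply]; congr 1; ring
  smul_zero b := by ext a; simp [HX_smul_apply]
  smul_add b e f := by ext a; simp [HX_smul_apply]
  add_smul b c e := by
    ext a; simp only [HX_smul_apply, Submodule.coe_add, LinearMap.add_apply, add_mul, map_add]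
  zero_smul e := by ext a; simp [HX_smul_apply]

/-- intertwiners with image in `W` -/
def HXW (θ : K) (X : V →ₗ[F] V) (W : Submodule F V) : Submodule K (HX θ X) where
  carrier := {e | ∀ a, e.1 a ∈ W}
  add_mem' := by intro a b ha hb c; exact W.add_mem (ha c) (hb c)
  zero_mem' := by intro c; exact W.zero_mem
  smul_mem' := by intro r a ha c; exact ha _

lemma HX_aeval (e : HX θ X) (g : F[X]) (a : K) : e.1 (aeval θ g * a) = aeval X g (e.1 a) := by
  induction g using Polynomial.induction_on' with
  | add p q hp hq => simp [add_mul, hp, hq]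
  | monomial n c =>
    simp only [aeval_monomial]
    have : ∀ a, e.1 (θ^n * a) = (X^n) (e.1 a) := by
      induction n with
      | zero => simp
      | succ n ih => intro a; rw [pow_succ, mul_assoc, ih, e.2, pow_succ]; rfl
    rw [mul_assoc, ← Algebra.smul_def, map_smul, this]; simp

lemma exists_HX [FiniteDimensional F K] (hθ : ∀ a : K, ∃ g : F[X], aeval θ g = a) (w : V) (hw : aeval X (minpoly F θ) w = 0) :
    ∃ e : HX θ X, e.1 1 = w := by
  obtain ⟨σ, hσ⟩ := LinearMap.exists_rightInverse_of_surjective (aeval θ : F[X] →ₐ[F] K).toLinearMap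
    (LinearMap.range_eq_top.2 hθ)
  have hσ' : ∀ a, aeval θ (σ a) = a := fun a => LinearMap.congr_fun hσ a
  have key : ∀ g : F[X], aeval θ g = 0 → aeval X g w = 0 := by
    intro g hg
    obtain ⟨h, rfl⟩ := minpoly.dvd F θ hg
    rw [mul_comm, map_mul]; simp [hw]
  let e0 : K →ₗ[F] V :=
    { toFun := fun a => aeval X (σ a) w
      map_add' := by intro a b; simp
      map_smul' := by intro a b; simp }
  refine ⟨⟨e0, ?_⟩, ?_⟩
  · intro a
    have := key (σ (θ * a) - Polynomial.X * σ a) (by simp [hσ'])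
    simp only [map_sub, map_mul, aeval_X, LinearMap.sub_apply, sub_eq_zero] at this
    exact this
  · have := key (σ 1 - 1) (by simp [hσ'])
    simp only [map_sub, LinearMap.sub_apply, sub_eq_zero, map_one] at this
    exact this

lemma HX_ext (hθ : ∀ a : K, ∃ g : F[X], aeval θ g = a) (e f : HX θ X) (h : e.1 1 = f.1 1) : e = f := by
  ext a
  obtain ⟨g, rfl⟩ := hθ a
  rw [← mul_one (aeval θ g), HX_aeval, HX_aeval, h]

lemma HX_ker (e : HX θ X) (a : K) : aeval X (minpoly F θ) (e.1 a) = 0 := by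
  rw [← HX_aeval]; simp

/-- evaluation at 1 -/
noncomputable def HX_equiv [FiniteDimensional F K] (hθ : ∀ a : K, ∃ g : F[X], aeval θ g = a) :
    HX θ X ≃ₗ[F] LinearMap.ker (aeval X (minpoly F θ)) :=
  LinearEquiv.ofBijective
    { toFun := fun e => ⟨e.1 1, HX_ker e 1⟩
      map_add' := by intro a b; rfl
      map_smul' := by intro a b; rfl }
    ⟨fun e f h => HX_ext hθ e f (congrArg Subtype.val h), fun w => by
      obtain ⟨e, he⟩ := exists_HX hθ w.1 w.2
      exact ⟨e, Subtype.ext he⟩⟩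

variable [Fintype F] [Fintype K] [Finite V]

instance : Finite (HX θ X) := by
  have : Finite (K →ₗ[F] V) := Finite.of_injective (fun f => (f : K → V)) DFunLike.coe_injective
  infer_instance

/-- intertwiners `K^j → V`, injective modulo `W` -/
def Inj (θ : K) (X : V →ₗ[F] V) (W : Submodule F V) (j : ℕ) : Set ((Fin j → K) →ₗ[F] V) :=
  {φ | (∀ y, X (φ y) = φ (θ • y)) ∧ ∀ y, φ y ∈ W → y = 0}

lemma int_aeval {j : ℕ} {φ : (Fin j → K) →ₗ[F] V} (h : ∀ y, X (φ y) = φ (θ • y)) (g : F[X]) (y : Fin j → K) :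
    aeval X g (φ y) = φ (aeval θ g • y) := by
  induction g using Polynomial.induction_on' generalizing y with
  | add p q hp hq => simp [add_smul, hp, hq]
  | monomial n c =>
    simp only [aeval_monomial]
    have : ∀ y, (X^n) (φ y) = φ (θ^n • y) := by
      induction n with
      | zero => simp
      | succ n ih => intro a; rw [pow_succ, Module.End.mul_apply, h, ih, pow_succ, mul_smul]
    simp [← Algebra.smul_def, this]

lemma stable_aeval {W : Submodule F V} (hW : ∀ x ∈ W, X x ∈ W) (g : F[X]) : ∀ x ∈ W, aeval X g x ∈ W := by
  induction g using Polynomial.induction_on' with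
  | add p q hp hq => intro x hx; rw [map_add]; exact W.add_mem (hp x hx) (hq x hx)
  | monomial n c =>
    have : ∀ x ∈ W, (X^n) x ∈ W := by
      induction n with
      | zero => simp
      | succ n ih => intro x hx; rw [pow_succ, Module.End.mul_apply]; exact ih _ (hW x hx)
    intro x hx
    simp only [aeval_monomial, ← Algebra.smul_def]
    exact W.smul_mem _ (this x hx)

lemma card_Inj_aux (hθ : ∀ a : K, ∃ g : F[X], aeval θ g = a) (W : Submodule F V) (hW : ∀ x ∈ W, X x ∈ W) (j : ℕ) :
    Nat.card (Inj θ X W j) = Nat.card {f : Fin j → HX θ X // LinearIndependent K (fun i => (HXW θ X W).mkQ (f i))} := by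
  symm
  have comb : ∀ (f : Fin j → HX θ X) (y : Fin j → K) (a : K),
      (LinearMap.lsum F (fun _ => K) F (fun i => (f i).1)) (a • y) = (∑ i, y i • f i : HX θ X).1 a := by
    intro f y a
    simp only [LinearMap.lsum_apply, LinearMap.coe_sum, Finset.sum_apply, LinearMap.comp_apply, LinearMap.proj_apply, Submodule.coe_sum]
    apply Finset.sum_congr rfl; intro i _; rw [HX_smul_apply]; simp [mul_comm]
  refine Nat.card_congr (Equiv.ofBijective (fun f => ⟨LinearMap.lsum F (fun _ => K) F (fun i => (f.1 i).1), ?_, ?_⟩) ⟨?_, ?_⟩)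
  · intro y
    simp only [LinearMap.lsum_apply, LinearMap.coe_sum, Finset.sum_apply, LinearMap.comp_apply, LinearMap.proj_apply, map_sum]
    apply Finset.sum_congr rfl; intro i _
    rw [← (f.1 i).2]; rfl
  · intro y hy
    have hl := Fintype.linearIndependent_iff.1 f.2 y (by
      simp_rw [← map_smul]
      rw [← map_sum, Submodule.mkQ_apply, Submodule.Quotient.mk_eq_zero]
      intro a
      obtain ⟨g, rfl⟩ := hθ a
      rw [← mul_one (aeval θ g), HX_aeval]
      apply stable_aeval hW
      rw [← comb]; simpa using hy)
    exact funext hl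
  · intro f g h
    have h' := congrArg Subtype.val h
    apply Subtype.ext; funext i; apply Subtype.ext
    have := (LinearMap.lsum F (fun _ : Fin j => K) F).injective h'
    exact congrFun this i
  · intro φ
    have hf : ∀ i, (φ.1 ∘ₗ LinearMap.single F (fun _ : Fin j => K) i) ∈ HX θ X := by
      intro i a
      simp only [LinearMap.comp_apply]
      rw [φ.2.1]; congr 1
      funext l; simp only [LinearMap.single_apply, Pi.smul_apply, Pi.single_apply, smul_eq_mul, mul_ite, mul_zero]
    have hs : LinearMap.lsum F (fun _ => K) F (fun i => φ.1 ∘ₗ LinearMap.single F (fun _ : Fin j => K) i) = φ.1 :=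
      (LinearMap.lsum F (fun _ : Fin j => K) F).apply_symm_apply φ.1
    refine ⟨⟨fun i => ⟨_, hf i⟩, ?_⟩, Subtype.ext hs⟩
    rw [Fintype.linearIndependent_iff]
    intro y hy
    simp_rw [← map_smul] at hy
    rw [← map_sum, Submodule.mkQ_apply, Submodule.Quotient.mk_eq_zero] at hy
    have := hy 1
    rw [← comb] at this
    simp only [one_smul] at this
    rw [hs] at this
    exact fun i => congrFun (φ.2.2 y this) i

lemma card_Inj (hθ : ∀ a : K, ∃ g : F[X], aeval θ g = a) (W : Submodule F V) (hW : ∀ x ∈ W, X x ∈ W) (j : ℕ) :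
    (Nat.card (Inj θ X W j) : ℂ) = ((Fintype.card K : ℂ) ^ (Module.finrank K (HXW θ X W))) ^ j *
      ij (Fintype.card K : ℂ) j (Module.finrank K (HX θ X ⧸ HXW θ X W)) := by
  classical
  rw [card_Inj_aux hθ W hW]
  have e1 : Nat.card {f : Fin j → HX θ X // LinearIndependent K (fun i => (HXW θ X W).mkQ (f i))} =
      Nat.card ({u : Fin j → (HX θ X ⧸ HXW θ X W) // LinearIndependent K u} × (Fin j → HXW θ X W)) := by
    let e : (HX θ X) ≃ (HX θ X ⧸ HXW θ X W) × (HXW θ X W) := AddSubgroup.addGroupEquivQuotientProdAddSubgroup (s := (HXW θ X W).toAddSubgroup)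
    have he : ∀ x, (e x).1 = (HXW θ X W).mkQ x := fun x => rfl
    refine Nat.card_congr (Equiv.ofBijective (fun f => (⟨fun i => (e (f.1 i)).1, f.2⟩, fun i => (e (f.1 i)).2)) ⟨?_, ?_⟩)
    · intro f g h
      apply Subtype.ext; funext i; apply e.injective
      have h1 := congrArg (fun z => z.1.1 i) h
      have h2 := congrArg (fun z => z.2 i) h
      exact Prod.ext h1 h2
    · rintro ⟨⟨u, hu⟩, v⟩
      refine ⟨⟨fun i => e.symm (u i, v i), ?_⟩, ?_⟩
      · simp_rw [← he]; simpa using hu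
      · simp
  have : Fintype (HX θ X) := Fintype.ofFinite _
  have : Fintype (HX θ X ⧸ HXW θ X W) := Fintype.ofFinite _
  rw [e1, Nat.card_prod]
  have e2 : Nat.card (Fin j → HXW θ X W) = ((Fintype.card K) ^ (Module.finrank K (HXW θ X W))) ^ j := by
    rw [Nat.card_fun, Nat.card_eq_fintype_card (α := Fin j), Fintype.card_fin]
    have : Fintype (HXW θ X W) := Fintype.ofFinite _
    rw [Nat.card_eq_fintype_card, Module.card_eq_pow_finrank (K := K)]
  rw [e2, mul_comm]
  push_cast
  congr 1
  by_cases hj : j ≤ Module.finrank K (HX θ X ⧸ HXW θ X W)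
  · rw [card_linearIndependent hj]
    unfold ij
    rw [Finset.prod_range]
    push_cast
    apply Finset.prod_congr rfl; intro i _
    rw [Nat.cast_sub]
    · push_cast; rfl
    · exact Nat.pow_le_pow_right Fintype.card_pos (by omega)
  · rw [ij_zero_of_lt _ (by omega)]
    rw [Nat.cast_eq_zero, Nat.card_eq_zero]
    left
    constructor
    rintro ⟨u, hu⟩
    have := hu.fintype_card_le_finrank
    simp at this; omega

end cnt
end KL

set_option linter.unusedSectionVars false
namespace KL
open Polynomial
open scoped Classical
section cusp
variable {F V : Type} [Field F] [AddCommGroup V] [Module F V] [Fintype F] [Finite V]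

/-- nilradical attached to `W` -/
def nW (W : Submodule F V) : Submodule F (V →ₗ[F] V) where
  carrier := {v | (∀ x, v x ∈ W) ∧ ∀ x ∈ W, v x = 0}
  add_mem' := by
    intro a b ha hb
    exact ⟨fun x => W.add_mem (ha.1 x) (hb.1 x), fun x hx => by simp [ha.2 x hx, hb.2 x hx]⟩
  zero_mem' := ⟨fun x => W.zero_mem, fun x _ => rfl⟩
  smul_mem' := by
    intro r a ha
    exact ⟨fun x => W.smul_mem _ (ha.1 x), fun x hx => by simp [ha.2 x hx]⟩

lemma nW_aeval {W : Submodule F V} {X v : V →ₗ[F] V} (hX : ∀ x ∈ W, X x ∈ W) (hv : v ∈ nW W) (g : F[X]) :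
    (∀ x ∈ W, aeval (X+v) g x = aeval X g x) ∧ ∀ x, aeval (X+v) g x - aeval X g x ∈ W := by
  induction g using Polynomial.induction_on' with
  | add p q hp hq =>
    refine ⟨fun x hx => ?_, fun x => ?_⟩
    · simp [hp.1 x hx, hq.1 x hx]
    · have := W.add_mem (hp.2 x) (hq.2 x)
      convert this using 1; simp; abel
  | monomial n c =>
    have h : (∀ x ∈ W, ((X+v)^n) x = (X^n) x) ∧ ∀ x, ((X+v)^n) x - (X^n) x ∈ W := by
      induction n with
      | zero => simp
      | succ n ih =>
        refine ⟨fun x hx => ?_, fun x => ?_⟩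
        · rw [pow_succ, pow_succ, Module.End.mul_apply, Module.End.mul_apply, LinearMap.add_apply, hv.2 x hx, add_zero]
          exact ih.1 _ (hX x hx)
        · rw [pow_succ, pow_succ, Module.End.mul_apply, Module.End.mul_apply, LinearMap.add_apply, map_add]
          have h1 := ih.2 (X x)
          have h2 : ((X+v)^n) (v x) ∈ W := by
            rw [ih.1 _ (hv.1 x)]
            have := stable_aeval hX (Polynomial.X^n) _ (hv.1 x)
            simpa using this
          convert W.add_mem h1 h2 using 1; abel
    simp only [aeval_monomial, ← Algebra.smul_def]
    refine ⟨fun x hx => by simp [h.1 x hx], fun x => ?_⟩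
    simp only [LinearMap.smul_apply, ← smul_sub]
    exact W.smul_mem _ (h.2 x)

lemma nW_primary1 {W : Submodule F V} {X v : V →ₗ[F] V} (hX : ∀ x ∈ W, X x ∈ W) (hv : v ∈ nW W) (p : F[X])
    (h : IsNilpotent (aeval X p)) : IsNilpotent (aeval (X+v) p) := by
  obtain ⟨m, hm⟩ := h
  refine ⟨m + m, ?_⟩
  rw [← map_pow, pow_add, map_mul]
  have hz : aeval X (p^m) = 0 := by rw [map_pow, hm]
  obtain ⟨h1, h2⟩ := nW_aeval hX hv (p^m)
  ext x
  rw [Module.End.mul_apply, h1, hz]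
  · simp
  · have := h2 x; rw [hz] at this; simpa using this

lemma nW_primary {W : Submodule F V} {X v : V →ₗ[F] V} (hX : ∀ x ∈ W, X x ∈ W) (hv : v ∈ nW W) (p : F[X]) :
    IsNilpotent (aeval (X+v) p) ↔ IsNilpotent (aeval X p) := by
  refine ⟨fun h => ?_, nW_primary1 hX hv p⟩
  have := nW_primary1 (X := X + v) (v := -v) (fun x hx => by simp [hv.2 x hx, hX x hx]) ((nW W).neg_mem hv) p h
  simpa using this

variable {K : Type} [Field K] [Algebra F K] [Fintype K]

/-- the function N -/
noncomputable def Nth (θ : K) (X : V →ₗ[F] V) : ℂ :=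
  if IsNilpotent (aeval X (minpoly F θ)) then Nq (Fintype.card K) (Module.finrank K (HX θ X)) else 0

variable {θ : K}

lemma hQK (i : ℕ) (hi : 1 ≤ i) : (Fintype.card K : ℂ)^i ≠ 1 := by
  have h : 1 < (Fintype.card K)^i := Nat.one_lt_pow (by omega) Fintype.one_lt_card
  have : (Fintype.card K)^i ≠ 1 := by omega
  exact_mod_cast this

lemma HXW_bot (X : V →ₗ[F] V) : HXW θ X ⊥ = ⊥ := by
  rw [eq_bot_iff]; intro e he
  rw [Submodule.mem_bot]
  ext a; have := he a; simpa using this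

lemma card_Inj_bot (hθ : ∀ a : K, ∃ g : F[X], aeval θ g = a) (X : V →ₗ[F] V) (j : ℕ) :
    (Nat.card (Inj θ X ⊥ j) : ℂ) = ij (Fintype.card K : ℂ) j (Module.finrank K (HX θ X)) := by
  rw [card_Inj hθ ⊥ (by intro x hx; rw [Submodule.mem_bot] at hx; simp [hx]), HXW_bot]
  have := Submodule.finrank_quotient_add_finrank (⊥ : Submodule K (HX θ X))
  simp only [finrank_bot, add_zero] at this ⊢
  rw [this]; simp

lemma nil_ker {U : Type} [AddCommGroup U] [Module F U] {P : U →ₗ[F] U} (hP : IsNilpotent P) (W : Submodule F U)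
    (hW : ∀ x ∈ W, P x ∈ W) (hW0 : W ≠ ⊥) : ∃ w ∈ W, w ≠ 0 ∧ P w = 0 := by
  by_contra hcon
  push Not at hcon
  obtain ⟨w, hw, hw0⟩ := W.ne_bot_iff.1 hW0
  have : ∀ m, (P^m) w ∈ W ∧ (P^m) w ≠ 0 := by
    intro m
    induction m with
    | zero => simp [hw, hw0]
    | succ m ih =>
      rw [pow_succ', Module.End.mul_apply]
      exact ⟨hW _ ih.1, hcon _ ih.1 ih.2⟩
  obtain ⟨m, hm⟩ := hP
  exact (this m).2 (by rw [hm]; rfl)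

lemma finrank_HXW_pos (hθ : ∀ a : K, ∃ g : F[X], aeval θ g = a) {X : V →ₗ[F] V} (h : IsNilpotent (aeval X (minpoly F θ)))
    (W : Submodule F V) (hW : ∀ x ∈ W, X x ∈ W) (hW0 : W ≠ ⊥) : 1 ≤ Module.finrank K (HXW θ X W) := by
  obtain ⟨w, hw, hw0, hw1⟩ := nil_ker h W (stable_aeval hW _) hW0
  obtain ⟨e, he⟩ := exists_HX hθ w hw1
  have : Nontrivial (HXW θ X W) := by
    refine ⟨⟨⟨e, ?_⟩, 0, ?_⟩⟩
    · intro a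
      obtain ⟨g, rfl⟩ := hθ a
      rw [← mul_one (aeval θ g), HX_aeval, he]
      exact stable_aeval hW _ _ hw
    · intro h
      apply hw0
      have h2 := congrArg (fun z => z.1.1 1) h
      simp only [he] at h2
      rw [h2]; rfl
  exact Module.finrank_pos (R := K) (M := HXW θ X W)

lemma finrank_HX_pos (hθ : ∀ a : K, ∃ g : F[X], aeval θ g = a) {X : V →ₗ[F] V} (h : IsNilpotent (aeval X (minpoly F θ)))
    [Nontrivial V] : 1 ≤ Module.finrank K (HX θ X) :=
  (finrank_HXW_pos hθ h (⊤ : Submodule F V) (fun _ _ => Submodule.mem_top) top_ne_bot).trans (Submodule.finrank_le (HXW θ X ⊤))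

variable [Fintype (V →ₗ[F] V)]

/-- cuspidal functions -/
def Cusp (f : (V →ₗ[F] V) → ℂ) : Prop :=
  ∀ W : Submodule F V, W ≠ ⊥ → W ≠ ⊤ → ∀ X : V →ₗ[F] V, (∀ x ∈ W, X x ∈ W) → ∑ v : nW W, f (X + v.1) = 0

lemma sum_Inj (X : V →ₗ[F] V) (W : Submodule F V) (hW : ∀ x ∈ W, X x ∈ W) (j : ℕ) :
    ∑ v : nW W, Nat.card (Inj θ (X + v.1) W j) = Nat.card (Inj θ (W.mapQ W X hW) ⊥ j) * Nat.card (nW W) := by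
  have hfin : ∀ U : Type, ∀ [AddCommGroup U] [Module F U] [Finite U], Finite ((Fin j → K) →ₗ[F] U) := fun U _ _ _ =>
    Finite.of_injective (fun f => (f : (Fin j → K) → U)) DFunLike.coe_injective
  have := hfin V
  rw [← Nat.card_sigma, ← Nat.card_prod]
  let X' := W.mapQ W X hW
  have mkX : ∀ x, W.mkQ (X x) = X' (W.mkQ x) := fun x => rfl
  have mk0 : ∀ x, W.mkQ x = 0 ↔ x ∈ W := fun x => by simp
  -- choices
  have hρ : ∀ φ : Inj θ X' ⊥ j, ∃ ρ : (V ⧸ W) →ₗ[F] (Fin j → K), ρ ∘ₗ φ.1 = LinearMap.id := fun φ =>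
    LinearMap.exists_leftInverse_of_injective φ.1 (LinearMap.ker_eq_bot'.2 (fun y hy => φ.2.2 y (by simpa using hy)))
  have hl : ∀ φ : Inj θ X' ⊥ j, ∃ φ0 : (Fin j → K) →ₗ[F] V, W.mkQ ∘ₗ φ0 = φ.1 := fun φ =>
    Module.projective_lifting_property _ _ (Submodule.mkQ_surjective W)
  choose ρ hρ using hρ
  choose L hL using hl
  have hρ' : ∀ φ y, ρ φ (φ.1 y) = y := fun φ y => LinearMap.congr_fun (hρ φ) y
  have hL' : ∀ φ y, W.mkQ (L φ y) = φ.1 y := fun φ y => LinearMap.congr_fun (hL φ) y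
  let mθ : (Fin j → K) →ₗ[F] (Fin j → K) := LinearMap.lsmul K (Fin j → K) θ |>.restrictScalars F
  have hmθ : ∀ y, mθ y = θ • y := fun y => rfl
  let D : ((Fin j → K) →ₗ[F] V) → ((Fin j → K) →ₗ[F] V) := fun φ => φ ∘ₗ mθ - X ∘ₗ φ
  have hD : ∀ φ y, D φ y = φ (θ • y) - X (φ y) := fun φ y => rfl
  have hbar : ∀ (v : nW W) (φ : Inj θ (X + v.1) W j), W.mkQ ∘ₗ φ.1 ∈ Inj θ X' ⊥ j := by
    intro v φ
    refine ⟨fun y => ?_, fun y hy => φ.2.2 y ?_⟩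
    · rw [LinearMap.comp_apply, LinearMap.comp_apply, ← φ.2.1 y, LinearMap.add_apply, map_add, mkX, (mk0 _).2 (v.2.1 _), add_zero]
    · rw [Submodule.mem_bot, LinearMap.comp_apply, mk0] at hy; exact hy
  let bar : (Σ v : nW W, Inj θ (X + v.1) W j) → Inj θ X' ⊥ j := fun z => ⟨_, hbar z.1 z.2⟩
  have hvD : ∀ (v : nW W) (φ : Inj θ (X + v.1) W j) y, v.1 (φ.1 y) = D φ.1 y := by
    intro v φ y
    have := φ.2.1 y
    rw [LinearMap.add_apply] at this
    rw [hD, ← this]; abel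
  have hDW : ∀ (φ' : Inj θ X' ⊥ j) (φ : (Fin j → K) →ₗ[F] V), W.mkQ ∘ₗ φ = φ'.1 → ∀ y, D φ y ∈ W := by
    intro φ' φ h y
    have h' : ∀ y, W.mkQ (φ y) = φ'.1 y := fun y => LinearMap.congr_fun h y
    rw [← mk0, hD, map_sub, mkX, h', h', φ'.2.1, sub_self]
  have hdW : ∀ (φ' : Inj θ X' ⊥ j) (φ : (Fin j → K) →ₗ[F] V), W.mkQ ∘ₗ φ = φ'.1 → ∀ y, (φ - L φ') y ∈ W := by
    intro φ' φ h y
    have h' : ∀ y, W.mkQ (φ y) = φ'.1 y := fun y => LinearMap.congr_fun h y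
    rw [← mk0, LinearMap.sub_apply, map_sub, h', hL', sub_self]
  let sec : (Σ v : nW W, Inj θ (X + v.1) W j) → nW W := fun z =>
    ⟨z.1.1 - D z.2.1 ∘ₗ ρ (bar z) ∘ₗ W.mkQ + (z.2.1 - L (bar z)) ∘ₗ ρ (bar z) ∘ₗ W.mkQ, by
      constructor
      · intro x
        exact W.add_mem (W.sub_mem (z.1.2.1 x) (hDW (bar z) _ rfl _)) (hdW (bar z) _ rfl _)
      · intro x hx
        simp only [LinearMap.add_apply, LinearMap.sub_apply, LinearMap.comp_apply, (mk0 x).2 hx, map_zero, z.1.2.2 x hx]; simp⟩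
  have hsec : ∀ z x, (sec z).1 x = z.1.1 x - D z.2.1 (ρ (bar z) (W.mkQ x)) + (z.2.1 - L (bar z)) (ρ (bar z) (W.mkQ x)) := fun z x => rfl
  have hsec2 : ∀ z y, (sec z).1 (L (bar z) y) = z.2.1 y - L (bar z) y := by
    intro z y
    rw [hsec, hL', hρ', ← hvD]
    have : z.1.1 ((z.2.1 - L (bar z)) y) = 0 := z.1.2.2 _ (hdW (bar z) _ rfl _)
    rw [LinearMap.sub_apply, map_sub, sub_eq_zero] at this
    rw [this, LinearMap.sub_apply]; abel
  refine Nat.card_congr (Equiv.ofBijective (fun z => (bar z, sec z)) ⟨?_, ?_⟩)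
  · rintro z1 z2 h
    simp only [Prod.mk.injEq] at h
    obtain ⟨hb, hs⟩ := h
    have hφ : z1.2.1 = z2.2.1 := by
      refine LinearMap.ext fun y => ?_
      have h1 := hsec2 z1 y
      rw [hs, hb, hsec2 z2 y] at h1
      exact (sub_left_inj.1 h1).symm
    have hv : z1.1 = z2.1 := by
      apply Subtype.ext; ext x
      have h1 := hsec z1 x
      rw [hs, hb, hsec z2 x, hφ] at h1
      have h2 := add_right_cancel h1
      exact (sub_left_inj.1 h2).symm
    obtain ⟨v1, φ1⟩ := z1
    obtain ⟨v2, φ2⟩ := z2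
    dsimp only at hv hφ
    subst hv
    congr
    exact Subtype.ext hφ
  · rintro ⟨φ', v'⟩
    let φ : (Fin j → K) →ₗ[F] V := L φ' + v'.1 ∘ₗ L φ'
    have hφ : ∀ y, φ y = L φ' y + v'.1 (L φ' y) := fun y => rfl
    have hφb : W.mkQ ∘ₗ φ = φ'.1 := by
      refine LinearMap.ext fun y => ?_
      rw [LinearMap.comp_apply, hφ, map_add, hL', (mk0 _).2 (v'.2.1 _), add_zero]
    let v : V →ₗ[F] V := v'.1 + D φ ∘ₗ ρ φ' ∘ₗ W.mkQ - v'.1 ∘ₗ L φ' ∘ₗ ρ φ' ∘ₗ W.mkQ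
    have hv : ∀ x, v x = v'.1 x + D φ (ρ φ' (W.mkQ x)) - v'.1 (L φ' (ρ φ' (W.mkQ x))) := fun x => rfl
    have hvn : v ∈ nW W := by
      refine ⟨fun x => ?_, fun x hx => ?_⟩
      · rw [hv]; exact W.sub_mem (W.add_mem (v'.2.1 _) (hDW φ' _ hφb _)) (v'.2.1 _)
      · rw [hv, (mk0 x).2 hx, v'.2.2 x hx]; simp
    have hφb' : ∀ y, W.mkQ (φ y) = φ'.1 y := fun y => LinearMap.congr_fun hφb y
    have hφI : φ ∈ Inj θ (X + v) W j := by
      refine ⟨fun y => ?_, fun y hy => ?_⟩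
      · have h1 : v'.1 (φ y) = v'.1 (L φ' y) := by
          rw [hφ, map_add, v'.2.2 _ (v'.2.1 _), add_zero]
        have h2 : v (φ y) = D φ y := by rw [hv, hφb', hρ', h1]; abel
        rw [LinearMap.add_apply, h2, hD]; abel
      · rw [← mk0, hφb'] at hy
        exact φ'.2.2 y (by simpa using hy)
    have hbz : bar ⟨⟨v, hvn⟩, ⟨φ, hφI⟩⟩ = φ' := Subtype.ext hφb
    refine ⟨⟨⟨v, hvn⟩, ⟨φ, hφI⟩⟩, Prod.ext hbz ?_⟩
    apply Subtype.ext; ext x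
    show (sec _).1 x = v'.1 x
    rw [hsec, hbz]
    have h5 : (φ - L φ') (ρ φ' (W.mkQ x)) = v'.1 (L φ' (ρ φ' (W.mkQ x))) := by
      rw [LinearMap.sub_apply, hφ]; abel
    show v x - D φ _ + (φ - L φ') _ = _
    rw [hv, h5]; abel

lemma mapQ_aeval {W : Submodule F V} {X : V →ₗ[F] V} (hW : ∀ x ∈ W, X x ∈ W) (g : F[X]) (x : V) :
    aeval (W.mapQ W X hW) g (W.mkQ x) = W.mkQ (aeval X g x) := by
  induction g using Polynomial.induction_on' generalizing x with
  | add p q hp hq => simp only [map_add, LinearMap.add_apply, hp, hq]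
  | monomial n c =>
    have : ∀ x, ((W.mapQ W X hW)^n) (W.mkQ x) = W.mkQ ((X^n) x) := by
      induction n with
      | zero => intro x; rfl
      | succ n ih =>
        intro x; rw [pow_succ, pow_succ, Module.End.mul_apply, Module.End.mul_apply, ← ih]; rfl
    simp only [aeval_monomial, ← Algebra.smul_def, LinearMap.smul_apply, this, map_smul]

theorem cusp_Nth (hθ : ∀ a : K, ∃ g : F[X], aeval θ g = a) : Cusp (fun X : V →ₗ[F] V => Nth θ X) := by
  intro W hW0 hW1 X hX
  have hfq : Finite (V ⧸ W) := Finite.of_surjective _ W.mkQ_surjective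
  by_cases hp : IsNilpotent (aeval X (minpoly F θ))
  swap
  · apply Finset.sum_eq_zero
    intro v _
    show Nth θ (X + v.1) = 0
    unfold Nth
    rw [if_neg (by rwa [nW_primary hX v.2])]
  have hst : ∀ v : nW W, ∀ x ∈ W, (X + v.1) x ∈ W := fun v x hx => by
    rw [LinearMap.add_apply, v.2.2 x hx, add_zero]; exact hX x hx
  have hr1 : ∀ v : nW W, Module.finrank K (HXW θ (X + v.1) W) = Module.finrank K (HXW θ X W) := by
    intro v
    have hc : Nat.card (HXW θ (X + v.1) W) = Nat.card (HXW θ X W) := by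
      refine Nat.card_congr (Equiv.ofBijective (fun e => ⟨⟨e.1.1, ?_⟩, e.2⟩) ⟨?_, ?_⟩)
      · intro a; rw [e.1.2, LinearMap.add_apply, v.2.2 _ (e.2 a), add_zero]
      · intro e f h
        apply Subtype.ext; apply Subtype.ext
        exact congrArg (fun z => z.1.1) h
      · intro e
        refine ⟨⟨⟨e.1.1, ?_⟩, e.2⟩, rfl⟩
        intro a; rw [e.1.2, LinearMap.add_apply, v.2.2 _ (e.2 a), add_zero]
    have : Fintype (HXW θ (X + v.1) W) := Fintype.ofFinite _
    have : Fintype (HXW θ X W) := Fintype.ofFinite _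
    rw [Nat.card_eq_fintype_card, Nat.card_eq_fintype_card, Module.card_eq_pow_finrank (K := K) (V := HXW θ (X + v.1) W), Module.card_eq_pow_finrank (K := K) (V := HXW θ X W)] at hc
    exact Nat.pow_right_injective Fintype.one_lt_card hc
  set r1 := Module.finrank K (HXW θ X W) with hr1d
  have hr1p : 1 ≤ r1 := finrank_HXW_pos hθ hp W hX hW0
  set r2 := Module.finrank K (HX θ (W.mapQ W X hX)) with hr2d
  have hr2p : 1 ≤ r2 := by
    have : Nontrivial (V ⧸ W) := Submodule.Quotient.nontrivial_iff.2 hW1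
    refine finrank_HX_pos hθ ?_
    obtain ⟨m, hm⟩ := hp
    refine ⟨m, ?_⟩
    rw [← map_pow] at hm ⊢
    ext x
    rw [LinearMap.comp_apply, mapQ_aeval, hm]; simp
  let κ : nW W → ℕ := fun v => Module.finrank K (HX θ (X+v.1) ⧸ HXW θ (X+v.1) W)
  have hκ : ∀ v, Module.finrank K (HX θ (X+v.1)) = r1 + κ v := by
    intro v
    rw [← Submodule.finrank_quotient_add_finrank (HXW θ (X+v.1) W), hr1 v, add_comm]
  let m := ∑ v, κ v + r2
  have hN : ∀ v : nW W, Nth θ (X + v.1) = Nq (Fintype.card K) r1 * ∑ j ∈ Finset.range (m+1), (-1)^j * (gq (Fintype.card K) j * (Nat.card (Inj θ (X+v.1) W j) : ℂ)) := by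
    intro v
    unfold Nth
    rw [if_pos ((nW_primary hX v.2 _).2 hp), hκ, Nq_rel hQK r1 (κ v) m _ hr1p]
    · congr 1
      apply Finset.sum_congr rfl; intro j _
      rw [card_Inj hθ W (hst v), hr1]
    · have : κ v ≤ ∑ v, κ v := Finset.single_le_sum (f := κ) (fun _ _ => Nat.zero_le _) (Finset.mem_univ v)
      omega
  show ∑ v : nW W, Nth θ (X + v.1) = 0
  simp_rw [hN]
  rw [← Finset.mul_sum, Finset.sum_comm]
  simp_rw [← Finset.mul_sum]
  have h3 : ∀ j, ∑ v : nW W, (Nat.card (Inj θ (X+v.1) W j) : ℂ) = ij (Fintype.card K) j r2 * Nat.card (nW W) := by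
    intro j
    have := sum_Inj (θ := θ) X W hX j
    rw [hr2d, ← card_Inj_bot hθ]
    exact_mod_cast this
  simp_rw [h3]
  have h4 : ∑ j ∈ Finset.range (m+1), (-1:ℂ)^j * (gq (Fintype.card K) j * (ij (Fintype.card K) j r2 * Nat.card (nW W))) =
      (∑ j ∈ Finset.range (m+1), (-1:ℂ)^j * (gq (Fintype.card K) j * ij (Fintype.card K) j r2)) * Nat.card (nW W) := by
    rw [Finset.sum_mul]; apply Finset.sum_congr rfl; intro j _; ring
  rw [h4, qbinom_one hQK r2 m (by omega) hr2p]; simp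

end cusp
end KL

set_option linter.unusedSectionVars false
namespace KL
open Polynomial
open scoped Classical
section pair
variable {F V : Type} [Field F] [AddCommGroup V] [Module F V] [Fintype F] [Finite V]

/-- class functions -/
def Cls (f : (V →ₗ[F] V) → ℂ) : Prop := ∀ (g : V ≃ₗ[F] V) (X : V →ₗ[F] V), f (g.conj X) = f X

variable [Fintype (V →ₗ[F] V)]

lemma cusp_avg {f : (V →ₗ[F] V) → ℂ} (hf : Cusp f) (W : Submodule F V) (h0 : W ≠ ⊥) (h1 : W ≠ ⊤)
    (A : (V →ₗ[F] V) → Prop) [DecidablePred A] (hA : ∀ X, A X → ∀ x ∈ W, X x ∈ W) (hi : ∀ X, ∀ v ∈ nW W, A X → A (X + v)) :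
    ∑ X, (if A X then f X else 0) = 0 := by
  have h : (Fintype.card (nW W) : ℂ) * ∑ X, (if A X then f X else 0) = 0 := by
    have h2 : ∀ v : nW W, ∑ X, (if A X then f X else 0) = ∑ X, (if A X then f (X + v.1) else 0) := by
      intro v
      rw [← Equiv.sum_comp (Equiv.addRight v.1)]
      apply Finset.sum_congr rfl; intro X _
      simp only [Equiv.coe_addRight]
      have : A (X + v.1) ↔ A X := by
        refine ⟨fun h => ?_, hi X _ v.2⟩
        have := hi _ _ ((nW W).neg_mem v.2) h
        simpa using this
      simp [this]
    calc (Fintype.card (nW W) : ℂ) * ∑ X, (if A X then f X else 0) = ∑ v : nW W, ∑ X, (if A X then f (X + v.1) else 0) := by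
          rw [← Finset.sum_congr rfl (fun v _ => h2 v)]; simp
      _ = 0 := by
          rw [Finset.sum_comm]
          apply Finset.sum_eq_zero; intro X _
          by_cases hX : A X
          · simp only [hX, if_true]; exact hf W h0 h1 X (hA X hX)
          · simp [hX]
  have hc : (Fintype.card (nW W) : ℂ) ≠ 0 := by exact_mod_cast Fintype.card_ne_zero
  exact (mul_eq_zero.1 h).resolve_left hc

variable {K : Type} [Field K] [Algebra F K] [Fintype K] {θ : K}

/-- multiplication by θ on K^k -/
def mθ (θ : K) (k : ℕ) : (Fin k → K) →ₗ[F] (Fin k → K) := (LinearMap.lsmul K (Fin k → K) θ).restrictScalars F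

lemma mθ_apply (k : ℕ) (y : Fin k → K) : mθ (F := F) θ k y = θ • y := rfl

lemma aeval_mθ (k : ℕ) (g : F[X]) (y : Fin k → K) : aeval (mθ (F := F) θ k) g y = aeval θ g • y :=
  int_aeval (X := mθ (F := F) θ k) (φ := LinearMap.id) (fun y => rfl) g y

lemma sum_prim_Inj (hθ : ∀ a : K, ∃ g : F[X], aeval θ g = a) {f : (V →ₗ[F] V) → ℂ} (hf : Cusp f) (hc : Cls f)
    {k : ℕ} (φ0 : (Fin k → K) ≃ₗ[F] V) (j : ℕ) :
    ∑ X, f X * (if IsNilpotent (aeval X (minpoly F θ)) then (Nat.card (Inj θ X ⊥ (j+1)) : ℂ) else 0) =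
      if j + 1 = k then (Nat.card (V ≃ₗ[F] V) : ℂ) * f (φ0.conj (mθ θ k)) else 0 := by
  have : Finite ((Fin (j+1) → K) →ₗ[F] V) :=
    Finite.of_injective (fun f => (f : (Fin (j+1) → K) → V)) DFunLike.coe_injective
  have : Fintype ((Fin (j+1) → K) →ₗ[F] V) := Fintype.ofFinite _
  have h1 : ∀ X : V →ₗ[F] V, (Nat.card (Inj θ X ⊥ (j+1)) : ℂ) = ∑ φ, if φ ∈ Inj θ X ⊥ (j+1) then 1 else 0 := by
    intro X
    rw [Nat.card_eq_fintype_card, Finset.sum_boole, Fintype.card_subtype]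
  have h2 : ∀ X : V →ₗ[F] V, f X * (if IsNilpotent (aeval X (minpoly F θ)) then (Nat.card (Inj θ X ⊥ (j+1)) : ℂ) else 0) =
      ∑ φ, if (IsNilpotent (aeval X (minpoly F θ)) ∧ φ ∈ Inj θ X ⊥ (j+1)) then f X else 0 := by
    intro X
    rw [h1]
    by_cases hX : IsNilpotent (aeval X (minpoly F θ))
    · simp only [hX, if_true, true_and, Finset.mul_sum, mul_ite, mul_one, mul_zero]
    · simp [hX]
  simp_rw [h2]
  rw [Finset.sum_comm]
  have h3 : ∀ φ : (Fin (j+1) → K) →ₗ[F] V,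
      ∑ X, (if (IsNilpotent (aeval X (minpoly F θ)) ∧ φ ∈ Inj θ X ⊥ (j+1)) then f X else 0) =
      if Function.Bijective φ then f (φ0.conj (mθ θ k)) else 0 := by
    intro φ
    by_cases hi : Function.Injective φ
    swap
    · rw [if_neg (fun h => hi h.1)]
      apply Finset.sum_eq_zero; intro X _
      rw [if_neg]
      rintro ⟨-, h⟩
      apply hi
      rw [injective_iff_map_eq_zero]
      exact fun y hy => h.2 y (by simpa using hy)
    by_cases hs : Function.Surjective φ
    · rw [if_pos ⟨hi, hs⟩]
      let φe : (Fin (j+1) → K) ≃ₗ[F] V := LinearEquiv.ofBijective φ ⟨hi, hs⟩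
      have hφe : ∀ y, φe y = φ y := fun y => rfl
      have hjk : j + 1 = k := by
        have := (φe.trans φ0.symm).finrank_eq
        rw [Module.finrank_pi_fintype, Module.finrank_pi_fintype] at this
        simp only [Finset.sum_const, Finset.card_univ, Fintype.card_fin, smul_eq_mul] at this
        exact Nat.eq_of_mul_eq_mul_right Module.finrank_pos this
      subst hjk
      have hY : φe.conj (mθ θ (j+1)) = (φ0.symm.trans φe).conj (φ0.conj (mθ θ (j+1))) := by
        ext x; simp [LinearEquiv.conj_apply]
      have hval : f (φe.conj (mθ θ (j+1))) = f (φ0.conj (mθ θ (j+1))) := by rw [hY, hc]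
      rw [← hval, Finset.sum_eq_single (φe.conj (mθ θ (j+1)))]
      · rw [if_pos]
        have hin : ∀ y, (φe.conj (mθ θ (j+1))) (φ y) = φ (θ • y) := by
          intro y; rw [LinearEquiv.conj_apply_apply, ← hφe, LinearEquiv.symm_apply_apply]; rfl
        refine ⟨⟨1, ?_⟩, hin, fun y hy => hi (by simpa using hy)⟩
        rw [pow_one]
        ext x
        obtain ⟨y, rfl⟩ := hs x
        rw [int_aeval hin]; simp
      · intro X _ hX
        rw [if_neg]
        rintro ⟨-, h⟩
        apply hX
        ext x
        obtain ⟨y, rfl⟩ := hs x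
        rw [h.1, LinearEquiv.conj_apply_apply, ← hφe y, LinearEquiv.symm_apply_apply]; rfl
      · simp
    · rw [if_neg (fun h => hs h.2)]
      refine cusp_avg hf (LinearMap.range φ) ?_ ?_ (fun X => IsNilpotent (aeval X (minpoly F θ)) ∧ φ ∈ Inj θ X ⊥ (j+1)) ?_ ?_
      · intro h
        rw [LinearMap.range_eq_bot] at h
        have := hi (a₁ := fun _ => 1) (a₂ := 0) (by simp [h])
        have := congrFun this 0
        simp at this
      · intro h; exact hs (LinearMap.range_eq_top.1 h)
      · rintro X ⟨-, h⟩ x ⟨y, rfl⟩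
        exact ⟨θ • y, (h.1 y).symm⟩
      · rintro X v hv ⟨hn, h⟩
        refine ⟨nW_primary1 ?_ hv _ hn, fun y => ?_, h.2⟩
        · rintro x ⟨y, rfl⟩
          exact ⟨θ • y, (h.1 y).symm⟩
        · rw [LinearMap.add_apply, hv.2 _ ⟨y, rfl⟩, add_zero, h.1]
  simp_rw [h3]
  rw [← Finset.sum_filter, Finset.sum_const, nsmul_eq_mul]
  by_cases hjk : j + 1 = k
  · subst hjk
    rw [if_pos rfl]
    congr 2
    rw [← Fintype.card_subtype, ← Nat.card_eq_fintype_card]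
    symm
    refine Nat.card_congr (Equiv.ofBijective (fun g => ⟨(φ0.trans g : _ →ₗ[F] V), (φ0.trans g).bijective⟩) ⟨?_, ?_⟩)
    · intro g h hgh
      ext x
      have := LinearMap.congr_fun (congrArg Subtype.val hgh) (φ0.symm x)
      simpa using this
    · rintro ⟨φ, hφ⟩
      refine ⟨φ0.symm.trans (LinearEquiv.ofBijective φ hφ), ?_⟩
      apply Subtype.ext; refine LinearMap.ext fun x => ?_; simp
  · rw [if_neg hjk]
    have : Finset.univ.filter (fun φ : (Fin (j+1) → K) →ₗ[F] V => Function.Bijective φ) = ∅ := by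
      rw [Finset.filter_eq_empty_iff]
      intro φ _ hφ
      apply hjk
      have := ((LinearEquiv.ofBijective φ hφ).trans φ0.symm).finrank_eq
      rw [Module.finrank_pi_fintype, Module.finrank_pi_fintype] at this
      simp only [Finset.sum_const, Finset.card_univ, Fintype.card_fin, smul_eq_mul] at this
      exact Nat.eq_of_mul_eq_mul_right Module.finrank_pos this
    rw [this]; simp

theorem pairing [Nontrivial V] (hθ : ∀ a : K, ∃ g : F[X], aeval θ g = a) {f : (V →ₗ[F] V) → ℂ} (hf : Cusp f) (hc : Cls f)
    {k : ℕ} (φ0 : (Fin k → K) ≃ₗ[F] V) :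
    ∑ X, f X * Nth θ X = (-1)^(k-1) * k * gq (Fintype.card K) k * (Nat.card (V ≃ₗ[F] V) : ℂ) * f (φ0.conj (mθ θ k)) := by
  have hk : 1 ≤ k := by
    by_contra h
    obtain rfl : k = 0 := by omega
    have : Subsingleton V := φ0.symm.toEquiv.subsingleton
    exact not_subsingleton V this
  let m := ∑ X : V →ₗ[F] V, Module.finrank K (HX θ X) + k
  have hm : ∀ X : V →ₗ[F] V, Module.finrank K (HX θ X) ≤ m := fun X =>
    (Finset.single_le_sum (f := fun X : V →ₗ[F] V => Module.finrank K (HX θ X)) (fun _ _ => Nat.zero_le _) (Finset.mem_univ X)).trans (by omega)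
  have h1 : ∀ X : V →ₗ[F] V, f X * Nth θ X = ∑ j ∈ Finset.range m, (-1:ℂ)^j * (j+1) * gq (Fintype.card K) (j+1) *
      (f X * (if IsNilpotent (aeval X (minpoly F θ)) then (Nat.card (Inj θ X ⊥ (j+1)) : ℂ) else 0)) := by
    intro X
    unfold Nth
    by_cases hX : IsNilpotent (aeval X (minpoly F θ))
    · simp only [hX, if_true]
      rw [← newton hQK _ m (hm X) (finrank_HX_pos hθ hX), Finset.mul_sum]
      apply Finset.sum_congr rfl; intro j _
      rw [card_Inj_bot hθ]; ring
    · simp [hX]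
  simp_rw [h1]
  rw [Finset.sum_comm]
  simp_rw [← Finset.mul_sum, sum_prim_Inj hθ hf hc φ0]
  rw [Finset.sum_eq_single (k-1)]
  · have : k - 1 + 1 = k := by omega
    have h2 : ((k - 1 : ℕ) : ℂ) + 1 = k := by exact_mod_cast this
    rw [this, h2, if_pos rfl]; ring
  · intro j _ hj
    rw [if_neg (by omega)]; simp
  · intro h; simp only [Finset.mem_range, not_lt] at h
    have : k ≤ m := by simp [m]
    omega

end pair
end KL

set_option linter.unusedSectionVars false
namespace KL
open Polynomial IntermediateField
open scoped Classical
section Np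
variable {F V : Type} [Field F] [AddCommGroup V] [Module F V] [Fintype F] [Finite V]

/-- the function `N(p, ·)` -/
noncomputable def Np (p : F[X]) (X : V →ₗ[F] V) : ℂ :=
  if IsNilpotent (aeval X p) then
    Nq ((Fintype.card F : ℂ)^p.natDegree) (Module.finrank F (LinearMap.ker (aeval X p)) / p.natDegree) else 0

lemma aeval_conj {U : Type} [AddCommGroup U] [Module F U] (g : V ≃ₗ[F] U) (X : V →ₗ[F] V) (p : F[X]) : aeval (g.conj X) p = g.conj (aeval X p) := by
  have := Polynomial.aeval_algHom_apply (g.conjAlgEquiv F).toAlgHom X p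
  exact this

lemma Np_cls (p : F[X]) : Cls (fun X : V →ₗ[F] V => Np p X) := by
  intro g X
  show Np p _ = Np p X
  unfold Np
  rw [aeval_conj]
  have h1 : IsNilpotent (g.conj (aeval X p)) ↔ IsNilpotent (aeval X p) := by
    have := IsNilpotent.map_iff (r := aeval X p) (f := g.conjAlgEquiv F) (g.conjAlgEquiv F).injective
    exact this
  have h2 : Module.finrank F (LinearMap.ker (g.conj (aeval X p))) = Module.finrank F (LinearMap.ker (aeval X p)) := by
    have : LinearMap.ker (g.conj (aeval X p)) = (LinearMap.ker (aeval X p)).map g.toLinearMap := by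
      ext x
      simp only [LinearMap.mem_ker, LinearEquiv.conj_apply_apply, Submodule.mem_map, LinearEquiv.coe_coe]
      constructor
      · intro h
        exact ⟨g.symm x, by simpa using h, by simp⟩
      · rintro ⟨y, hy, rfl⟩; simp [hy]
    rw [this]
    exact LinearEquiv.finrank_map_eq g _
  simp only [h1, h2]

variable {K : Type} [Field K] [Algebra F K] [Fintype K] {θ : K}

instance {X : V →ₗ[F] V} : IsScalarTower F K (HX θ X) := ⟨by
  intro a b e
  ext c
  rw [HX_smul_apply, smul_mul_assoc, map_smul]; rfl⟩

lemma Nth_eq_Np (hθ : ∀ a : K, ∃ g : F[X], aeval θ g = a) (hd : Module.finrank F K = (minpoly F θ).natDegree) (X : V →ₗ[F] V) :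
    Nth θ X = Np (minpoly F θ) X := by
  unfold Nth Np
  have h1 : Module.finrank F (LinearMap.ker (aeval X (minpoly F θ))) = Module.finrank F K * Module.finrank K (HX θ X) := by
    rw [← (HX_equiv (X := X) hθ).finrank_eq, Module.finrank_mul_finrank]
  rw [h1, ← hd, Nat.mul_div_cancel_left _ Module.finrank_pos, Module.card_eq_pow_finrank (K := F) (V := K)]
  push_cast; rfl

end Np

section E
variable (F : Type) {E : Type} [Field F] [Field E] [Fintype F] [Fintype E] [Algebra F E]

lemma gen_surj (s : E) (a : F⟮s⟯) : ∃ g : F[X], aeval (AdjoinSimple.gen F s) g = a := by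
  have hs : IsIntegral F s := Algebra.IsIntegral.isIntegral s
  have h1 : (a : E) ∈ (F⟮s⟯).toSubalgebra := a.2
  rw [adjoin_simple_toSubalgebra_of_isAlgebraic hs.isAlgebraic, Algebra.adjoin_singleton_eq_range_aeval] at h1
  obtain ⟨g, hg⟩ := h1
  refine ⟨g, Subtype.ext ?_⟩
  rw [← hg]
  have := Polynomial.aeval_algHom_apply (F⟮s⟯).val (AdjoinSimple.gen F s) g
  simpa using this.symm

/-- the function N(s, ·) -/
noncomputable def NE (s : E) (X : E →ₗ[F] E) : ℂ := Np (minpoly F s) X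

lemma NE_eq (s : E) (X : E →ₗ[F] E) : NE F s X = Nth (AdjoinSimple.gen F s) X := by
  rw [Nth_eq_Np (gen_surj F s), minpoly_gen]
  · rfl
  · rw [minpoly_gen, adjoin.finrank (Algebra.IsIntegral.isIntegral s)]

/-- index of F(s) in E -/
noncomputable def ks (s : E) : ℕ := Module.finrank F⟮s⟯ E

lemma ks_mul (s : E) : (minpoly F s).natDegree * ks F s = Module.finrank F E := by
  rw [← adjoin.finrank (Algebra.IsIntegral.isIntegral s)]
  exact Module.finrank_mul_finrank _ _ _

lemma ks_pos (s : E) : 0 < ks F s := Module.finrank_pos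

/-- the value N(s,s) -/
noncomputable def Qs (s : E) : ℂ := Nq ((Fintype.card F : ℂ)^(minpoly F s).natDegree) (ks F s)

lemma NE_cls (s : E) : Cls (NE F s) := Np_cls _

lemma NE_of_aeval_zero (s : E) (X : E →ₗ[F] E) (h : aeval X (minpoly F s) = 0) : NE F s X = Qs F s := by
  unfold NE Np Qs
  rw [h, if_pos (by exact IsNilpotent.zero), LinearMap.ker_zero, finrank_top, ← ks_mul F s, Nat.mul_div_cancel_left]
  exact minpoly.natDegree_pos (Algebra.IsIntegral.isIntegral s)

lemma aeval_mulLeft (s : E) (g : F[X]) : aeval (LinearMap.mulLeft F s) g = LinearMap.mulLeft F (aeval s g) := by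
  have := Polynomial.aeval_algHom_apply (Algebra.lmul F E) s g
  exact this

lemma NE_lm (s : E) : NE F s (LinearMap.mulLeft F s) = Qs F s := by
  apply NE_of_aeval_zero
  rw [aeval_mulLeft]; simp

lemma hQF (d : ℕ) (hd : 0 < d) (i : ℕ) (hi : 1 ≤ i) : ((Fintype.card F : ℂ)^d)^i ≠ 1 := by
  rw [← pow_mul]; exact hQK _ (by nlinarith)

lemma Qs_ne_zero (s : E) : Qs F s ≠ 0 := by
  unfold Qs Nq
  rw [Finset.prod_ne_zero_iff]
  intro i _ h
  exact hQF F _ (minpoly.natDegree_pos (Algebra.IsIntegral.isIntegral s)) (i+1) (by omega) (sub_eq_zero.1 h).symm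

variable (E) in
/-- orbit size -/
noncomputable def mu : ℂ := (Nat.card (E ≃ₗ[F] E) : ℂ) / ((Fintype.card E : ℂ) - 1)

lemma cardE_ne : (Fintype.card E : ℂ) - 1 ≠ 0 := by
  have h : 1 < Fintype.card E := Fintype.one_lt_card
  rw [sub_ne_zero]; exact_mod_cast h.ne'

variable (E) in
lemma finEquiv : Finite (E ≃ₗ[F] E) := Finite.of_injective (fun f => (f : E → E)) DFunLike.coe_injective

variable (E) in
lemma mu_ne_zero : mu F E ≠ 0 := by
  have := finEquiv F E
  unfold mu
  refine div_ne_zero ?_ cardE_ne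
  exact_mod_cast Nat.card_pos.ne'

variable [Fintype (E →ₗ[F] E)]

lemma NE_cusp (s : E) : Cusp (NE F s) := by
  have h := cusp_Nth (V := E) (θ := AdjoinSimple.gen F s) (gen_surj F s)
  convert h using 2
  exact NE_eq F s _

theorem pairingE {f : (E →ₗ[F] E) → ℂ} (hf : Cusp f) (hc : Cls f) (s : E) :
    Qs F s * ∑ X, f X * NE F s X = mu F E * ks F s * f (LinearMap.mulLeft F s) := by
  let φ0 : (Fin (ks F s) → F⟮s⟯) ≃ₗ[F] E := (((Module.finBasis F⟮s⟯ E).equivFun).symm).restrictScalars F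
  have h := pairing (gen_surj F s) hf hc φ0
  simp_rw [NE_eq F s]
  rw [h]
  have h2 : φ0.conj (mθ (AdjoinSimple.gen F s) (ks F s)) = LinearMap.mulLeft F s := by
    ext x
    rw [LinearEquiv.conj_apply_apply, mθ_apply]
    have h3 : φ0 (AdjoinSimple.gen F s • φ0.symm x) = AdjoinSimple.gen F s • φ0 (φ0.symm x) :=
      (((Module.finBasis F⟮s⟯ E).equivFun).symm).map_smul _ _
    rw [h3, LinearEquiv.apply_symm_apply]; rfl
  rw [h2]
  have hcard : Fintype.card F⟮s⟯ = (Fintype.card F)^(minpoly F s).natDegree := by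
    rw [Module.card_eq_pow_finrank (K := F), adjoin.finrank (Algebra.IsIntegral.isIntegral s)]
  have hcE : (Fintype.card E : ℂ) = ((Fintype.card F : ℂ)^(minpoly F s).natDegree)^(ks F s) := by
    rw [← pow_mul, ks_mul, Module.card_eq_pow_finrank (K := F) (V := E)]; push_cast; rfl
  rw [hcard]
  have hg := gN (hQF F _ (minpoly.natDegree_pos (Algebra.IsIntegral.isIntegral (R := F) s))) (ks F s) (ks_pos F s)
  rw [← hcE] at hg
  unfold mu
  rw [div_eq_mul_inv, ← hg]
  unfold Qs; push_cast; ring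

lemma NE_disj {s t : E} (h : minpoly F s ≠ minpoly F t) (X : E →ₗ[F] E) : NE F s X * NE F t X = 0 := by
  unfold NE Np
  by_cases h1 : IsNilpotent (aeval X (minpoly F s))
  swap
  · rw [if_neg h1, zero_mul]
  by_cases h2 : IsNilpotent (aeval X (minpoly F t))
  swap
  · rw [if_neg h2, mul_zero]
  exfalso
  have is : IsIntegral F s := Algebra.IsIntegral.isIntegral s
  have it : IsIntegral F t := Algebra.IsIntegral.isIntegral t
  have hcop : IsCoprime (minpoly F s) (minpoly F t) := by
    rw [(minpoly.irreducible is).coprime_iff_not_dvd]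
    intro hd
    exact h (eq_of_monic_of_associated (minpoly.monic is) (minpoly.monic it)
      ((minpoly.irreducible is).associated_of_dvd (minpoly.irreducible it) hd))
  obtain ⟨a, ha⟩ := h1
  obtain ⟨b, hb⟩ := h2
  obtain ⟨u, v, huv⟩ := hcop.pow (m := a) (n := b)
  have := congrArg (aeval X) huv
  simp only [map_add, map_mul, map_pow, ha, hb, mul_zero, add_zero, map_one] at this
  have := LinearMap.congr_fun this 1
  simp at this

lemma ks_congr {s t : E} (h : minpoly F s = minpoly F t) : ks F s = ks F t := by
  have h1 := ks_mul F s
  have h2 := ks_mul F t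
  rw [← h2, h] at h1
  exact Nat.eq_of_mul_eq_mul_left (minpoly.natDegree_pos (Algebra.IsIntegral.isIntegral t)) h1

theorem orthE (s t : E) : ∑ X, NE F s X * NE F t X = if minpoly F s = minpoly F t then mu F E * ks F s else 0 := by
  split_ifs with h
  · have h1 := pairingE F (NE_cusp F s) (NE_cls F s) t
    have h2 : NE F s (LinearMap.mulLeft F t) = Qs F t := by
      rw [← NE_lm]; unfold NE; rw [h]
    rw [h2, ks_congr F h.symm] at h1
    apply mul_left_cancel₀ (Qs_ne_zero F t)
    rw [h1]; ring
  · exact Finset.sum_eq_zero (fun X _ => NE_disj F h X)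
end E
end KL

set_option linter.unusedSectionVars false
namespace KL
open Polynomial IntermediateField
open scoped Classical
section gen
variable {F V K : Type} [Field F] [AddCommGroup V] [Module F V] [Fintype F] [Finite V] [Field K] [Algebra F K] [Fintype K] {θ : K}
lemma finrank_ker_HX (hθ : ∀ a : K, ∃ g : F[X], aeval θ g = a) (X : V →ₗ[F] V) :
    Module.finrank F (LinearMap.ker (aeval X (minpoly F θ))) = Module.finrank F K * Module.finrank K (HX θ X) := by
  rw [← (HX_equiv (X := X) hθ).finrank_eq, Module.finrank_mul_finrank]
end gen
section E
variable (F : Type) {E : Type} [Field F] [Field E] [Fintype F] [Fintype E] [Algebra F E]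

variable (E) in
/-- the constant c -/
noncomputable def cc : ℂ := (-1)^(Module.finrank F E - 1) * (Fintype.card F : ℂ)^(Module.finrank F E * (Module.finrank F E - 1) / 2)

variable (E) in
lemma card_equiv : (Nat.card (E ≃ₗ[F] E) : ℂ) = ∏ i ∈ Finset.range (Module.finrank F E),
    ((Fintype.card F : ℂ)^(Module.finrank F E) - (Fintype.card F : ℂ)^i) := by
  set n := Module.finrank F E with hn
  let b : E ≃ₗ[F] (Fin n → F) := (Module.finBasis F E).equivFun
  have h1 : Nat.card (E ≃ₗ[F] E) = Nat.card (GL (Fin n) F) := by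
    have e1 : (E ≃ₗ[F] E) ≃ ((Fin n → F) ≃ₗ[F] (Fin n → F)) :=
      { toFun := fun g => b.symm.trans (g.trans b)
        invFun := fun g => b.trans (g.trans b.symm)
        left_inv := by intro g; ext x; simp
        right_inv := by intro g; apply LinearEquiv.ext; intro x; simp }
    rw [Nat.card_congr e1]
    exact Nat.card_congr ((Matrix.GeneralLinearGroup.toLin).trans (LinearMap.GeneralLinearGroup.generalLinearEquiv F (Fin n → F))).symm.toEquiv
  rw [h1, Matrix.card_GL_field, Finset.prod_range]
  push_cast
  apply Finset.prod_congr rfl; intro i _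
  rw [Nat.cast_sub (Nat.pow_le_pow_right Fintype.card_pos (by omega))]
  push_cast; rfl

variable (E) in
lemma minpoly_zero_natDegree : (minpoly F (0 : E)).natDegree = 1 := by
  rw [minpoly.zero]; simp

variable (E) in
lemma ks_zero : ks F (0 : E) = Module.finrank F E := by
  have := ks_mul F (0 : E)
  rw [minpoly_zero_natDegree, one_mul] at this
  exact this

variable (E) in
lemma cc_Q0 : cc F E * Qs F (0:E) = mu F E := by
  unfold mu
  rw [eq_div_iff cardE_ne, card_equiv]
  have hn : 0 < Module.finrank F E := Module.finrank_pos
  have hcE : (Fintype.card E : ℂ) = (Fintype.card F : ℂ)^(Module.finrank F E) := by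
    rw [Module.card_eq_pow_finrank (K := F) (V := E)]; push_cast; rfl
  rw [hcE]
  unfold Qs cc Nq
  rw [ks_zero, minpoly_zero_natDegree, pow_one]
  generalize Module.finrank F E = n at *
  set q := (Fintype.card F : ℂ)
  have h1 : ∀ i ∈ Finset.range n, q^n - q^i = q^i * (q^(n-1-i+1) - 1) := by
    intro i hi
    rw [Finset.mem_range] at hi
    rw [mul_sub, ← pow_add, mul_one]; congr 2; omega
  rw [Finset.prod_congr rfl h1, Finset.prod_mul_distrib, Finset.prod_range_reflect (fun i => q^(i+1) - 1), Finset.prod_pow_eq_pow_sum,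
    Finset.sum_range_id]
  obtain ⟨m, rfl⟩ : ∃ m, n = m + 1 := ⟨n-1, by omega⟩
  rw [Finset.prod_range_succ, Nat.add_sub_cancel]
  have : ∏ i ∈ Finset.range m, (1 - q^(i+1)) = (-1)^m * ∏ i ∈ Finset.range m, (q^(i+1) - 1) := by
    rw [← Finset.card_range m, ← Finset.prod_const, Finset.card_range, ← Finset.prod_mul_distrib]
    apply Finset.prod_congr rfl; intro i _; ring
  rw [this]
  have h1 : ((-1:ℂ)^m) * (-1)^m = 1 := by rw [← mul_pow]; simp
  linear_combination (q ^ ((m + 1) * m / 2) * (∏ i ∈ Finset.range m, (q^(i+1) - 1)) * (q^(m+1) - 1)) * h1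

variable [Fintype (E →ₗ[F] E)]

/-- the cyclic subspace -/
noncomputable def cyc (X : E →ₗ[F] E) (e : E) : Submodule F E :=
  LinearMap.range ((LinearMap.applyₗ e) ∘ₗ (aeval X : F[X] →ₐ[F] Module.End F E).toLinearMap)

lemma mem_cyc (X : E →ₗ[F] E) (e x : E) : x ∈ cyc F X e ↔ ∃ g : F[X], aeval X g e = x := Iff.rfl

lemma cyc_stable (X : E →ₗ[F] E) (e : E) : ∀ x ∈ cyc F X e, X x ∈ cyc F X e := by
  rintro x ⟨g, rfl⟩
  exact ⟨Polynomial.X * g, by simp⟩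

lemma self_mem_cyc (X : E →ₗ[F] E) (e : E) : e ∈ cyc F X e := ⟨1, by simp⟩

lemma cyc_add (X v : E →ₗ[F] E) (e : E) (hv : v ∈ nW (cyc F X e)) : cyc F (X+v) e = cyc F X e := by
  have h := nW_aeval (cyc_stable F X e) hv
  ext x
  rw [mem_cyc, mem_cyc]
  apply exists_congr; intro g
  rw [(h g).1 e (self_mem_cyc F X e)]

lemma NE_cyclic (s : E) (X : E →ₗ[F] E) (e : E) (h : cyc F X e = ⊤) (hp : IsNilpotent (aeval X (minpoly F s))) : NE F s X = 1 := by
  rw [NE_eq]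
  unfold Nth
  rw [minpoly_gen, if_pos hp]
  set P := aeval X (minpoly F s) with hP
  have hpos : 1 ≤ Module.finrank F⟮s⟯ (HX (AdjoinSimple.gen F s) X) := finrank_HX_pos (gen_surj F s) (by rw [minpoly_gen]; exact hp)
  have hle : Module.finrank F⟮s⟯ (HX (AdjoinSimple.gen F s) X) ≤ 1 := by
    have h1 : Module.finrank F (LinearMap.ker P) = Module.finrank F F⟮s⟯ * Module.finrank F⟮s⟯ (HX (AdjoinSimple.gen F s) X) := by
      have := finrank_ker_HX (gen_surj F s) X
      rw [minpoly_gen] at this; exact this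
    have h2 : Module.finrank F (E ⧸ LinearMap.range P) = Module.finrank F (LinearMap.ker P) := by
      have a1 := Submodule.finrank_quotient_add_finrank (LinearMap.range P)
      have a2 := LinearMap.finrank_range_add_finrank_ker P
      omega
    have hst : ∀ x ∈ LinearMap.range P, X x ∈ LinearMap.range P := by
      rintro x ⟨y, rfl⟩
      refine ⟨X y, ?_⟩
      rw [hP]
      have := congrArg (fun g => aeval X g y) (mul_comm (minpoly F s) Polynomial.X)
      simpa using this
    have hfq : Finite (E ⧸ LinearMap.range P) := Finite.of_surjective _ (LinearMap.range P).mkQ_surjective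
    obtain ⟨w, hw⟩ := exists_HX (X := (LinearMap.range P).mapQ (LinearMap.range P) X hst) (θ := AdjoinSimple.gen F s) (gen_surj F s) ((LinearMap.range P).mkQ e) (by
      rw [mapQ_aeval, minpoly_gen]
      simp [← hP])
    have hsurj : Function.Surjective w.1 := by
      intro z
      obtain ⟨x, rfl⟩ := (LinearMap.range P).mkQ_surjective z
      have hx : x ∈ cyc F X e := by rw [h]; trivial
      obtain ⟨g, rfl⟩ := (mem_cyc F X e x).1 hx
      refine ⟨aeval (AdjoinSimple.gen F s) g * 1, ?_⟩
      rw [HX_aeval, hw, mapQ_aeval]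
    have h3 := LinearMap.finrank_le_finrank_of_surjective (f := w.1) hsurj
    rw [h2, h1] at h3
    have h4 : 0 < Module.finrank F F⟮s⟯ := Module.finrank_pos
    by_contra hcon
    push Not at hcon
    nlinarith
  have : Module.finrank F⟮s⟯ (HX (AdjoinSimple.gen F s) X) = 1 := by omega
  rw [this]; simp [Nq]

theorem sum_NE (s : E) : ∑ X, NE F s X = mu F E := by
  have := finEquiv F E
  have hn0 : 0 < Module.finrank F E := Module.finrank_pos
  -- restrict to cyclic X
  have h1 : ∑ X, NE F s X = ∑ X : E →ₗ[F] E, (if cyc F X 1 = ⊤ then NE F s X else 0) := by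
    have hW : Fintype (Submodule F E) := Fintype.ofFinite _
    have : ∀ X : E →ₗ[F] E, NE F s X = ∑ W : Submodule F E, if cyc F X 1 = W then NE F s X else 0 := by
      intro X; simp
    rw [Finset.sum_congr rfl (fun X _ => this X), Finset.sum_comm, Finset.sum_eq_single ⊤]
    · intro W _ hW
      by_cases hb : (1:E) ∈ W
      · refine cusp_avg (NE_cusp F s) W (fun h => by rw [h] at hb; simp at hb) hW (fun X => cyc F X 1 = W) ?_ ?_
        · rintro X rfl; exact cyc_stable F X 1
        · rintro X v hv rfl; exact cyc_add F X v 1 hv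
      · apply Finset.sum_eq_zero; intro X _
        rw [if_neg]; rintro rfl; exact hb (self_mem_cyc F X 1)
    · simp
  set p := minpoly F s with hp
  set k := ks F s with hk
  let P := p^k
  have pm : p.Monic := minpoly.monic (Algebra.IsIntegral.isIntegral s)
  have pirr : Irreducible p := minpoly.irreducible (Algebra.IsIntegral.isIntegral s)
  have Pm : P.Monic := pm.pow k
  have Pd : P.natDegree = Module.finrank F E := by
    rw [pm.natDegree_pow, mul_comm]; exact ks_mul F s
  let A := AdjoinRoot P
  have hA : Module.finrank F A = Module.finrank F E := by
    rw [← Pd]; exact (AdjoinRoot.powerBasis' Pm).finrank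
  have : Module.Finite F A := Module.Finite.of_basis (AdjoinRoot.powerBasis' Pm).basis
  have hAf : Finite A := Module.finite_of_finite F
  have : Nontrivial A := Module.nontrivial_of_finrank_pos (R := F) (by omega)
  have hfin2 : Finite (A ≃ₗ[F] E) := Finite.of_injective (fun f => (f : A → E)) DFunLike.coe_injective
  let mr : A →ₗ[F] A := LinearMap.mulLeft F (AdjoinRoot.root P)
  have hmr : ∀ g : F[X], aeval mr g = LinearMap.mulLeft F (AdjoinRoot.mk P g) := by
    intro g
    have := Polynomial.aeval_algHom_apply (Algebra.lmul F A) (AdjoinRoot.root P) g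
    rw [AdjoinRoot.aeval_eq] at this
    exact this
  -- counting
  let S := {X : E →ₗ[F] E // cyc F X 1 = ⊤ ∧ IsNilpotent (aeval X p)}
  let T := {h : A ≃ₗ[F] E // h 1 = 1}
  have hST : Nat.card T = Nat.card S := by
    refine Nat.card_congr (Equiv.ofBijective (fun h => ⟨h.1.conj mr, ?_, ?_⟩) ⟨?_, ?_⟩)
    · rw [eq_top_iff]; intro x _
      obtain ⟨g, hg⟩ := AdjoinRoot.mk_surjective (h.1.symm x)
      refine (mem_cyc F _ _ _).2 ⟨g, ?_⟩
      have h1 : h.1.symm 1 = 1 := by rw [LinearEquiv.symm_apply_eq]; exact h.2.symm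
      rw [aeval_conj, LinearEquiv.conj_apply_apply, hmr, h1]
      simp [hg]
    · refine ⟨k, ?_⟩
      rw [← map_pow, aeval_conj, hmr]
      have : AdjoinRoot.mk P (p^k) = 0 := AdjoinRoot.mk_self
      rw [this]; ext x; simp [LinearEquiv.conj_apply]
    · intro h1 h2 hh
      have hh' := congrArg Subtype.val hh
      dsimp only at hh'
      apply Subtype.ext; apply LinearEquiv.ext; intro a
      obtain ⟨g, rfl⟩ := AdjoinRoot.mk_surjective a
      have key : ∀ h : T, h.1 (AdjoinRoot.mk P g) = aeval (h.1.conj mr) g 1 := by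
        intro h
        have h1 : h.1.symm 1 = 1 := by rw [LinearEquiv.symm_apply_eq]; exact h.2.symm
        rw [aeval_conj, LinearEquiv.conj_apply_apply, hmr, h1]; simp
      rw [key, key, hh']
    · rintro ⟨X, hX, hX2⟩
      have hPX : aeval X P = 0 := by
        have hmi : minpoly F X ∣ P := by
          obtain ⟨m, hm⟩ := hX2
          have h1 : minpoly F X ∣ p^m := minpoly.dvd F X (by rw [map_pow, hm])
          obtain ⟨i, _, hi⟩ := (dvd_prime_pow pirr.prime m).1 h1
          have hii : minpoly F X = p^i := eq_of_monic_of_associated (minpoly.monic (Algebra.IsIntegral.isIntegral X)) (pm.pow i) hi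
          rw [hii]
          apply pow_dvd_pow
          have hle : (minpoly F X).natDegree ≤ Module.finrank F E := by
            have := Polynomial.natDegree_le_of_dvd (LinearMap.minpoly_dvd_charpoly X) (LinearMap.charpoly_monic X).ne_zero
            rwa [LinearMap.charpoly_natDegree] at this
          rw [hii, pm.natDegree_pow, ← Pd, pm.natDegree_pow] at hle
          exact Nat.le_of_mul_le_mul_right hle (minpoly.natDegree_pos (Algebra.IsIntegral.isIntegral s))
        obtain ⟨u, hu⟩ := hmi
        rw [hu, map_mul, minpoly.aeval, zero_mul]
      let ev : F[X] →ₗ[F] E := (LinearMap.applyₗ (1:E)) ∘ₗ (aeval X : F[X] →ₐ[F] Module.End F E).toLinearMap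
      have hev : ∀ g, ev g = aeval X g 1 := fun g => rfl
      have hev0 : ∀ g g', AdjoinRoot.mk P g = AdjoinRoot.mk P g' → ev g = ev g' := by
        intro g g' h
        rw [AdjoinRoot.mk_eq_mk] at h
        obtain ⟨u, hu⟩ := h
        rw [← sub_eq_zero, ← map_sub, hu, hev, map_mul, hPX]; simp
      have hsi : ∀ a : A, AdjoinRoot.mk P (Function.surjInv AdjoinRoot.mk_surjective a) = a := Function.surjInv_eq _
      let h0 : A →ₗ[F] E :=
        { toFun := fun a => ev (Function.surjInv AdjoinRoot.mk_surjective a)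
          map_add' := by
            intro a b; rw [← map_add]; apply hev0
            rw [map_add, hsi, hsi, hsi]
          map_smul' := by
            intro r a
            rw [RingHom.id_apply, ← map_smul]; apply hev0
            rw [hsi, ← AdjoinRoot.smul_mk, hsi] }
      have hh0 : ∀ g, h0 (AdjoinRoot.mk P g) = aeval X g 1 := fun g => hev0 _ _ (Function.surjInv_eq _ _)
      have hs : Function.Surjective h0 := by
        intro x
        have hx : x ∈ cyc F X 1 := by rw [hX]; trivial
        obtain ⟨g, hg⟩ := (mem_cyc F X 1 x).1 hx
        exact ⟨_, (hh0 g).trans hg⟩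
      have hi : Function.Injective h0 := (LinearMap.injective_iff_surjective_of_finrank_eq_finrank hA).2 hs
      let he : A ≃ₗ[F] E := LinearEquiv.ofBijective h0 ⟨hi, hs⟩
      have hhe : ∀ g, he (AdjoinRoot.mk P g) = aeval X g 1 := hh0
      refine ⟨⟨he, ?_⟩, ?_⟩
      · have := hhe 1; simpa using this
      · apply Subtype.ext
        show he.conj mr = X
        apply LinearMap.ext; intro x
        obtain ⟨a, rfl⟩ := he.surjective x
        obtain ⟨g, rfl⟩ := AdjoinRoot.mk_surjective a
        rw [LinearEquiv.conj_apply_apply, LinearEquiv.symm_apply_apply]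
        have : mr (AdjoinRoot.mk P g) = AdjoinRoot.mk P (Polynomial.X * g) := by
          rw [map_mul, AdjoinRoot.mk_X]; rfl
        rw [this, hhe, hhe, map_mul, aeval_X]; rfl
  have hT : Nat.card T * Nat.card Eˣ = Nat.card (E ≃ₗ[F] E) := by
    let h0 : A ≃ₗ[F] E := LinearEquiv.ofFinrankEq A E hA
    have e1 : Nat.card (E ≃ₗ[F] E) = Nat.card (A ≃ₗ[F] E) := Nat.card_congr
      { toFun := fun g => h0.trans g
        invFun := fun g => h0.symm.trans g
        left_inv := by intro g; ext x; simp
        right_inv := by intro g; apply LinearEquiv.ext; intro x; simp }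
    rw [e1, ← Nat.card_prod]
    let mu' : Eˣ → (E ≃ₗ[F] E) := fun u => LinearEquiv.smulOfUnit u |>.restrictScalars F
    have hmu : ∀ u x, mu' u x = u * x := fun u x => rfl
    refine Nat.card_congr (Equiv.ofBijective (fun z => z.1.1.trans (mu' z.2)) ⟨?_, ?_⟩)
    · rintro ⟨⟨h1, h1'⟩, u1⟩ ⟨⟨h2, h2'⟩, u2⟩ h
      have hx : ∀ a, (u1 : E) * h1 a = u2 * h2 a := fun a => LinearEquiv.congr_fun h a
      have h1u := hx 1
      rw [h1', h2', mul_one, mul_one] at h1u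
      have hu : u1 = u2 := Units.ext h1u
      subst hu
      have : h1 = h2 := by
        apply LinearEquiv.ext; intro a
        exact mul_left_cancel₀ u1.ne_zero (hx a)
      subst this; rfl
    · intro h
      have h10 : h 1 ≠ 0 := by
        intro hh; exact one_ne_zero (h.injective (hh.trans (map_zero h).symm))
      let u : Eˣ := Units.mk0 (h 1) h10
      refine ⟨⟨⟨h.trans (mu' u⁻¹), ?_⟩, u⟩, ?_⟩
      · rw [LinearEquiv.trans_apply, hmu]; simp [u, h10]
      · apply LinearEquiv.ext; intro a
        simp [hmu]
  rw [h1]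
  have h2 : ∀ X : E →ₗ[F] E, (if cyc F X 1 = ⊤ then NE F s X else 0) = if (cyc F X 1 = ⊤ ∧ IsNilpotent (aeval X p)) then 1 else 0 := by
    intro X
    by_cases ha : cyc F X 1 = ⊤
    · by_cases hb : IsNilpotent (aeval X p)
      · rw [if_pos ha, if_pos ⟨ha, hb⟩, NE_cyclic F s X 1 ha hb]
      · rw [if_pos ha, if_neg (fun h => hb h.2)]
        unfold NE Np; rw [if_neg hb]
    · rw [if_neg ha, if_neg (fun h => ha h.1)]
  simp_rw [h2]
  rw [Finset.sum_boole, ← Fintype.card_subtype, ← Nat.card_eq_fintype_card]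
  show (Nat.card S : ℂ) = _
  rw [← hST]
  unfold mu
  rw [eq_div_iff cardE_ne, ← hT, Nat.card_eq_fintype_card (α := Eˣ), Fintype.card_units]
  rw [Nat.cast_mul, Nat.cast_sub (Fintype.card_pos)]; simp
end E
end KL

set_option linter.unusedSectionVars false
namespace KL
open scoped Classical
section FT
variable {F V : Type} [Field F] [AddCommGroup V] [Module F V] [Fintype F] [Finite V] [Fintype (V →ₗ[F] V)]

/-- the trace pairing -/
noncomputable def tp (X Y : V →ₗ[F] V) : F := LinearMap.trace F V (X ∘ₗ Y)

lemma tp_comm (X Y : V →ₗ[F] V) : tp X Y = tp Y X := LinearMap.trace_mul_comm F X Y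
lemma tp_add_left (X Y Z : V →ₗ[F] V) : tp (X + Y) Z = tp X Z + tp Y Z := by
  unfold tp; rw [LinearMap.add_comp, map_add]
lemma tp_add_right (X Y Z : V →ₗ[F] V) : tp Z (X + Y) = tp Z X + tp Z Y := by
  unfold tp; rw [LinearMap.comp_add, map_add]
lemma tp_smul_left (a : F) (X Y : V →ₗ[F] V) : tp (a • X) Y = a * tp X Y := by
  unfold tp; rw [LinearMap.smul_comp, map_smul, smul_eq_mul]
lemma tp_smul_right (a : F) (X Y : V →ₗ[F] V) : tp X (a • Y) = a * tp X Y := by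
  rw [tp_comm, tp_smul_left, tp_comm]
lemma tp_neg_right (X Y : V →ₗ[F] V) : tp X (-Y) = - tp X Y := by
  rw [← neg_one_smul F Y, tp_smul_right]; ring
lemma tp_conj (g : V ≃ₗ[F] V) (X Y : V →ₗ[F] V) : tp (g.conj X) (g.conj Y) = tp X Y := by
  unfold tp; rw [← LinearEquiv.conj_comp, LinearMap.trace_conj']

/-- the trace pairing as linear form -/
noncomputable def tpL (Y : V →ₗ[F] V) : (V →ₗ[F] V) →ₗ[F] F where
  toFun X := tp X Y
  map_add' a b := tp_add_left a b Y
  map_smul' a b := tp_smul_left a b Y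

lemma finV : FiniteDimensional F V := FiniteDimensional.of_injective (LinearMap.id : V →ₗ[F] V) (fun _ _ h => h)

lemma tp_smulRight (φ : V →ₗ[F] F) (w : V) (Z : V →ₗ[F] V) : tp (φ.smulRight w) Z = φ (Z w) := by
  have : Module.Finite F V := Module.Finite.of_finite
  rw [tp_comm]
  unfold tp
  have : Z ∘ₗ φ.smulRight w = φ.smulRight (Z w) := by ext x; simp
  rw [this, LinearMap.trace_smulRight]

lemma tpL_eq_zero (Y : V →ₗ[F] V) : tpL Y = 0 ↔ Y = 0 := by
  constructor
  · intro h
    ext w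
    by_contra hw
    obtain ⟨φ, hφ, _⟩ := Submodule.exists_le_ker_of_notMem (p := (⊥ : Submodule F V)) (v := Y w) (by simpa using hw)
    apply hφ
    rw [← tp_smulRight]
    exact LinearMap.congr_fun h _
  · rintro rfl; ext X; show tp X 0 = 0; unfold tp; simp

variable {ψ : AddChar F ℂ}

lemma sum_tp (hψ : ∃ a : F, ψ a ≠ 1) (Y : V →ₗ[F] V) :
    ∑ X, ψ (tp X Y) = if Y = 0 then (Fintype.card (V →ₗ[F] V) : ℂ) else 0 := by
  have := sum_psi_lin hψ (tpL Y)
  simp only [tpL_eq_zero] at this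
  exact this

/-- Fourier transform -/
noncomputable def FT (ψ : AddChar F ℂ) (f : (V →ₗ[F] V) → ℂ) (Y : V →ₗ[F] V) : ℂ := ∑ X, ψ (tp X Y) * f X

lemma FT_cls {f : (V →ₗ[F] V) → ℂ} (hf : Cls f) : Cls (FT ψ f) := by
  intro g Y
  unfold FT
  rw [← Equiv.sum_comp g.conj.toEquiv]
  apply Finset.sum_congr rfl; intro X _
  show ψ (tp (g.conj X) (g.conj Y)) * f (g.conj X) = _
  rw [tp_conj, hf]

lemma FT_adj (f g : (V →ₗ[F] V) → ℂ) : ∑ Y, FT ψ f Y * g Y = ∑ X, f X * FT ψ g X := by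
  unfold FT
  simp_rw [Finset.sum_mul, Finset.mul_sum]
  rw [Finset.sum_comm]
  apply Finset.sum_congr rfl; intro X _
  apply Finset.sum_congr rfl; intro Y _
  rw [tp_comm]; ring

lemma FT_FT (hψ : ∃ a : F, ψ a ≠ 1) (f : (V →ₗ[F] V) → ℂ) (Z : V →ₗ[F] V) :
    FT ψ (FT ψ f) Z = Fintype.card (V →ₗ[F] V) * f (-Z) := by
  unfold FT
  simp_rw [Finset.mul_sum]
  rw [Finset.sum_comm]
  have : ∀ X : V →ₗ[F] V, ∑ Y, ψ (tp Y Z) * (ψ (tp X Y) * f X) = (if Z + X = 0 then (Fintype.card (V →ₗ[F] V) : ℂ) else 0) * f X := by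
    intro X
    rw [← sum_tp hψ, Finset.sum_mul]
    apply Finset.sum_congr rfl; intro Y _
    rw [tp_add_right, AddChar.map_add_eq_mul, tp_comm X Y]; ring
  simp_rw [this, ite_mul, zero_mul]
  rw [Finset.sum_eq_single (-Z)]
  · simp
  · intro X _ hX
    rw [if_neg]; intro h; exact hX (eq_neg_of_add_eq_zero_right h)
  · simp

lemma conj_psi (a : F) : (starRingEnd ℂ) (ψ a) = ψ (-a) := by
  rw [AddChar.map_neg_eq_conj]

/-- Parseval -/
lemma FT_parseval (hψ : ∃ a : F, ψ a ≠ 1) (f : (V →ₗ[F] V) → ℂ) (hr : ∀ X, (starRingEnd ℂ) (f X) = f X) :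
    ∑ Y, FT ψ f Y * (starRingEnd ℂ) (FT ψ f Y) = Fintype.card (V →ₗ[F] V) * ∑ X, f X * f X := by
  rw [FT_adj, Finset.mul_sum]
  apply Finset.sum_congr rfl; intro X _
  have h1 : ∀ Y, (starRingEnd ℂ) (FT ψ f Y) = FT ψ f (-Y) := by
    intro Y
    unfold FT
    rw [map_sum]
    apply Finset.sum_congr rfl; intro X _
    rw [map_mul, hr, conj_psi, tp_neg_right]
  have h2 : FT ψ (fun Y => (starRingEnd ℂ) (FT ψ f Y)) X = FT ψ (FT ψ f) (-X) := by
    show ∑ Y, _ = ∑ Y, _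
    rw [← Equiv.sum_comp (Equiv.neg _)]
    apply Finset.sum_congr rfl; intro Y _
    simp only [Equiv.neg_apply]
    rw [h1, neg_neg, tp_neg_right, tp_comm, tp_neg_right, tp_comm]
  rw [h2, FT_FT hψ, neg_neg]; ring

lemma tp_nil {W : Submodule F V} {v X : V →ₗ[F] V} (hv : v ∈ nW W) (hX : ∀ x ∈ W, X x ∈ W) : tp v X = 0 := by
  have : Module.Finite F V := Module.Finite.of_finite
  have h : IsNilpotent (v ∘ₗ X) := by
    refine ⟨2, ?_⟩
    ext x
    rw [pow_two]
    show v (X (v (X x))) = 0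
    exact hv.2 _ (hX _ (hv.1 _))
  have := LinearMap.isNilpotent_trace_of_isNilpotent h
  exact this.eq_zero

lemma tp_perp {W : Submodule F V} (Z : V →ₗ[F] V) : (∀ v ∈ nW W, tp v Z = 0) ↔ ∀ x ∈ W, Z x ∈ W := by
  constructor
  · intro h w hw
    by_contra hZ
    obtain ⟨φ, hφ, hW⟩ := Submodule.exists_le_ker_of_notMem hZ
    apply hφ
    rw [← tp_smulRight]
    apply h
    refine ⟨fun x => ?_, fun x hx => ?_⟩
    · exact W.smul_mem _ hw
    · have : φ x = 0 := hW hx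
      simp [this]
  · intro h v hv; exact tp_nil hv h

lemma FT_cusp (hψ : ∃ a : F, ψ a ≠ 1) {f : (V →ₗ[F] V) → ℂ} (hf : Cusp f) : Cusp (FT ψ f) := by
  intro W h0 h1 X hX
  unfold FT
  rw [Finset.sum_comm]
  have h2 : ∀ Z : V →ₗ[F] V, ∑ v : nW W, ψ (tp Z (X + v.1)) * f Z =
      (Fintype.card (nW W) : ℂ) * (if ∀ x ∈ W, Z x ∈ W then ψ (tp Z X) * f Z else 0) := by
    intro Z
    have h3 := sum_psi_lin hψ ((tpL Z).domRestrict (nW W))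
    have h4 : (tpL Z).domRestrict (nW W) = 0 ↔ ∀ x ∈ W, Z x ∈ W := by
      rw [← tp_perp]
      constructor
      · intro h v hv; exact LinearMap.congr_fun h ⟨v, hv⟩
      · intro h; ext v; exact h v.1 v.2
    simp only [h4] at h3
    have h5 : ∀ v : nW W, ψ (tp Z (X + v.1)) * f Z = (ψ (tp Z X) * f Z) * ψ ((tpL Z).domRestrict (nW W) v) := by
      intro v
      have : (tpL Z).domRestrict (nW W) v = tp v.1 Z := rfl
      rw [this, tp_add_right, AddChar.map_add_eq_mul, tp_comm v.1]; ring
    rw [Finset.sum_congr rfl (fun v _ => h5 v), ← Finset.mul_sum, h3]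
    split_ifs <;> ring
  rw [Finset.sum_congr rfl (fun Z _ => h2 Z), ← Finset.mul_sum]
  have h6 : ∀ Z : V →ₗ[F] V, (if ∀ x ∈ W, Z x ∈ W then ψ (tp Z X) * f Z else 0) =
      ∑ c : F, ψ c * (if (∀ x ∈ W, Z x ∈ W) ∧ tp Z X = c then f Z else 0) := by
    intro Z
    by_cases h : ∀ x ∈ W, Z x ∈ W
    · rw [if_pos h, Finset.sum_eq_single (tp Z X)]
      · rw [if_pos ⟨h, rfl⟩]
      · intro c _ hc
        rw [if_neg (fun h' => hc h'.2.symm), mul_zero]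
      · simp
    · rw [if_neg h]; symm; apply Finset.sum_eq_zero; intro c _
      rw [if_neg (fun h' => h h'.1), mul_zero]
  rw [Finset.sum_congr rfl (fun Z _ => h6 Z), Finset.sum_comm]
  have h7 : ∀ c : F, ∑ Z : V →ₗ[F] V, ψ c * (if (∀ x ∈ W, Z x ∈ W) ∧ tp Z X = c then f Z else 0) = 0 := by
    intro c
    rw [← Finset.mul_sum, cusp_avg hf W h0 h1 (fun Z => (∀ x ∈ W, Z x ∈ W) ∧ tp Z X = c), mul_zero]
    · intro Z h; exact h.1
    · intro Z v hv h
      refine ⟨fun x hx => ?_, ?_⟩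
      · simp [hv.2 x hx, h.1 x hx]
      · rw [tp_add_left, tp_nil hv hX, add_zero, h.2]
  rw [Finset.sum_congr rfl (fun c _ => h7 c)]; simp
end FT
end KL

set_option linter.unusedSectionVars false
namespace KL
open scoped Classical
open Polynomial

/-- divisibility in the ring of algebraic integers -/
def DvdO (m : ℤ) (z : ℂ) : Prop := ∃ w : ℂ, IsIntegral ℤ w ∧ z = m * w

lemma isInt_int (m : ℤ) : IsIntegral ℤ (m : ℂ) := by
  have := isIntegral_algebraMap (R := ℤ) (A := ℂ) (x := m)
  simpa using this
lemma DvdO.isIntegral {m : ℤ} {z : ℂ} (h : DvdO m z) : IsIntegral ℤ z := by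
  obtain ⟨w, hw, rfl⟩ := h; exact (isInt_int m).mul hw
lemma DvdO.add {m : ℤ} {z z' : ℂ} (h : DvdO m z) (h' : DvdO m z') : DvdO m (z + z') := by
  obtain ⟨w, hw, rfl⟩ := h; obtain ⟨w', hw', rfl⟩ := h'
  exact ⟨w + w', hw.add hw', by ring⟩
lemma DvdO.sub {m : ℤ} {z z' : ℂ} (h : DvdO m z) (h' : DvdO m z') : DvdO m (z - z') := by
  obtain ⟨w, hw, rfl⟩ := h; obtain ⟨w', hw', rfl⟩ := h'
  exact ⟨w - w', hw.sub hw', by ring⟩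
lemma DvdO.mul {m : ℤ} {z z' : ℂ} (h : DvdO m z) (h' : IsIntegral ℤ z') : DvdO m (z * z') := by
  obtain ⟨w, hw, rfl⟩ := h
  exact ⟨w * z', hw.mul h', by ring⟩
lemma DvdO.mul' {m : ℤ} {z z' : ℂ} (h' : IsIntegral ℤ z') (h : DvdO m z) : DvdO m (z' * z) := by
  rw [mul_comm]; exact h.mul h'
lemma DvdO.zero (m : ℤ) : DvdO m 0 := ⟨0, isIntegral_zero, by simp⟩
lemma DvdO.sum {ι : Type*} {s : Finset ι} {m : ℤ} {f : ι → ℂ} (h : ∀ i ∈ s, DvdO m (f i)) : DvdO m (∑ i ∈ s, f i) := by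
  induction s using Finset.induction_on with
  | empty => simpa using DvdO.zero m
  | insert a s ha ih =>
    rw [Finset.sum_insert ha]
    exact (h a (Finset.mem_insert_self _ _)).add (ih fun i hi => h i (Finset.mem_insert_of_mem hi))
lemma dvdO_int {m a : ℤ} (h : m ∣ a) : DvdO m a := by
  obtain ⟨b, rfl⟩ := h; exact ⟨b, isInt_int b, by push_cast; ring⟩
lemma DvdO.coprime {m a : ℤ} (h : IsCoprime m a) {z : ℂ} (hz : IsIntegral ℤ z) (h' : DvdO m (a * z)) : DvdO m z := by
  obtain ⟨u, v, huv⟩ := h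
  obtain ⟨w, hw, h'⟩ := h'
  refine ⟨u * z + v * w, ((isInt_int u).mul hz).add ((isInt_int v).mul hw), ?_⟩
  have : ((u * m + v * a : ℤ) : ℂ) = 1 := by rw [huv]; simp
  push_cast at this
  linear_combination (-z) * this + (v:ℂ) * h'
lemma DvdO.mul_coprime {m a : ℤ} (h : IsCoprime m a) {z : ℂ} (h1 : DvdO m z) (h2 : DvdO a z) : DvdO (m * a) z := by
  obtain ⟨u, v, huv⟩ := h
  obtain ⟨w, hw, h1⟩ := h1
  obtain ⟨w', hw', h2⟩ := h2
  refine ⟨u * w' + v * w, ((isInt_int u).mul hw').add ((isInt_int v).mul hw), ?_⟩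
  have : ((u * m + v * a : ℤ) : ℂ) = 1 := by rw [huv]; simp
  push_cast at this ⊢
  linear_combination (-z) * this + (v:ℂ) * a * h1 + (u:ℂ) * m * h2

section E
variable (F : Type) {E : Type} [Field F] [Field E] [Fintype F] [Fintype E] [Algebra F E]

/-- regular elements -/
def Rg (t : E) : Prop := (minpoly F t).natDegree = Module.finrank F E

variable {F} in
lemma Rg.ks {t : E} (h : Rg F t) : ks F t = 1 := by
  have := ks_mul F t
  rw [h] at this
  exact (Nat.mul_eq_left (Module.finrank_pos (R := F) (M := E)).ne').1 this

variable {F} in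
lemma Rg.Qs {t : E} (h : Rg F t) : Qs F t = 1 := by
  unfold KL.Qs; rw [h.ks]; simp [Nq]

variable {F} in
lemma Rg.surj {t : E} (h : Rg F t) (a : E) : ∃ g : F[X], aeval t g = a := by
  have h1 := (Field.primitive_element_iff_minpoly_natDegree_eq F t).2 h
  obtain ⟨g, hg⟩ := gen_surj F t ⟨a, by rw [h1]; trivial⟩
  refine ⟨g, ?_⟩
  have h2 := congrArg Subtype.val hg
  have := Polynomial.aeval_algHom_apply (IntermediateField.val (IntermediateField.adjoin F {t})) (IntermediateField.AdjoinSimple.gen F t) g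
  rw [← show _ = a from h2]
  simpa using this

lemma prim_pow (s : E) {X : E →ₗ[F] E} (hX2 : IsNilpotent (aeval X (minpoly F s))) : aeval X ((minpoly F s)^(ks F s)) = 0 := by
  set p := minpoly F s with hp
  have pm : p.Monic := minpoly.monic (Algebra.IsIntegral.isIntegral s)
  have pirr : Irreducible p := minpoly.irreducible (Algebra.IsIntegral.isIntegral s)
  have Pd : (p^(ks F s)).natDegree = Module.finrank F E := by
    rw [pm.natDegree_pow, mul_comm]; exact ks_mul F s
  have hmi : minpoly F X ∣ p^(ks F s) := by
    obtain ⟨m, hm⟩ := hX2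
    have h1 : minpoly F X ∣ p^m := minpoly.dvd F X (by rw [map_pow, hm])
    obtain ⟨i, _, hi⟩ := (dvd_prime_pow pirr.prime m).1 h1
    have hii : minpoly F X = p^i := eq_of_monic_of_associated (minpoly.monic (Algebra.IsIntegral.isIntegral X)) (pm.pow i) hi
    rw [hii]
    apply pow_dvd_pow
    have hle : (minpoly F X).natDegree ≤ Module.finrank F E := by
      have := Polynomial.natDegree_le_of_dvd (LinearMap.minpoly_dvd_charpoly X) (LinearMap.charpoly_monic X).ne_zero
      rwa [LinearMap.charpoly_natDegree] at this
    rw [hii, pm.natDegree_pow, ← Pd, pm.natDegree_pow] at hle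
    exact Nat.le_of_mul_le_mul_right hle (minpoly.natDegree_pos (Algebra.IsIntegral.isIntegral s))
  obtain ⟨u, hu⟩ := hmi
  rw [hu, map_mul, minpoly.aeval, zero_mul]

lemma NE_eq_zero {s : E} {X : E →ₗ[F] E} (h : ¬ IsNilpotent (aeval X (minpoly F s))) : NE F s X = 0 := by
  unfold NE Np; rw [if_neg h]

lemma NE_int (s : E) (X : E →ₗ[F] E) : ∃ m : ℤ, NE F s X = m := by
  unfold NE Np
  split_ifs
  · unfold Nq
    refine ⟨∏ i ∈ Finset.range (Module.finrank F (LinearMap.ker (aeval X (minpoly F s))) / (minpoly F s).natDegree - 1), (1 - ((Fintype.card F : ℤ)^(minpoly F s).natDegree)^(i+1)), ?_⟩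
    push_cast; rfl
  · exact ⟨0, by simp⟩

lemma Rg.NE_eq {t : E} (ht : Rg F t) (X : E →ₗ[F] E) : NE F t X = if aeval X (minpoly F t) = 0 then 1 else 0 := by
  split_ifs with h
  · rw [NE_of_aeval_zero F t X h, ht.Qs]
  · apply NE_eq_zero
    intro h'; apply h
    have := prim_pow F t h'
    rwa [ht.ks, pow_one] at this

lemma card_conj {t : E} (ht : Rg F t) (X : E →ₗ[F] E) (hX : aeval X (minpoly F t) = 0) :
    Nat.card {g : E ≃ₗ[F] E // g.conj (LinearMap.mulLeft F t) = X} = Fintype.card E - 1 := by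
  rw [← Fintype.card_units, ← Nat.card_eq_fintype_card]
  have hHX : ∀ g : E ≃ₗ[F] E, g.conj (LinearMap.mulLeft F t) = X → g.toLinearMap ∈ HX t X := by
    rintro g rfl a
    rw [LinearEquiv.conj_apply_apply]; simp
  refine Nat.card_congr (Equiv.ofBijective (fun g => Units.mk0 (g.1 1) ?_) ⟨?_, ?_⟩)
  · intro h; exact one_ne_zero (g.1.injective (h.trans (map_zero g.1).symm))
  · rintro ⟨g, hg⟩ ⟨g', hg'⟩ h
    have h1 : g 1 = g' 1 := congrArg Units.val h
    have := HX_ext ht.surj ⟨g.toLinearMap, hHX g hg⟩ ⟨g'.toLinearMap, hHX g' hg'⟩ h1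
    apply Subtype.ext
    exact LinearEquiv.toLinearMap_injective (congrArg Subtype.val this)
  · intro u
    obtain ⟨e, he⟩ := exists_HX (X := X) ht.surj u.1 (by rw [hX]; rfl)
    have hinj : Function.Injective e.1 := by
      rw [← LinearMap.ker_eq_bot, LinearMap.ker_eq_bot']
      intro a ha
      by_contra ha0
      obtain ⟨g, hg⟩ := ht.surj (1 / a)
      have := HX_aeval e g a
      rw [hg, ha, map_zero, one_div_mul_cancel ha0, he] at this
      exact u.ne_zero this
    refine ⟨⟨LinearEquiv.ofInjectiveEndo e.1 hinj, ?_⟩, ?_⟩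
    · apply LinearMap.ext; intro x
      obtain ⟨a, rfl⟩ := (LinearEquiv.ofInjectiveEndo e.1 hinj).surjective x
      rw [LinearEquiv.conj_apply_apply, LinearEquiv.symm_apply_apply]
      exact e.2 a
    · apply Units.ext; exact he

variable [Fintype (E →ₗ[F] E)]

lemma sum_conj [Fintype (E ≃ₗ[F] E)] {t : E} (ht : Rg F t) (h : (E →ₗ[F] E) → ℂ) :
    ∑ g : E ≃ₗ[F] E, h (g.conj (LinearMap.mulLeft F t)) = ((Fintype.card E : ℂ) - 1) * ∑ X, h X * NE F t X := by
  have h1 : ∀ g : E ≃ₗ[F] E, h (g.conj (LinearMap.mulLeft F t)) = ∑ X, if g.conj (LinearMap.mulLeft F t) = X then h X else 0 := by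
    intro g; simp
  rw [Finset.sum_congr rfl (fun g _ => h1 g), Finset.sum_comm, Finset.mul_sum]
  apply Finset.sum_congr rfl; intro X _
  rw [← Finset.sum_filter, Finset.sum_const, nsmul_eq_mul, ← Fintype.card_subtype, ← Nat.card_eq_fintype_card, ht.NE_eq]
  split_ifs with h2
  · rw [card_conj F ht X h2, Nat.cast_sub Fintype.card_pos]; push_cast; ring
  · have : IsEmpty {g : E ≃ₗ[F] E // g.conj (LinearMap.mulLeft F t) = X} := by
      constructor; rintro ⟨g, rfl⟩
      apply h2
      rw [aeval_conj, aeval_mulLeft, minpoly.aeval]; ext; simp [LinearEquiv.conj_apply]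
    simp

variable (ψ : AddChar F ℂ)

/-- f_s(t) -/
noncomputable def fst (s t : E) : ℂ := FT ψ (NE F s) (LinearMap.mulLeft F t)

lemma Rg.pair {t : E} (ht : Rg F t) {f : (E →ₗ[F] E) → ℂ} (hf : Cusp f) (hc : Cls f) :
    ∑ X, f X * NE F t X = mu F E * f (LinearMap.mulLeft F t) := by
  have := pairingE F hf hc t
  rw [ht.Qs, ht.ks] at this; simpa using this

variable {ψ} (hψ : ∃ a : F, ψ a ≠ 1)
include hψ

lemma pair_FT {t : E} (ht : Rg F t) (s : E) : ∑ X, FT ψ (NE F t) X * NE F s X = mu F E * fst F ψ s t := by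
  rw [FT_adj]
  simp_rw [mul_comm (NE F t _)]
  exact ht.pair F (FT_cusp hψ (NE_cusp F s)) (FT_cls (NE_cls F s))

lemma fst_symm {t : E} (ht : Rg F t) (s : E) : Qs F s * fst F ψ s t = ks F s * fst F ψ t s := by
  have h1 := pairingE F (FT_cusp hψ (NE_cusp F t)) (FT_cls (NE_cls F t)) s
  rw [pair_FT F hψ ht] at h1
  apply mul_left_cancel₀ (mu_ne_zero F E)
  rw [← mul_assoc, mul_comm (mu F E) (Qs F s), mul_assoc, h1]; unfold fst; ring

omit hψ in
lemma fst_integral (s t : E) : IsIntegral ℤ (fst F ψ s t) := by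
  unfold fst FT
  apply IsIntegral.sum; intro X _
  obtain ⟨m, hm⟩ := NE_int F s X
  rw [hm]
  exact (isIntegral_psi ψ _).mul (isInt_int m)
end E
end KL

set_option linter.unusedSectionVars false
namespace KL
open scoped Classical
open Polynomial
section E
variable (F : Type) {E : Type} [Field F] [Field E] [Fintype F] [Fintype E] [Algebra F E]

variable (E) in
/-- exponent -/
noncomputable def n0 : ℕ := Module.finrank F E * (Module.finrank F E - 1) / 2

lemma sum_equiv_L1 [Fintype (E ≃ₗ[F] E)] {ψ : AddChar F ℂ} (hψ : ∃ a : F, ψ a ≠ 1) (X : (Module.End F E)ˣ) (Y : E →ₗ[F] E) :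
    DvdO ((Fintype.card F : ℤ)^(n0 F E)) (∑ g : E ≃ₗ[F] E, ψ (tp (g.conj X.1) Y)) := by
  let b := Module.finBasis F E
  let T : Module.End F E ≃ₐ[F] Matrix _ _ F := LinearMap.toMatrixAlgEquiv b
  let U : (Module.End F E)ˣ ≃* (Matrix (Fin (Module.finrank F E)) (Fin (Module.finrank F E)) F)ˣ := Units.mapEquiv T.toMulEquiv
  obtain ⟨z, hz, h⟩ := L1 hψ (U X) (T Y)
  refine ⟨z, hz, ?_⟩
  push_cast
  unfold n0
  rw [← h]
  symm
  refine Fintype.sum_equiv ((Equiv.inv _).trans (U.symm.toEquiv.trans (LinearMap.GeneralLinearGroup.generalLinearEquiv F E).toEquiv)) _ _ ?_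
  intro x
  congr 1
  obtain ⟨u, rfl⟩ := U.surjective x
  have h1 : (((Equiv.inv _).trans (U.symm.toEquiv.trans (LinearMap.GeneralLinearGroup.generalLinearEquiv F E).toEquiv)) (U u)).conj X.1 = u⁻¹.1 * X.1 * u.1 := by
    have h2 : ((Equiv.inv _).trans (U.symm.toEquiv.trans (LinearMap.GeneralLinearGroup.generalLinearEquiv F E).toEquiv)) (U u) = LinearMap.GeneralLinearGroup.generalLinearEquiv F E u⁻¹ := by
      simp
    rw [h2]
    rfl
  rw [h1]
  unfold tp
  show _ = LinearMap.trace F E (u⁻¹.1 * X.1 * u.1 * Y)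
  rw [LinearMap.trace_eq_matrix_trace F b]
  have h3 : ∀ Z : Module.End F E, LinearMap.toMatrix b b Z = T Z := fun Z => rfl
  rw [h3, map_mul, map_mul, map_mul, ← map_inv]
  rfl

variable [Fintype (E →ₗ[F] E)]

lemma cop_q (m : ℕ) (a : ℤ) (h : (Fintype.card F : ℤ) ∣ a - 1) : IsCoprime ((Fintype.card F : ℤ)^m) a := by
  apply IsCoprime.pow_left
  obtain ⟨b, hb⟩ := h
  exact ⟨-b, 1, by linear_combination hb⟩

lemma fst_dvd1 {ψ : AddChar F ℂ} (hψ : ∃ a : F, ψ a ≠ 1) {t : E} (ht : Rg F t) (s : E) :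
    DvdO ((Fintype.card F : ℤ)^(n0 F E)) (fst F ψ t s) := by
  have hfin := finEquiv F E
  have : Fintype (E ≃ₗ[F] E) := Fintype.ofFinite _
  by_cases h0 : t = 0
  · subst h0
    have : n0 F E = 0 := by
      unfold Rg at ht
      rw [minpoly_zero_natDegree] at ht
      unfold n0; rw [← ht]
    rw [this]
    exact ⟨_, fst_integral F (ψ := ψ) 0 s, by simp⟩
  · let u : (Module.End F E)ˣ := Units.map (Algebra.lmul F E : E →* Module.End F E) (Units.mk0 t h0)
    have h1 := sum_equiv_L1 F hψ u (LinearMap.mulLeft F s)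
    have h2 := sum_conj F ht (fun X => ψ (tp X (LinearMap.mulLeft F s)))
    have h3 : u.1 = LinearMap.mulLeft F t := rfl
    rw [h3, h2] at h1
    refine DvdO.coprime (a := (Fintype.card E : ℤ) - 1) ?_ (fst_integral F t s) ?_
    · have h4 : IsCoprime ((Fintype.card F : ℤ)^(n0 F E)) (-((Fintype.card E : ℤ) - 1)) := by
        apply cop_q
        rw [Module.card_eq_pow_finrank (K := F) (V := E)]
        have : (Fintype.card F : ℤ) ∣ (Fintype.card F : ℤ) ^ Module.finrank F E := dvd_pow_self _ (Module.finrank_pos).ne'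
        rw [show (-(((Fintype.card F ^ Module.finrank F E : ℕ) : ℤ) - 1) - 1) = -((Fintype.card F : ℤ) ^ Module.finrank F E) by push_cast; ring]
        exact (dvd_neg).2 this
      simpa using h4.neg_right
    · push_cast
      exact h1

lemma Qs_int (s : E) : ∃ m : ℤ, Qs F s = m ∧ (Fintype.card F : ℤ) ∣ m - 1 := by
  unfold Qs Nq
  refine ⟨∏ i ∈ Finset.range (ks F s - 1), (1 - ((Fintype.card F : ℤ)^(minpoly F s).natDegree)^(i+1)), by push_cast; rfl, ?_⟩
  have : ∀ i ∈ Finset.range (ks F s - 1), (1 - ((Fintype.card F : ℤ)^(minpoly F s).natDegree)^(i+1)) ≡ 1 [ZMOD (Fintype.card F : ℤ)] := by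
    intro i _
    rw [Int.modEq_iff_dvd]
    have h : 0 < (minpoly F s).natDegree := minpoly.natDegree_pos (Algebra.IsIntegral.isIntegral s)
    rw [sub_sub_cancel, ← pow_mul]
    exact dvd_pow_self _ (by positivity)
  have h2 := Int.ModEq.prod this
  rw [Finset.prod_const_one] at h2
  exact (Int.modEq_iff_dvd.1 h2.symm)

lemma fst_dvd {ψ : AddChar F ℂ} (hψ : ∃ a : F, ψ a ≠ 1) {t : E} (ht : Rg F t) (s : E) :
    DvdO ((Fintype.card F : ℤ)^(n0 F E)) (fst F ψ s t) := by
  obtain ⟨m, hm, hm'⟩ := Qs_int F s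
  refine DvdO.coprime (cop_q F _ m hm') (fst_integral F s t) ?_
  rw [← hm, fst_symm F hψ ht]
  have : IsIntegral ℤ ((ks F s : ℕ) : ℂ) := by exact_mod_cast isInt_int (ks F s)
  exact (fst_dvd1 F hψ ht s).mul' this

variable (E) in
lemma cc_eq : cc F E = (((-1)^(Module.finrank F E - 1) * (Fintype.card F : ℤ)^(n0 F E) : ℤ) : ℂ) := by
  unfold cc n0; push_cast; rfl
end E
end KL

set_option linter.unusedSectionVars false
namespace KL
open scoped Classical
open Polynomial IntermediateField

lemma orb_dvd {G A : Type*} [Group G] [Finite G] [Fintype A] (act : G → A → A) (h1 : ∀ a, act 1 a = a)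
    (hm : ∀ g h a, act (g * h) a = act g (act h a)) (h : A → ℂ) (hi : ∀ g a, h (act g a) = h a)
    (hIntg : ∀ a, IsIntegral ℤ (h a)) (m : ℤ)
    (hd : ∀ a, h a ≠ 0 → ∃ r : ℤ, m * r * Nat.card {g // act g a = a} = Nat.card G) : DvdO m (∑ a, h a) := by
  have : Fintype G := Fintype.ofFinite G
  let inst : MulAction G A := { smul := act, one_smul := h1, mul_smul := hm }
  have hs : ∀ g a, g • a = act g a := fun _ _ => rfl
  rw [← Finset.sum_fiberwise Finset.univ (fun a => (Quotient.mk (MulAction.orbitRel G A) a))]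
  apply DvdO.sum
  intro ω _
  induction ω using Quotient.inductionOn with
  | h a =>
    have hc : ∀ b ∈ Finset.univ.filter (fun b => Quotient.mk (MulAction.orbitRel G A) b = Quotient.mk (MulAction.orbitRel G A) a), h b = h a := by
      intro b hb
      rw [Finset.mem_filter] at hb
      have := Quotient.exact hb.2
      obtain ⟨g, hg⟩ := MulAction.orbitRel_apply.1 this
      rw [← hg]; exact hi g a
    rw [Finset.sum_congr rfl hc, Finset.sum_const, nsmul_eq_mul]
    by_cases h0 : h a = 0
    · rw [h0, mul_zero]; exact DvdO.zero m
    · refine DvdO.mul ?_ (hIntg a)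
      obtain ⟨r, hr⟩ := hd a h0
      have h3 := MulAction.card_orbit_mul_card_stabilizer_eq_card_group G a
      have h4 : (Finset.univ.filter (fun b => Quotient.mk (MulAction.orbitRel G A) b = Quotient.mk (MulAction.orbitRel G A) a)).card = Fintype.card (MulAction.orbit G a) := by
        rw [← Fintype.card_subtype]
        apply Fintype.card_congr
        refine Equiv.subtypeEquivRight ?_
        intro b
        rw [Quotient.eq]; exact MulAction.orbitRel_apply
      rw [h4]
      have h5 : Fintype.card (MulAction.stabilizer G a) = Nat.card {g // act g a = a} := by
        rw [← Nat.card_eq_fintype_card]; rfl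
      rw [h5, ← Nat.card_eq_fintype_card (α := G)] at h3
      have h6 : Nat.card {g // act g a = a} ≠ 0 := by
        have : Nonempty {g // act g a = a} := ⟨⟨1, h1 a⟩⟩
        exact Nat.card_pos.ne'
      have h7 : (Fintype.card (MulAction.orbit G a) : ℤ) = m * r := by
        apply mul_right_cancel₀ (b := (Nat.card {g // act g a = a} : ℤ)) (by exact_mod_cast h6)
        rw [hr, ← h3]; push_cast; rfl
      have : DvdO m ((Fintype.card (MulAction.orbit G a) : ℤ) : ℂ) := by
        rw [h7]; exact dvdO_int (dvd_mul_right _ _)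
      exact_mod_cast this

lemma cyc_dvd_eval (n : ℕ) (hn : 0 < n) (P : ℤ[X]) (hP : ∀ ζ : ℂ, IsPrimitiveRoot ζ n → aeval ζ P = 0) (q : ℤ) :
    (cyclotomic n ℤ).eval q ∣ P.eval q := by
  have hζ := Complex.isPrimitiveRoot_exp n hn.ne'
  have h1 := minpoly.isIntegrallyClosed_dvd (hζ.isIntegral hn) (hP _ hζ)
  rw [← cyclotomic_eq_minpoly hζ hn] at h1
  exact Polynomial.eval_dvd h1

lemma cyc_dvd_Q (d k : ℕ) (hd : 0 < d) (hk : 0 < k) (q : ℤ) :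
    (cyclotomic (d * k) ℤ).eval q ∣ (∏ i ∈ Finset.range (k-1), (1 - (q^d)^(i+1))) - k := by
  have h := cyc_dvd_eval (d*k) (by positivity) (∏ i ∈ Finset.range (k-1), (1 - ((X : ℤ[X])^d)^(i+1)) - C (k:ℤ)) ?_ q
  · simpa [Polynomial.eval_prod] using h
  · intro ζ hζ
    have h1 : IsPrimitiveRoot (ζ^d) (k - 1 + 1) := by
      rw [Nat.sub_add_cancel hk]
      exact hζ.pow (by positivity) rfl
    have := h1.prod_one_sub_pow_eq_order
    simp only [map_sub, map_prod, map_one, map_pow, aeval_X, aeval_C]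
    rw [this]
    have : ((k - 1 : ℕ) : ℂ) + 1 = k := by exact_mod_cast Nat.sub_add_cancel hk
    rw [this]; simp

lemma cyc_dvd_c (n : ℕ) (hn : 0 < n) (q : ℤ) :
    (cyclotomic n ℤ).eval q ∣ (-1)^(n-1) * q^(n*(n-1)/2) - 1 := by
  have h := cyc_dvd_eval n hn ((-1)^(n-1) * (X : ℤ[X])^(n*(n-1)/2) - 1) ?_ q
  · simpa using h
  · intro ζ hζ
    simp only [map_sub, map_mul, map_one, map_pow, map_neg, aeval_X]
    rcases Nat.even_or_odd n with ⟨m, hm⟩ | ⟨m, hm⟩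
    · have h1 : n * (n-1) / 2 = m * (n - 1) := by
        rw [hm, ← two_mul, mul_assoc, Nat.mul_div_cancel_left _ (by norm_num)]
      have h2 : ζ^m = -1 := by
        have : IsPrimitiveRoot (ζ^m) 2 := hζ.pow hn (by omega)
        exact this.eq_neg_one_of_two_right
      rw [h1, pow_mul, h2, ← mul_pow]; simp
    · have h1 : n * (n-1) / 2 = n * m := by
        have : n - 1 = 2 * m := by omega
        rw [this, ← mul_assoc, mul_comm n 2, mul_assoc, Nat.mul_div_cancel_left _ (by norm_num)]
      have h2 : n - 1 = 2 * m := by omega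
      rw [h1, h2, pow_mul, pow_mul, hζ.pow_eq_one]; simp

section E
variable (F : Type) {E : Type} [Field F] [Field E] [Fintype F] [Fintype E] [Algebra F E]

lemma card_stab (s e : E) (h : aeval e (minpoly F s) = 0) : Nat.card {σ : E ≃ₐ[F] E // σ s = e} = ks F s := by
  have h1 : minpoly F e = minpoly F s := by
    have is : IsIntegral F s := Algebra.IsIntegral.isIntegral s
    exact (minpoly.eq_of_irreducible_of_monic (minpoly.irreducible is) h (minpoly.monic is)).symm
  obtain ⟨τ, hτ⟩ := (Normal.minpoly_eq_iff_mem_orbit E).1 h1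
  have hτ' : τ s = e := hτ
  have h2 : Nat.card {σ : E ≃ₐ[F] E // σ s = e} = Nat.card (F⟮s⟯.fixingSubgroup) := by
    refine Nat.card_congr ((Equiv.mulLeft τ⁻¹).subtypeEquiv ?_)
    intro σ
    have : τ⁻¹ * σ ∈ F⟮s⟯.fixingSubgroup ↔ (τ⁻¹ * σ) s = s := by
      rw [IntermediateField.mem_fixingSubgroup_iff]
      have := forall_mem_adjoin_smul_eq_self_iff F (S := {s}) (τ⁻¹ * σ)
      simpa using this
    rw [Equiv.coe_mulLeft, this]
    show _ ↔ τ.symm (σ s) = s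
    rw [AlgEquiv.symm_apply_eq, hτ']
  rw [h2, IsGalois.card_fixingSubgroup_eq_finrank]; rfl

lemma sum_gal (s : E) (g : E → ℂ) : ∑ σ : E ≃ₐ[F] E, g (σ s) = ks F s * ∑ e, if aeval e (minpoly F s) = 0 then g e else 0 := by
  have h1 : ∀ σ : E ≃ₐ[F] E, g (σ s) = ∑ e, if σ s = e then g e else 0 := by intro σ; simp
  rw [Finset.sum_congr rfl (fun σ _ => h1 σ), Finset.sum_comm, Finset.mul_sum]
  apply Finset.sum_congr rfl; intro e _
  rw [← Finset.sum_filter, Finset.sum_const, nsmul_eq_mul, ← Fintype.card_subtype, ← Nat.card_eq_fintype_card]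
  split_ifs with h
  · rw [card_stab F s e h]
  · have : IsEmpty {σ : E ≃ₐ[F] E // σ s = e} := by
      constructor; rintro ⟨σ, rfl⟩
      apply h
      have := Polynomial.aeval_algHom_apply σ.toAlgHom s (minpoly F s)
      rw [minpoly.aeval, map_zero] at this
      exact this
    simp

/-- Galois-symmetrized character -/
noncomputable def SS (ψ : AddChar F ℂ) (t s : E) : ℂ := ∑ σ : E ≃ₐ[F] E, ψ (Algebra.trace F E (t * σ s))

lemma SS_integral (ψ : AddChar F ℂ) (t s : E) : IsIntegral ℤ (SS F ψ t s) := by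
  unfold SS; exact IsIntegral.sum _ (fun σ _ => isIntegral_psi ψ _)

lemma tp_lm (e t : E) : tp (LinearMap.mulLeft F e) (LinearMap.mulLeft F t) = Algebra.trace F E (e * t) := by
  unfold tp
  rw [Algebra.trace_apply]
  congr 1
  ext x; simp [mul_assoc]

lemma NE_lm' (s e : E) : NE F s (LinearMap.mulLeft F e) = if aeval e (minpoly F s) = 0 then Qs F s else 0 := by
  split_ifs with h
  · apply NE_of_aeval_zero; rw [aeval_mulLeft, h]; simp
  · apply NE_eq_zero
    rintro ⟨m, hm⟩
    apply h
    rw [aeval_mulLeft] at hm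
    have := LinearMap.congr_fun hm 1
    rw [LinearMap.pow_mulLeft] at this
    simp only [LinearMap.mulLeft_apply, mul_one, LinearMap.zero_apply] at this
    exact pow_eq_zero_iff (n := m) (by
      rintro rfl
      simp at this) |>.1 this

variable [Fintype (E →ₗ[F] E)]

/-- conjugation by a unit of `E` -/
def cj (u : Eˣ) (X : E →ₗ[F] E) : E →ₗ[F] E := LinearMap.mulLeft F (u : E) ∘ₗ X ∘ₗ LinearMap.mulLeft F ((u⁻¹ : Eˣ) : E)

/-- multiplication by a unit -/
noncomputable def ul (u : Eˣ) : E ≃ₗ[F] E := (LinearEquiv.smulOfUnit u).restrictScalars F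

lemma cj_eq (u : Eˣ) (X : E →ₗ[F] E) : cj F u X = (ul F u).conj X := by
  ext x; rw [LinearEquiv.conj_apply_apply]
  have : (ul F u).symm x = (u⁻¹ : Eˣ) * x := by
    rw [LinearEquiv.symm_apply_eq]; show _ = (u:E) * _; simp
  rw [this]; rfl

lemma ul_lm (u : Eˣ) (t : E) : (ul F u).conj (LinearMap.mulLeft F t) = LinearMap.mulLeft F t := by
  rw [← cj_eq]; ext x; simp [cj]; field_simp

lemma cj_fix (u : Eˣ) (X : E →ₗ[F] E) : cj F u X = X ↔ ∀ x, X (u * x) = u * X x := by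
  constructor
  · intro h x
    have := LinearMap.congr_fun h (u * x)
    rw [← this]; simp [cj]
  · intro h; ext x
    simp only [cj, LinearMap.comp_apply, LinearMap.mulLeft_apply]
    rw [← h]; simp

/-- the commutant of `X` in `E` -/
def com (X : E →ₗ[F] E) : IntermediateField F E where
  carrier := {u | ∀ x, X (u * x) = u * X x}
  mul_mem' := by intro a b ha hb x; rw [mul_assoc, ha, hb, mul_assoc]
  add_mem' := by intro a b ha hb x; rw [add_mul, map_add, ha, hb, add_mul]
  algebraMap_mem' := by intro r x; rw [← Algebra.smul_def, map_smul, Algebra.smul_def]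
  inv_mem' := by
    intro a ha x
    by_cases h0 : a = 0
    · subst h0; simp
    · apply mul_left_cancel₀ h0
      rw [← ha, mul_inv_cancel_left₀ h0, mul_inv_cancel_left₀ h0]

lemma stab_count (X : E →ₗ[F] E) (hX : com F X ≠ ⊤) :
    ∃ r : ℤ, (cyclotomic (Module.finrank F E) ℤ).eval (Fintype.card F : ℤ) * r * Nat.card {u : Eˣ // cj F u X = X} = Nat.card Eˣ := by
  have h1 : Nat.card {u : Eˣ // cj F u X = X} = Fintype.card (com F X) - 1 := by
    rw [← Fintype.card_units, ← Nat.card_eq_fintype_card]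
    refine Nat.card_congr (Equiv.ofBijective (fun u => Units.mk0 ⟨u.1.1, (cj_fix F u.1 X).1 u.2⟩ ?_) ⟨?_, ?_⟩)
    · intro h; exact u.1.ne_zero (congrArg Subtype.val h)
    · intro u v h
      apply Subtype.ext; apply Units.ext
      exact congrArg (fun z => ((z : (com F X)ˣ) : com F X).1) h
    · intro v
      have hv : v.1.1 ≠ 0 := fun h => v.ne_zero (Subtype.ext h)
      refine ⟨⟨Units.mk0 v.1.1 hv, (cj_fix F _ X).2 v.1.2⟩, ?_⟩
      apply Units.ext; rfl
  set e := Module.finrank F (com F X) with he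
  have hc1 : Fintype.card (com F X) = Fintype.card F ^ e := Module.card_eq_pow_finrank (K := F)
  have hc2 : Fintype.card E = Fintype.card F ^ (Module.finrank F E) := Module.card_eq_pow_finrank (K := F)
  have hm := Module.finrank_mul_finrank F (com F X) E
  have hn : 0 < Module.finrank F E := Module.finrank_pos
  have hpd : e ∈ (Module.finrank F E).properDivisors := by
    rw [Nat.mem_properDivisors]
    refine ⟨⟨_, hm.symm⟩, ?_⟩
    refine lt_of_le_of_ne (Nat.le_of_dvd hn ⟨_, hm.symm⟩) ?_
    intro h
    apply hX
    apply IntermediateField.eq_of_le_of_finrank_eq le_top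
    rw [IntermediateField.finrank_top']; exact h
  obtain ⟨r, hr⟩ := X_pow_sub_one_mul_cyclotomic_dvd_X_pow_sub_one_of_dvd ℤ hpd
  refine ⟨r.eval (Fintype.card F : ℤ), ?_⟩
  have := congrArg (Polynomial.eval (Fintype.card F : ℤ)) hr
  simp only [eval_sub, eval_mul, eval_pow, eval_X, eval_one] at this
  rw [h1, Nat.card_eq_fintype_card, Fintype.card_units, hc1, hc2, Nat.cast_sub (Nat.one_le_pow _ _ Fintype.card_pos), Nat.cast_sub (Nat.one_le_pow _ _ Fintype.card_pos)]
  push_cast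
  rw [this]; ring

theorem fst_congr (ψ : AddChar F ℂ) (s t : E) :
    DvdO ((cyclotomic (Module.finrank F E) ℤ).eval (Fintype.card F : ℤ)) (fst F ψ s t - SS F ψ t s) := by
  set Φ := (cyclotomic (Module.finrank F E) ℤ).eval (Fintype.card F : ℤ) with hΦ
  let h : (E →ₗ[F] E) → ℂ := fun X => ψ (tp X (LinearMap.mulLeft F t)) * NE F s X
  have hh : ∀ u X, h (cj F u X) = h X := by
    intro u X
    simp only [h]
    rw [cj_eq, NE_cls F s, ← tp_conj (ul F u) X, ul_lm]
  have hIntg : ∀ X, IsIntegral ℤ (h X) := by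
    intro X
    obtain ⟨m, hm⟩ := NE_int F s X
    simp only [h]; rw [hm]
    exact (isIntegral_psi ψ _).mul (isInt_int m)
  have hcomcj : ∀ (u : Eˣ) (X : E →ₗ[F] E), com F (cj F u X) = com F X := by
    intro u X
    ext a
    show (∀ x, cj F u X (a * x) = a * cj F u X x) ↔ ∀ x, X (a * x) = a * X x
    constructor
    · intro H x
      have := H (u * x)
      simp only [cj, LinearMap.comp_apply, LinearMap.mulLeft_apply] at this
      rw [mul_left_comm a, Units.inv_mul_cancel_left, Units.inv_mul_cancel_left, mul_left_comm] at this
      exact mul_left_cancel₀ u.ne_zero this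
    · intro H x
      simp only [cj, LinearMap.comp_apply, LinearMap.mulLeft_apply]
      rw [mul_left_comm _ a, H]; ring
  have h1 : DvdO Φ (∑ X, if com F X = ⊤ then 0 else h X) := by
    refine orb_dvd (cj (E := E) F) ?_ ?_ _ ?_ ?_ Φ ?_
    · intro X; ext x; simp [cj]
    · intro u v X; ext x; simp [cj, mul_assoc]
    · intro u X
      rw [hcomcj, hh]
    · intro X; split_ifs
      · exact isIntegral_zero
      · exact hIntg X
    · intro X hX
      apply stab_count
      intro h'; rw [if_pos h'] at hX; exact hX rfl
  have h2 : fst F ψ s t = (∑ X, if com F X = ⊤ then 0 else h X) + ∑ X, if com F X = ⊤ then h X else 0 := by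
    rw [← Finset.sum_add_distrib]
    unfold fst FT
    apply Finset.sum_congr rfl; intro X _
    split_ifs <;> simp [h]
  have h3 : (∑ X, if com F X = ⊤ then h X else 0) = ∑ e : E, h (LinearMap.mulLeft F e) := by
    rw [← Finset.sum_filter]
    symm
    refine Finset.sum_bij (fun e _ => LinearMap.mulLeft F e) ?_ ?_ ?_ ?_
    · intro e _
      rw [Finset.mem_filter]
      refine ⟨Finset.mem_univ _, ?_⟩
      rw [eq_top_iff]; intro a _ x
      simp only [LinearMap.mulLeft_apply]; ring
    · intro e _ e' _ H
      have := LinearMap.congr_fun H 1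
      simpa using this
    · intro X hX
      rw [Finset.mem_filter] at hX
      refine ⟨X 1, Finset.mem_univ _, ?_⟩
      ext x
      have : x ∈ com F X := by rw [hX.2]; trivial
      have := this 1
      rw [mul_one] at this
      rw [this]; simp [mul_comm]
    · intro e _; rfl
  have h4 : ∑ e : E, h (LinearMap.mulLeft F e) = Qs F s * ∑ e, if aeval e (minpoly F s) = 0 then ψ (Algebra.trace F E (t * e)) else 0 := by
    rw [Finset.mul_sum]
    apply Finset.sum_congr rfl; intro e _
    simp only [h]
    rw [NE_lm', tp_lm, mul_comm e t]
    split_ifs <;> ring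
  have h5 : SS F ψ t s = ks F s * ∑ e, if aeval e (minpoly F s) = 0 then ψ (Algebra.trace F E (t * e)) else 0 :=
    sum_gal F s (fun e => ψ (Algebra.trace F E (t * e)))
  rw [h2, h3, h4, h5, add_sub_assoc, ← sub_mul]
  refine h1.add (DvdO.mul ?_ ?_)
  · have h6 := cyc_dvd_Q (minpoly F s).natDegree (ks F s) (minpoly.natDegree_pos (Algebra.IsIntegral.isIntegral s)) (ks_pos F s) (Fintype.card F : ℤ)
    rw [ks_mul] at h6
    have h7 := dvdO_int h6
    convert h7 using 1
    unfold Qs Nq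
    push_cast; rfl
  · apply IsIntegral.sum; intro e _
    split_ifs
    · exact isIntegral_psi ψ _
    · exact isIntegral_zero
end E
end KL

set_option linter.unusedSectionVars false
namespace KL
open scoped Classical
open Polynomial IntermediateField
section E
variable (F : Type) {E : Type} [Field F] [Field E] [Fintype F] [Fintype E] [Algebra F E]

variable (E) in
/-- real version of `mu` -/
noncomputable def muR : ℝ := (Nat.card (E ≃ₗ[F] E) : ℝ) / ((Fintype.card E : ℝ) - 1)

variable (E) in
lemma mu_eq : mu F E = (muR F E : ℂ) := by unfold mu muR; push_cast; rfl

variable (E) in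
lemma muR_pos : 0 < muR F E := by
  have := finEquiv F E
  unfold muR
  apply div_pos
  · exact_mod_cast Nat.card_pos
  · have h : 1 < Fintype.card E := Fintype.one_lt_card
    have : (1:ℝ) < Fintype.card E := by exact_mod_cast h
    linarith

lemma NE_congr {s s' : E} (h : minpoly F s = minpoly F s') (X : E →ₗ[F] E) : NE F s X = NE F s' X := by
  unfold NE; rw [h]

lemma NE_conj (s : E) (X : E →ₗ[F] E) : (starRingEnd ℂ) (NE F s X) = NE F s X := by
  obtain ⟨m, hm⟩ := NE_int F s X; rw [hm]; simp

lemma minpoly_iff (s e : E) : minpoly F s = minpoly F e ↔ aeval e (minpoly F s) = 0 := by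
  constructor
  · intro h; rw [h]; exact minpoly.aeval F e
  · intro h
    have is : IsIntegral F s := Algebra.IsIntegral.isIntegral s
    exact (minpoly.eq_of_irreducible_of_monic (minpoly.irreducible is) h (minpoly.monic is))

variable [Fintype (E →ₗ[F] E)]

/-- coefficient -/
noncomputable def bs (A : (E →ₗ[F] E) → ℂ) (s : E) : ℂ := ∑ X, A X * NE F s X

lemma class_sum (b : E → ℂ) (hb : ∀ s s', minpoly F s = minpoly F s' → b s = b s') (s : E) :
    ∑ s', b s' * (if minpoly F s = minpoly F s' then mu F E * ks F s else 0) = Module.finrank F E * mu F E * b s := by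
  have h1 := sum_gal F s b
  have h2 : ∀ σ : E ≃ₐ[F] E, b (σ s) = b s := by
    intro σ; apply hb
    exact (Normal.minpoly_eq_iff_mem_orbit E).2 ⟨σ, rfl⟩
  rw [Finset.sum_congr rfl (fun σ _ => h2 σ), Finset.sum_const, Finset.card_univ, ← Nat.card_eq_fintype_card, IsGalois.card_aut_eq_finrank, nsmul_eq_mul] at h1
  simp_rw [← minpoly_iff] at h1
  have : ∑ s', b s' * (if minpoly F s = minpoly F s' then mu F E * ks F s else 0) = mu F E * (ks F s * ∑ e, if minpoly F s = minpoly F e then b e else 0) := by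
    rw [Finset.mul_sum, Finset.mul_sum]
    apply Finset.sum_congr rfl; intro e _
    split_ifs <;> ring
  rw [this, ← h1]; ring

/-- projection -/
noncomputable def GG (A : (E →ₗ[F] E) → ℂ) (X : E →ₗ[F] E) : ℂ := ∑ s, bs F A s / (Module.finrank F E * mu F E) * NE F s X

lemma bessel (A : (E →ₗ[F] E) → ℂ) :
    ∑ X, (A X - GG F A X) * (starRingEnd ℂ) (A X - GG F A X) =
      ∑ X, A X * (starRingEnd ℂ) (A X) - (1 / (Module.finrank F E * mu F E)) * ∑ s, bs F A s * (starRingEnd ℂ) (bs F A s) := by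
  have hmu : (starRingEnd ℂ) (mu F E) = mu F E := by rw [mu_eq]; simp
  have hn : (Module.finrank F E : ℂ) ≠ 0 := by
    have : 0 < Module.finrank F E := Module.finrank_pos
    exact_mod_cast this.ne'
  have hm := mu_ne_zero F E
  set k : ℂ := Module.finrank F E * mu F E with hk
  have hk0 : k ≠ 0 := mul_ne_zero hn hm
  have hkc : (starRingEnd ℂ) k = k := by rw [hk, map_mul, hmu]; simp
  have hbs : ∀ s s', minpoly F s = minpoly F s' → bs F A s = bs F A s' := by
    intro s s' h; unfold bs
    apply Finset.sum_congr rfl; intro X _; rw [NE_congr F h]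
  set B := ∑ s, bs F A s * (starRingEnd ℂ) (bs F A s) with hB
  have hGc : ∀ X, (starRingEnd ℂ) (GG F A X) = ∑ s, (starRingEnd ℂ) (bs F A s) / k * NE F s X := by
    intro X; unfold GG
    rw [map_sum]
    apply Finset.sum_congr rfl; intro s _
    rw [map_mul, NE_conj, map_div₀, hkc]
  have h1 : ∑ X, A X * (starRingEnd ℂ) (GG F A X) = B / k := by
    simp_rw [hGc, Finset.mul_sum]
    rw [Finset.sum_comm, hB, Finset.sum_div]
    apply Finset.sum_congr rfl; intro s _
    have h6 : ∀ X, A X * ((starRingEnd ℂ) (bs F A s) / k * NE F s X) = ((starRingEnd ℂ) (bs F A s) / k) * (A X * NE F s X) := by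
      intro X; ring
    simp_rw [h6]
    rw [← Finset.mul_sum]
    show (starRingEnd ℂ) (bs F A s) / k * bs F A s = _
    ring
  have h2 : ∑ X, GG F A X * (starRingEnd ℂ) (A X) = B / k := by
    have := congrArg (starRingEnd ℂ) h1
    rw [map_sum, map_div₀, hkc, hB, map_sum] at this
    rw [hB]
    convert this using 2
    · rw [map_mul, Complex.conj_conj, mul_comm]
    · apply Finset.sum_congr rfl; intro s _; rw [map_mul, Complex.conj_conj, mul_comm]
  have h3 : ∑ X, GG F A X * (starRingEnd ℂ) (GG F A X) = B / k := by
    have : ∀ X, GG F A X * (starRingEnd ℂ) (GG F A X) = ∑ s, ∑ s', bs F A s / k * ((starRingEnd ℂ) (bs F A s') / k * (NE F s X * NE F s' X)) := by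
      intro X
      rw [hGc]; unfold GG
      rw [Finset.sum_mul_sum]
      apply Finset.sum_congr rfl; intro s _
      apply Finset.sum_congr rfl; intro s' _
      rw [← hk]; ring
    simp_rw [this]
    rw [Finset.sum_comm, hB, Finset.sum_div]
    apply Finset.sum_congr rfl; intro s _
    rw [Finset.sum_comm]
    have h4 : ∀ s', ∑ X, bs F A s / k * ((starRingEnd ℂ) (bs F A s') / k * (NE F s X * NE F s' X)) =
        bs F A s / k / k * ((starRingEnd ℂ) (bs F A s') * (if minpoly F s = minpoly F s' then mu F E * ks F s else 0)) := by
      intro s'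
      rw [← orthE, Finset.mul_sum, Finset.mul_sum]
      apply Finset.sum_congr rfl; intro X _; ring
    simp_rw [h4]
    rw [← Finset.mul_sum, class_sum F (fun s => (starRingEnd ℂ) (bs F A s)) (fun s s' h => by rw [hbs s s' h]), ← hk]
    field_simp
  have h5 : ∀ X, (A X - GG F A X) * (starRingEnd ℂ) (A X - GG F A X) = A X * (starRingEnd ℂ) (A X) - A X * (starRingEnd ℂ) (GG F A X)
      - GG F A X * (starRingEnd ℂ) (A X) + GG F A X * (starRingEnd ℂ) (GG F A X) := by
    intro X; rw [map_sub]; ring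
  simp_rw [h5]
  rw [Finset.sum_add_distrib, Finset.sum_sub_distrib, Finset.sum_sub_distrib, h1, h2, h3]; ring

lemma bessel_le (A : (E →ₗ[F] E) → ℂ) : ∑ s, ‖bs F A s‖^2 ≤ Module.finrank F E * muR F E * ∑ X, ‖A X‖^2 := by
  have h := bessel F A
  have hc : ∀ z : ℂ, z * (starRingEnd ℂ) z = ((‖z‖^2 : ℝ) : ℂ) := by
    intro z; rw [Complex.mul_conj']; push_cast; rfl
  simp_rw [hc, mu_eq] at h
  have hp : 0 < (Module.finrank F E : ℝ) * muR F E := by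
    have : 0 < Module.finrank F E := Module.finrank_pos
    have := muR_pos F E
    positivity
  have h' : ∑ X, ‖A X - GG F A X‖^2 = ∑ X, ‖A X‖^2 - (1 / (Module.finrank F E * muR F E)) * ∑ s, ‖bs F A s‖^2 := by
    exact_mod_cast h
  have h0 : 0 ≤ ∑ X, ‖A X - GG F A X‖^2 := Finset.sum_nonneg (fun X _ => by positivity)
  rw [h', one_div, inv_mul_eq_div, sub_nonneg, div_le_iff₀ hp] at h0
  linarith

lemma bessel_eq (A : (E →ₗ[F] E) → ℂ) (hA : ∑ s, bs F A s * (starRingEnd ℂ) (bs F A s) = Module.finrank F E * mu F E * ∑ X, A X * (starRingEnd ℂ) (A X))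
    (X : E →ₗ[F] E) : A X = GG F A X := by
  have h := bessel F A
  have hn : (Module.finrank F E : ℂ) ≠ 0 := by
    have : 0 < Module.finrank F E := Module.finrank_pos
    exact_mod_cast this.ne'
  have hm := mu_ne_zero F E
  rw [hA, ← mul_assoc, one_div_mul_cancel (mul_ne_zero hn hm), one_mul, sub_self] at h
  have hc : ∀ z : ℂ, z * (starRingEnd ℂ) z = ((‖z‖^2 : ℝ) : ℂ) := by
    intro z; rw [Complex.mul_conj']; push_cast; rfl
  simp_rw [hc] at h
  have h' : ∑ X, ‖A X - GG F A X‖^2 = 0 := by exact_mod_cast h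
  have := (Finset.sum_eq_zero_iff_of_nonneg (fun X _ => by positivity)).1 h' X (Finset.mem_univ X)
  rw [sq_eq_zero_iff, norm_eq_zero, sub_eq_zero] at this
  exact this

lemma NE_scale (a : F) (ha : a ≠ 0) (s : E) (X : E →ₗ[F] E) : NE F (algebraMap F E a * s) (a • X) = NE F s X := by
  set a' := algebraMap F E a with ha'
  have ha0 : a' ≠ 0 := by rw [ha']; simpa using ha
  have is : ∀ s : E, IsIntegral F s := fun s => Algebra.IsIntegral.isIntegral s
  let L : F[X] := C a * Polynomial.X
  have hL : L.natDegree = 1 := natDegree_C_mul_X a ha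
  let P := (minpoly F (a' * s)).comp L
  have hPs : aeval s P = 0 := by
    simp only [P, L]
    rw [aeval_comp, map_mul, aeval_C, aeval_X]; exact minpoly.aeval F _
  have hdeg : (minpoly F (a' * s)).natDegree = (minpoly F s).natDegree := by
    rw [← adjoin.finrank (is _), ← adjoin.finrank (is s)]
    have : F⟮a' * s⟯ = F⟮s⟯ := by
      apply le_antisymm
      · rw [adjoin_simple_le_iff]; exact mul_mem (IntermediateField.algebraMap_mem _ a) (mem_adjoin_simple_self F s)
      · rw [adjoin_simple_le_iff]
        have := mul_mem (inv_mem (IntermediateField.algebraMap_mem F⟮a' * s⟯ a)) (mem_adjoin_simple_self F (a' * s))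
        rwa [← ha', inv_mul_cancel_left₀ ha0] at this
    rw [this]
  have hPd : P.natDegree = (minpoly F s).natDegree := by
    simp only [P]; rw [natDegree_comp, hL, mul_one, hdeg]
  have hP0 : P ≠ 0 := by
    intro h
    rw [h, natDegree_zero] at hPd
    exact (minpoly.natDegree_pos (is s)).ne hPd
  obtain ⟨w, hw⟩ := minpoly.dvd F s hPs
  have hw0 : w ≠ 0 := by rintro rfl; exact hP0 (by rw [hw, mul_zero])
  have hwd : w.natDegree = 0 := by
    have := congrArg natDegree hw
    rw [natDegree_mul (minpoly.ne_zero (is s)) hw0, hPd] at this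
    omega
  obtain ⟨u, rfl⟩ := natDegree_eq_zero.1 hwd
  have hu : u ≠ 0 := by rintro rfl; exact hw0 (by simp)
  have hae : aeval (a • X) (minpoly F (a' * s)) = u • aeval X (minpoly F s) := by
    have h1 : aeval X P = aeval (a • X) (minpoly F (a' * s)) := by
      simp only [P, L]
      rw [aeval_comp, map_mul, aeval_C, aeval_X, ← Algebra.smul_def]
    rw [← h1, hw, map_mul, aeval_C, ← Algebra.commutes, ← Algebra.smul_def]
  unfold NE Np
  rw [hae, hdeg, LinearMap.ker_smul _ _ hu]
  have : IsNilpotent (u • aeval X (minpoly F s)) ↔ IsNilpotent (aeval X (minpoly F s)) := by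
    constructor
    · intro h
      have := h.smul u⁻¹
      rwa [smul_smul, inv_mul_cancel₀ hu, one_smul] at this
    · intro h; exact h.smul u
  simp only [this]
end E

section rat
variable {F : Type} [Field F] [Fintype F] (p : ℕ) [Fact p.Prime] [Algebra (ZMod p) F]

lemma sum_zmod (ψ : AddChar F ℂ) (y : F) : ∃ r : ℚ, ∑ a : ZMod p, ψ (algebraMap (ZMod p) F a * y) = r := by
  let χ : AddChar (ZMod p) ℂ := ψ.compAddMonoidHom ((AddMonoidHom.mulRight y).comp (algebraMap (ZMod p) F).toAddMonoidHom)
  have := AddChar.sum_eq_ite χ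
  have h2 : ∑ a : ZMod p, ψ (algebraMap (ZMod p) F a * y) = ∑ a, χ a := rfl
  rw [h2, this]
  split_ifs
  · exact ⟨Fintype.card (ZMod p), by push_cast; rfl⟩
  · exact ⟨0, by simp⟩

lemma rat_sum (ψ : AddChar F ℂ) {I : Type*} [Fintype I] (m : I → ℚ) (x : I → F) (T : ZMod p → ℂ)
    (hT : ∀ a, T a = ∑ i, (m i : ℂ) * ψ (algebraMap (ZMod p) F a * x i)) :
    ∃ r : ℚ, ∑ a ∈ Finset.univ.erase (0 : ZMod p), T a * (starRingEnd ℂ) (T a) = r := by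
  have h1 : ∀ a, T a * (starRingEnd ℂ) (T a) = ∑ i, ∑ j, (m i : ℂ) * m j * ψ (algebraMap (ZMod p) F a * (x i - x j)) := by
    intro a
    rw [hT, map_sum, Finset.sum_mul_sum]
    apply Finset.sum_congr rfl; intro i _
    apply Finset.sum_congr rfl; intro j _
    rw [RingHom.map_mul, conj_psi, mul_sub, sub_eq_add_neg, AddChar.map_add_eq_mul]
    simp; ring
  have hall : ∃ r : ℚ, ∑ a, T a * (starRingEnd ℂ) (T a) = r := by
    simp_rw [h1]
    rw [Finset.sum_comm]
    have h2 : ∀ i, ∃ r : ℚ, ∑ a : ZMod p, ∑ j, (m i : ℂ) * m j * ψ (algebraMap (ZMod p) F a * (x i - x j)) = r := by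
      intro i
      rw [Finset.sum_comm]
      choose r hr using fun j => sum_zmod p ψ (x i - x j)
      refine ⟨∑ j, m i * m j * r j, ?_⟩
      push_cast
      apply Finset.sum_congr rfl; intro j _
      rw [← Finset.mul_sum, hr]
    choose r hr using h2
    refine ⟨∑ i, r i, ?_⟩
    push_cast
    exact Finset.sum_congr rfl (fun i _ => hr i)
  obtain ⟨r, hr⟩ := hall
  rw [← Finset.add_sum_erase _ _ (Finset.mem_univ (0 : ZMod p))] at hr
  refine ⟨r - (∑ i, m i) * (∑ i, m i), ?_⟩
  have h3 : T 0 = ((∑ i, m i : ℚ) : ℂ) := by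
    rw [hT]; push_cast
    apply Finset.sum_congr rfl; intro i _; simp
  rw [h3] at hr
  push_cast
  push_cast at hr
  rw [← hr]
  simp

end rat
lemma rat_integral {z : ℂ} (hz : IsIntegral ℤ z) (r : ℚ) (h : z = r) : ∃ m : ℤ, z = m := by
  subst h
  have h1 : IsIntegral ℤ r := by
    have : (r : ℂ) = algebraMap ℚ ℂ r := by simp
    rw [this] at hz
    exact (isIntegral_algebraMap_iff (algebraMap ℚ ℂ).injective).1 hz
  obtain ⟨m, hm⟩ := IsIntegrallyClosed.isIntegral_iff.1 h1
  exact ⟨m, by rw [← hm]; simp⟩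
end KL

set_option linter.unusedSectionVars false
namespace KL
open scoped Classical
open Polynomial
section E
variable (F : Type) {E : Type} [Field F] [Field E] [Fintype F] [Fintype E] [Algebra F E]

variable (E) in
/-- cyclotomic value -/
noncomputable def Ph : ℤ := (cyclotomic (Module.finrank F E) ℤ).eval (Fintype.card F : ℤ)

variable (E) in
lemma Ph_ge : (Fintype.card F : ℤ) - 1 ≤ Ph F E := by
  have hq : 1 < Fintype.card F := Fintype.one_lt_card
  have hn : 0 < Module.finrank F E := Module.finrank_pos
  unfold Ph
  rcases Nat.lt_or_ge 1 (Module.finrank F E) with h | h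
  · have h1 := Polynomial.sub_one_lt_natAbs_cyclotomic_eval h hq.ne'
    have h2 : 0 < (cyclotomic (Module.finrank F E) ℤ).eval (Fintype.card F : ℤ) :=
      cyclotomic_pos' _ (by exact_mod_cast hq)
    omega
  · have : Module.finrank F E = 1 := by omega
    rw [this, cyclotomic_one]; simp

variable {ψ : AddChar F ℂ} (hψ : ∃ a : F, ψ a ≠ 1)

include hψ in
lemma sum_tr (y : E) : ∑ s : E, ψ (Algebra.trace F E (y * s)) = if y = 0 then (Fintype.card E : ℂ) else 0 := by
  have h := sum_psi_lin hψ ((Algebra.trace F E).comp (LinearMap.mulLeft F y))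
  simp only [LinearMap.comp_apply, LinearMap.mulLeft_apply] at h
  rw [h]
  have : (Algebra.trace F E).comp (LinearMap.mulLeft F y) = 0 ↔ y = 0 := by
    constructor
    · intro h0
      have hnd := traceForm_nondegenerate F E
      apply hnd.1 y
      intro z
      rw [Algebra.traceForm_apply]
      have := congrArg (fun l => l z) h0
      simpa using this
    · rintro rfl; ext; simp
  simp only [this]

lemma tr_aut (σ : E ≃ₐ[F] E) (x : E) : Algebra.trace F E (σ x) = Algebra.trace F E x :=
  Algebra.trace_eq_of_algEquiv σ x

variable {F} in
lemma Rg.inj {t : E} (ht : Rg F t) {σ τ : E ≃ₐ[F] E} (h : σ t = τ t) : σ = τ := by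
  ext x
  obtain ⟨P, rfl⟩ := ht.surj x
  have h1 : ∀ ρ : E ≃ₐ[F] E, ρ (aeval t P) = aeval (ρ t) P := fun ρ => (aeval_algHom_apply ρ t P).symm
  rw [h1, h1, h]

include hψ in
lemma SS_norm {t : E} (ht : Rg F t) : ∑ s, SS F ψ t s * (starRingEnd ℂ) (SS F ψ t s) = Module.finrank F E * Fintype.card E := by
  have h1 : ∀ s, SS F ψ t s * (starRingEnd ℂ) (SS F ψ t s) = ∑ σ : E ≃ₐ[F] E, ∑ τ : E ≃ₐ[F] E, ψ (Algebra.trace F E ((σ t - τ t) * s)) := by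
    intro s
    have h2 : SS F ψ t s = ∑ σ : E ≃ₐ[F] E, ψ (Algebra.trace F E (σ t * s)) := by
      unfold SS
      rw [← Equiv.sum_comp (Equiv.inv (E ≃ₐ[F] E))]
      apply Finset.sum_congr rfl; intro σ _
      rw [← tr_aut F σ]
      congr 2
      simp [map_mul]
    rw [h2, map_sum, Finset.sum_mul_sum]
    apply Finset.sum_congr rfl; intro σ _
    apply Finset.sum_congr rfl; intro τ _
    rw [conj_psi, ← AddChar.map_add_eq_mul, sub_mul, map_sub, sub_eq_add_neg]
  simp_rw [h1]
  rw [Finset.sum_comm]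
  have h3 : ∀ σ : E ≃ₐ[F] E, ∑ s, ∑ τ : E ≃ₐ[F] E, ψ (Algebra.trace F E ((σ t - τ t) * s)) = Fintype.card E := by
    intro σ
    rw [Finset.sum_comm]
    simp_rw [sum_tr F hψ, sub_eq_zero]
    have : ∀ τ : E ≃ₐ[F] E, (σ t = τ t) ↔ σ = τ := fun τ => ⟨ht.inj, fun h => by rw [h]⟩
    simp [this]
  simp_rw [h3]
  rw [Finset.sum_const, Finset.card_univ, ← Nat.card_eq_fintype_card, IsGalois.card_aut_eq_finrank, nsmul_eq_mul]

lemma psi_norm (a : F) : ‖ψ a‖ = 1 := by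
  have h : ψ a * (starRingEnd ℂ) (ψ a) = 1 := by
    rw [conj_psi, ← AddChar.map_add_eq_mul]; simp
  rw [Complex.mul_conj'] at h
  have h' : ‖ψ a‖^2 = 1 := by exact_mod_cast h
  nlinarith [norm_nonneg (ψ a)]

lemma SS_le (t s : E) : ‖SS F ψ t s‖ ≤ Module.finrank F E := by
  unfold SS
  refine (norm_sum_le _ _).trans ?_
  simp_rw [psi_norm]
  rw [Finset.sum_const, Finset.card_univ, ← Nat.card_eq_fintype_card, IsGalois.card_aut_eq_finrank]; simp

variable [Fintype (E →ₗ[F] E)]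

/-- error term -/
noncomputable def ee (ψ : AddChar F ℂ) (t s : E) : ℂ := (fst F ψ s t / cc F E - SS F ψ t s) / Ph F E

variable (E) in
lemma cc_ne : cc F E ≠ 0 := by
  rw [cc_eq]
  have : Fintype.card F ≠ 0 := Fintype.card_ne_zero
  simp [this]

variable (E) in
lemma Ph_pos : 0 < Ph F E := by
  have := Ph_ge F E
  have hq : 1 < Fintype.card F := Fintype.one_lt_card
  omega

lemma fst_ee (t s : E) : fst F ψ s t = cc F E * (SS F ψ t s + Ph F E * ee F ψ t s) := by
  have h1 := cc_ne F E
  have h2 : (Ph F E : ℂ) ≠ 0 := by exact_mod_cast (Ph_pos F E).ne'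
  unfold ee
  field_simp
  ring

include hψ in
lemma ee_integral {t : E} (ht : Rg F t) (s : E) : IsIntegral ℤ (ee F ψ t s) := by
  have hn : 0 < Module.finrank F E := Module.finrank_pos
  set c' : ℤ := (-1) ^ (Module.finrank F E - 1) * (Fintype.card F:ℤ) ^ n0 F E with hc'
  have hΦ : Ph F E ∣ c' - 1 := cyc_dvd_c _ hn _
  have hcop : IsCoprime ((Fintype.card F : ℤ) ^ n0 F E) (Ph F E) := by
    obtain ⟨k, hk⟩ := hΦ
    refine ⟨(-1) ^ (Module.finrank F E - 1), -k, ?_⟩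
    rw [hc'] at hk
    linear_combination hk
  have hS := SS_integral F ψ t s
  have h1 : DvdO ((Fintype.card F : ℤ) ^ n0 F E) (fst F ψ s t - (c' : ℂ) * SS F ψ t s) :=
    (fst_dvd F hψ ht s).sub (DvdO.mul (dvdO_int (Dvd.intro_left _ rfl)) hS)
  have h2 : DvdO (Ph F E) (fst F ψ s t - (c' : ℂ) * SS F ψ t s) := by
    have := (fst_congr F ψ s t).sub (DvdO.mul (dvdO_int hΦ) hS)
    have h10 : fst F ψ s t - (c' : ℂ) * SS F ψ t s = fst F ψ s t - SS F ψ t s - ((c' - 1 : ℤ) : ℂ) * SS F ψ t s := by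
      push_cast; ring
    rw [h10]; exact this
  obtain ⟨w, hw, hw2⟩ := h1.mul_coprime hcop h2
  have h3 : ee F ψ t s = (((-1) ^ (Module.finrank F E - 1) : ℤ) : ℂ) * w := by
    have h4 : (Ph F E : ℂ) ≠ 0 := by exact_mod_cast (Ph_pos F E).ne'
    have h5 := cc_ne F E
    have hcc : cc F E = (c' : ℂ) := cc_eq F E
    have h6 : (cc F E * Ph F E) * ee F ψ t s = (cc F E * Ph F E) * ((((-1) ^ (Module.finrank F E - 1) : ℤ) : ℂ) * w) := by
      have h7 := fst_ee F (ψ := ψ) t s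
      have h8 : (cc F E * Ph F E) * ee F ψ t s = fst F ψ s t - c' * SS F ψ t s := by rw [h7, ← hcc]; ring
      rw [h8, hw2, hcc, hc']
      have h9 : ((-1:ℂ) ^ (Module.finrank F E - 1)) * ((-1:ℂ) ^ (Module.finrank F E - 1)) = 1 := by
        rw [← mul_pow]; simp
      push_cast
      linear_combination (-(Fintype.card F:ℂ) ^ n0 F E * Ph F E * w) * h9
    exact mul_left_cancel₀ (mul_ne_zero h5 h4) h6
  rw [h3]
  exact (isInt_int _).mul hw

lemma hcn (z : ℂ) : z * (starRingEnd ℂ) z = ((‖z‖^2 : ℝ) : ℂ) := by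
  rw [Complex.mul_conj']; push_cast; rfl

variable (E) in
lemma card_M : (Fintype.card (E →ₗ[F] E) : ℝ) = ‖cc F E‖^2 * Fintype.card E := by
  have h1 : Fintype.card (E →ₗ[F] E) = Fintype.card F ^ (Module.finrank F E * Module.finrank F E) := by
    rw [Module.card_eq_pow_finrank (K := F) (V := E →ₗ[F] E), Module.finrank_linearMap]
  have h2 : Fintype.card E = Fintype.card F ^ Module.finrank F E := Module.card_eq_pow_finrank (K := F) (V := E)
  rw [cc_eq, h1, h2]
  push_cast
  rw [norm_mul, norm_pow, norm_pow, norm_neg, norm_one, one_pow, one_mul, Complex.norm_natCast, ← pow_mul, ← pow_add]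
  congr 1
  unfold n0
  have : 0 < Module.finrank F E := Module.finrank_pos
  obtain ⟨m, hm⟩ : ∃ m, Module.finrank F E = m + 1 := ⟨Module.finrank F E - 1, by omega⟩
  rw [hm]
  have h3 : Even ((m+1) * (m+1-1)) := by simpa [mul_comm] using Nat.even_mul_succ_self m
  rw [Nat.div_mul_cancel h3.two_dvd]
  simp; ring

include hψ in
lemma fst_norm_le {t : E} (ht : Rg F t) : ∑ s, ‖fst F ψ s t‖^2 ≤ Module.finrank F E * (‖cc F E‖^2 * Fintype.card E) := by
  have h := bessel_le F (FT ψ (NE F t))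
  have h1 : ∀ s, bs F (FT ψ (NE F t)) s = muR F E * fst F ψ s t := by
    intro s; unfold bs; rw [pair_FT F hψ ht, mu_eq]
  have h2 := FT_parseval hψ (NE F t) (NE_conj F t)
  rw [orthE, if_pos rfl, ht.ks] at h2
  simp_rw [hcn, mu_eq] at h2
  have h3 : ∑ X, ‖FT ψ (NE F t) X‖^2 = Fintype.card (E →ₗ[F] E) * muR F E := by
    rw [← Complex.ofReal_inj]; push_cast
    push_cast at h2; rw [h2]; ring
  have hm := muR_pos F E
  simp_rw [h1, norm_mul, mul_pow, Complex.norm_real, Real.norm_eq_abs, sq_abs] at h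
  rw [← Finset.mul_sum, h3, card_M] at h
  have : muR F E ^2 * ∑ s, ‖fst F ψ s t‖^2 ≤ muR F E ^2 * (Module.finrank F E * (‖cc F E‖^2 * Fintype.card E)) := by
    calc _ ≤ _ := h
      _ = _ := by ring
  exact le_of_mul_le_mul_left this (by positivity)

include hψ in
lemma ee_le {t : E} (ht : Rg F t) : (Ph F E : ℝ) * ∑ s, ‖ee F ψ t s‖^2 ≤ 2 * Module.finrank F E * ∑ s, ‖ee F ψ t s‖ := by
  have h1 := fst_norm_le F hψ ht
  have hP : (0:ℝ) < Ph F E := by exact_mod_cast Ph_pos F E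
  have hc : 0 < ‖cc F E‖ := norm_pos_iff.2 (cc_ne F E)
  have h2 : ∑ s, ‖SS F ψ t s‖^2 = Module.finrank F E * Fintype.card E := by
    have := SS_norm F hψ ht
    simp_rw [hcn] at this
    exact_mod_cast this
  simp_rw [fst_ee F t, norm_mul, mul_pow] at h1
  rw [← Finset.mul_sum] at h1
  have h3 : ∑ s, ‖SS F ψ t s + Ph F E * ee F ψ t s‖^2 ≤ ∑ s, ‖SS F ψ t s‖^2 := by
    rw [h2]
    have : ‖cc F E‖^2 * ∑ s, ‖SS F ψ t s + Ph F E * ee F ψ t s‖^2 ≤ ‖cc F E‖^2 * (Module.finrank F E * Fintype.card E) := by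
      calc _ ≤ _ := h1
        _ = _ := by ring
    exact le_of_mul_le_mul_left this (by positivity)
  have h4 : ∀ s, ‖SS F ψ t s‖^2 - 2 * Module.finrank F E * Ph F E * ‖ee F ψ t s‖ + (Ph F E)^2 * ‖ee F ψ t s‖^2 ≤ ‖SS F ψ t s + Ph F E * ee F ψ t s‖^2 := by
    intro s
    have h5 := abs_norm_sub_norm_le (SS F ψ t s) (-(Ph F E * ee F ψ t s))
    rw [sub_neg_eq_add, norm_neg] at h5
    have h6 : ‖(Ph F E : ℂ) * ee F ψ t s‖ = Ph F E * ‖ee F ψ t s‖ := by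
      rw [norm_mul, Complex.norm_intCast, abs_of_pos hP]
    rw [h6] at h5
    have h7 := sq_le_sq' (by linarith [norm_nonneg (SS F ψ t s + Ph F E * ee F ψ t s), abs_nonneg (‖SS F ψ t s‖ - Ph F E * ‖ee F ψ t s‖)]) h5
    rw [sq_abs] at h7
    have h8 := SS_le F (ψ := ψ) t s
    have h9 : 0 ≤ Ph F E * ‖ee F ψ t s‖ := by positivity
    nlinarith [mul_le_mul_of_nonneg_right h8 h9]
  have h10 := (Finset.sum_le_sum (fun s _ => h4 s)).trans h3
  rw [Finset.sum_add_distrib, Finset.sum_sub_distrib, ← Finset.mul_sum, ← Finset.mul_sum] at h10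
  have : (Ph F E : ℝ) * ((Ph F E : ℝ) * ∑ s, ‖ee F ψ t s‖^2) ≤ Ph F E * (2 * Module.finrank F E * ∑ s, ‖ee F ψ t s‖) := by nlinarith
  exact le_of_mul_le_mul_left this hP

section p
variable (p : ℕ) [Fact p.Prime] [Algebra (ZMod p) F]

lemma ee_scale (t s : E) (a : F) (ha : a ≠ 0) : ee F ψ t (algebraMap F E a * s) =
    ∑ X, (NE F s X / (cc F E * Ph F E)) * ψ (a * tp X (LinearMap.mulLeft F t)) + ∑ σ : E ≃ₐ[F] E, (-1 / (Ph F E : ℂ)) * ψ (a * Algebra.trace F E (t * σ s)) := by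
  have h1 : fst F ψ (algebraMap F E a * s) t = ∑ X, NE F s X * ψ (a * tp X (LinearMap.mulLeft F t)) := by
    unfold fst FT
    rw [← Equiv.sum_comp (LinearEquiv.smulOfNeZero F (E →ₗ[F] E) a ha).toEquiv]
    apply Finset.sum_congr rfl; intro X _
    simp only [LinearEquiv.coe_toEquiv, LinearEquiv.smulOfNeZero_apply]
    rw [NE_scale F a ha, tp_smul_left, mul_comm]
  have h2 : SS F ψ t (algebraMap F E a * s) = ∑ σ : E ≃ₐ[F] E, ψ (a * Algebra.trace F E (t * σ s)) := by
    unfold SS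
    apply Finset.sum_congr rfl; intro σ _
    rw [map_mul σ, AlgEquiv.commutes, mul_left_comm, ← Algebra.smul_def, map_smul, smul_eq_mul]
  unfold ee
  rw [h1, h2, sub_div, div_div, Finset.sum_div, Finset.sum_div, sub_eq_add_neg, ← Finset.sum_neg_distrib]
  congr 1
  · apply Finset.sum_congr rfl; intro X _; ring
  · apply Finset.sum_congr rfl; intro X _; ring

include hψ in
lemma ee_Z {t : E} (ht : Rg F t) (s : E) : ‖ee F ψ t s‖ ≤ ∑ a ∈ Finset.univ.erase (0 : ZMod p), ‖ee F ψ t (algebraMap F E (algebraMap (ZMod p) F a) * s)‖^2 := by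
  choose NZ hNZ using NE_int F s
  let m : (E →ₗ[F] E) ⊕ (E ≃ₐ[F] E) → ℚ := Sum.elim (fun X => NZ X / (((-1) ^ (Module.finrank F E - 1) * (Fintype.card F:ℤ) ^ n0 F E : ℤ) * Ph F E)) (fun σ => -1 / Ph F E)
  let x : (E →ₗ[F] E) ⊕ (E ≃ₐ[F] E) → F := Sum.elim (fun X => tp X (LinearMap.mulLeft F t)) (fun σ => Algebra.trace F E (t * σ s))
  let T : ZMod p → ℂ := fun a => ∑ i, (m i : ℂ) * ψ (algebraMap (ZMod p) F a * x i)
  have hinj : Function.Injective (algebraMap (ZMod p) F) := (algebraMap (ZMod p) F).injective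
  have hT : ∀ a, a ≠ 0 → ee F ψ t (algebraMap F E (algebraMap (ZMod p) F a) * s) = T a := by
    intro a ha
    rw [ee_scale F t s _ ((map_ne_zero_iff _ hinj).2 ha)]
    simp only [T, Fintype.sum_sum_type, m, x, Sum.elim_inl, Sum.elim_inr]
    congr 1
    · apply Finset.sum_congr rfl; intro X _
      rw [hNZ, cc_eq]; push_cast; rfl
    · apply Finset.sum_congr rfl; intro X _
      push_cast; rfl
  obtain ⟨r, hr⟩ := rat_sum p ψ m x T (fun a => rfl)
  have hr2 : ∑ a ∈ Finset.univ.erase (0 : ZMod p), T a * (starRingEnd ℂ) (T a) = ∑ a ∈ Finset.univ.erase (0 : ZMod p), 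
      ee F ψ t (algebraMap F E (algebraMap (ZMod p) F a) * s) * (starRingEnd ℂ) (ee F ψ t (algebraMap F E (algebraMap (ZMod p) F a) * s)) := by
    apply Finset.sum_congr rfl; intro a ha
    rw [hT a (Finset.ne_of_mem_erase ha)]
  rw [hr2] at hr
  have hIntg : IsIntegral ℤ (∑ a ∈ Finset.univ.erase (0 : ZMod p), 
      ee F ψ t (algebraMap F E (algebraMap (ZMod p) F a) * s) * (starRingEnd ℂ) (ee F ψ t (algebraMap F E (algebraMap (ZMod p) F a) * s))) := by
    apply IsIntegral.sum; intro a _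
    apply IsIntegral.mul (ee_integral F hψ ht _)
    exact (ee_integral F hψ ht _).map ((starRingEnd ℂ).toIntAlgHom)
  obtain ⟨z, hz⟩ := rat_integral hIntg r hr
  simp_rw [hcn] at hz
  have hz' : ∑ a ∈ Finset.univ.erase (0 : ZMod p), ‖ee F ψ t (algebraMap F E (algebraMap (ZMod p) F a) * s)‖^2 = (z:ℝ) := by
    exact_mod_cast hz
  have h1 : ‖ee F ψ t s‖^2 ≤ (z:ℝ) := by
    rw [← hz']
    have := Finset.single_le_sum (f := fun a : ZMod p => ‖ee F ψ t (algebraMap F E (algebraMap (ZMod p) F a) * s)‖^2) (s := Finset.univ.erase (0 : ZMod p)) (fun a _ => by positivity)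
      (Finset.mem_erase.2 ⟨one_ne_zero, Finset.mem_univ (1 : ZMod p)⟩)
    simpa using this
  rw [hz']
  by_cases h0 : z ≤ 0
  · have : (z:ℝ) ≤ 0 := by exact_mod_cast h0
    have h2 : ‖ee F ψ t s‖^2 = 0 := le_antisymm (h1.trans this) (by positivity)
    have h3 : ‖ee F ψ t s‖ = 0 := by simpa using h2
    rw [h2] at h1; rw [h3]; exact h1
  · have h3 : (1:ℝ) ≤ z := by exact_mod_cast (by omega : 1 ≤ z)
    by_contra hcon
    push Not at hcon
    nlinarith [norm_nonneg (ee F ψ t s)]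

include hψ in
lemma ee_zero {t : E} (ht : Rg F t) (hq : 2 * Module.finrank F E * p < Fintype.card F) (s : E) : ee F ψ t s = 0 := by
  have hinj : Function.Injective (algebraMap (ZMod p) F) := (algebraMap (ZMod p) F).injective
  have h1 : ∑ s, ‖ee F ψ t s‖ ≤ (p - 1 : ℕ) * ∑ s, ‖ee F ψ t s‖^2 := by
    refine (Finset.sum_le_sum (fun s _ => ee_Z F hψ p ht s)).trans ?_
    rw [Finset.sum_comm]
    have : ∀ a ∈ Finset.univ.erase (0 : ZMod p), ∑ s, ‖ee F ψ t (algebraMap F E (algebraMap (ZMod p) F a) * s)‖^2 = ∑ s, ‖ee F ψ t s‖^2 := by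
      intro a ha
      have ha0 : algebraMap F E (algebraMap (ZMod p) F a) ≠ 0 := by
        rw [_root_.map_ne_zero]
        exact (map_ne_zero_iff _ hinj).2 (Finset.ne_of_mem_erase ha)
      exact Equiv.sum_comp (Equiv.mulLeft₀ _ ha0) (fun s => ‖ee F ψ t s‖^2)
    rw [Finset.sum_congr rfl this, Finset.sum_const, Finset.card_erase_of_mem (Finset.mem_univ _), Finset.card_univ, ZMod.card, nsmul_eq_mul]
  have h2 := ee_le F hψ ht
  have h3 : (2 * Module.finrank F E * (p - 1 : ℕ) : ℝ) < Ph F E := by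
    have h4 := Ph_ge F E
    have hn : 0 < Module.finrank F E := Module.finrank_pos
    have hp : 1 < p := (Fact.out : p.Prime).one_lt
    have h5 : (2 * Module.finrank F E * (p - 1 : ℕ) : ℤ) < Ph F E := by
      push_cast [Nat.cast_sub hp.le]
      have h6 : (2 * Module.finrank F E * p : ℤ) < Fintype.card F := by exact_mod_cast hq
      nlinarith
    exact_mod_cast h5
  have h6 : ∑ s, ‖ee F ψ t s‖^2 = 0 := by
    apply le_antisymm _ (Finset.sum_nonneg (fun s _ => by positivity))
    by_contra hcon
    push Not at hcon
    have h7 : (2 * Module.finrank F E : ℝ) * ∑ s, ‖ee F ψ t s‖ ≤ (2 * Module.finrank F E : ℝ) * ((p - 1 : ℕ) * ∑ s, ‖ee F ψ t s‖^2) :=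
      mul_le_mul_of_nonneg_left h1 (by positivity)
    nlinarith [mul_lt_mul_of_pos_right h3 hcon]
  have := (Finset.sum_eq_zero_iff_of_nonneg (fun X _ => by positivity)).1 h6 s (Finset.mem_univ s)
  simpa using this

/-- `∑ ψ(Tr ts) N_s` -/
noncomputable def PP (ψ : AddChar F ℂ) (t : E) (X : E →ₗ[F] E) : ℂ := ∑ s, ψ (Algebra.trace F E (t * s)) * NE F s X

lemma NE_aut (σ : E ≃ₐ[F] E) (s : E) (X : E →ₗ[F] E) : NE F (σ s) X = NE F s X :=
  NE_congr F ((Normal.minpoly_eq_iff_mem_orbit E).2 ⟨σ, rfl⟩) X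

lemma sum_SS (t : E) (X : E →ₗ[F] E) : ∑ s, SS F ψ t s * NE F s X = Module.finrank F E * PP F ψ t X := by
  unfold SS PP
  simp_rw [Finset.sum_mul]
  rw [Finset.sum_comm]
  have : ∀ σ : E ≃ₐ[F] E, ∑ s, ψ (Algebra.trace F E (t * σ s)) * NE F s X = ∑ s, ψ (Algebra.trace F E (t * s)) * NE F s X := by
    intro σ
    symm; rw [← Equiv.sum_comp σ.toEquiv]
    apply Finset.sum_congr rfl; intro s _
    symm; rw [← NE_aut F σ s]; rfl
  rw [Finset.sum_congr rfl (fun σ _ => this σ), Finset.sum_const, Finset.card_univ, ← Nat.card_eq_fintype_card, IsGalois.card_aut_eq_finrank, nsmul_eq_mul]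

include hψ in
/-- Part E conclusion -/
lemma FT_R {t : E} (ht : Rg F t) (hq : 2 * Module.finrank F E * p < Fintype.card F) (X : E →ₗ[F] E) :
    FT ψ (NE F t) X = cc F E * PP F ψ t X := by
  have hf : ∀ s, fst F ψ s t = cc F E * SS F ψ t s := by
    intro s; rw [fst_ee, ee_zero F hψ p ht hq]; ring
  have hn : (Module.finrank F E : ℂ) ≠ 0 := by
    have : 0 < Module.finrank F E := Module.finrank_pos
    exact_mod_cast this.ne'
  have hm := mu_ne_zero F E
  have hb : ∀ s, bs F (FT ψ (NE F t)) s = mu F E * (cc F E * SS F ψ t s) := by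
    intro s; rw [← hf]; exact pair_FT F hψ ht s
  rw [bessel_eq F (FT ψ (NE F t)) _ X]
  · unfold GG
    have : ∀ s, bs F (FT ψ (NE F t)) s / (Module.finrank F E * mu F E) * NE F s X = cc F E / Module.finrank F E * (SS F ψ t s * NE F s X) := by
      intro s; rw [hb]; field_simp
    simp_rw [this]
    rw [← Finset.mul_sum, sum_SS]
    field_simp
  · have hmc : (starRingEnd ℂ) (mu F E) = mu F E := by rw [mu_eq]; simp
    have hcc : cc F E * (starRingEnd ℂ) (cc F E) * Fintype.card E = Fintype.card (E →ₗ[F] E) := by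
      rw [hcn]; exact_mod_cast (card_M F E).symm
    rw [FT_parseval hψ (NE F t) (NE_conj F t), orthE, if_pos rfl, ht.ks, ← hcc]
    have : ∀ s, bs F (FT ψ (NE F t)) s * (starRingEnd ℂ) (bs F (FT ψ (NE F t)) s) = mu F E * mu F E * (cc F E * (starRingEnd ℂ) (cc F E)) * (SS F ψ t s * (starRingEnd ℂ) (SS F ψ t s)) := by
      intro s
      rw [hb, RingHom.map_mul, RingHom.map_mul, hmc]; ring
    simp_rw [this]
    rw [← Finset.mul_sum, SS_norm F hψ ht]
    push_cast; ring
end p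
end E
end KL

set_option linter.unusedSectionVars false
namespace KL
open scoped Classical
open Polynomial
section E
variable (F : Type) {E : Type} [Field F] [Field E] [Fintype F] [Fintype E] [Algebra F E]
variable (ψ : AddChar F ℂ)

/-- Fourier transform on `E` -/
noncomputable def fh (f : E → ℂ) (r : E) : ℂ := ∑ s, ψ (Algebra.trace F E (r * s)) * f s

variable {ψ} (hψ : ∃ a : F, ψ a ≠ 1)

include hψ in
lemma fh_inv (f : E → ℂ) (u : E) : ∑ r, ψ (-Algebra.trace F E (r * u)) * fh F ψ f r = Fintype.card E * f u := by
  unfold fh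
  simp_rw [Finset.mul_sum]
  rw [Finset.sum_comm]
  have : ∀ s, ∑ r, ψ (-Algebra.trace F E (r * u)) * (ψ (Algebra.trace F E (r * s)) * f s) = (if s = u then (Fintype.card E : ℂ) * f s else 0) := by
    intro s
    have h := sum_tr F hψ (s - u)
    rw [sub_eq_zero] at h
    have h2 : ∀ r, ψ (-Algebra.trace F E (r * u)) * (ψ (Algebra.trace F E (r * s)) * f s) = ψ (Algebra.trace F E ((s - u) * r)) * f s := by
      intro r
      rw [← mul_assoc, ← AddChar.map_add_eq_mul, ← map_neg, ← map_add]
      congr 3; ring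
    simp_rw [h2]
    rw [← Finset.sum_mul, h]; split_ifs <;> simp
  simp_rw [this]
  simp

include hψ in
lemma unc (f : E → ℂ) (A B : Finset E) (hA : ∀ s, s ∉ A → f s = 0) (hB : ∀ s, s ∉ B → fh F ψ f s = 0)
    (hAB : A.card * B.card < Fintype.card E) (s : E) : f s = 0 := by
  obtain ⟨s0, -, h0⟩ := Finset.exists_max_image (Finset.univ : Finset E) (fun s => ‖f s‖) ⟨0, Finset.mem_univ _⟩
  have h1 : ∀ r, ‖fh F ψ f r‖ ≤ A.card * ‖f s0‖ := by
    intro r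
    unfold fh
    rw [← Finset.sum_subset (Finset.subset_univ A) (fun s _ hs => by rw [hA s hs, mul_zero])]
    refine (norm_sum_le _ _).trans ?_
    rw [← nsmul_eq_mul]
    apply Finset.sum_le_card_nsmul
    intro s _
    rw [norm_mul, psi_norm, one_mul]; exact h0 s (Finset.mem_univ _)
  have h2 : (Fintype.card E : ℝ) * ‖f s0‖ ≤ B.card * (A.card * ‖f s0‖) := by
    have h3 := congrArg norm (fh_inv F hψ f s0)
    rw [norm_mul, Complex.norm_natCast] at h3
    rw [← h3, ← Finset.sum_subset (Finset.subset_univ B) (fun s _ hs => by rw [hB s hs, mul_zero])]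
    refine (norm_sum_le _ _).trans ?_
    rw [← nsmul_eq_mul]
    apply Finset.sum_le_card_nsmul
    intro s _
    rw [norm_mul, psi_norm, one_mul]; exact h1 s
  have h4 : ‖f s0‖ = 0 := by
    by_contra hne
    have hpos : 0 < ‖f s0‖ := lt_of_le_of_ne (norm_nonneg _) (Ne.symm hne)
    have h5 : ((A.card * B.card : ℕ) : ℝ) < Fintype.card E := by exact_mod_cast hAB
    push_cast at h5
    nlinarith [mul_lt_mul_of_pos_right h5 hpos]
  have := h0 s (Finset.mem_univ _)
  rw [h4] at this
  exact norm_le_zero_iff.1 this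

lemma card_fix (d : ℕ) (hd : 1 ≤ d) : (Finset.univ.filter (fun s : E => s ^ (Fintype.card F ^ d) = s)).card ≤ Fintype.card F ^ d := by
  have hq : 1 < Fintype.card F := Fintype.one_lt_card
  have h1 : (X ^ (Fintype.card F ^ d) - X : E[X]) ≠ 0 := FiniteField.X_pow_card_pow_sub_X_ne_zero E (by omega) hq
  have h2 : (X ^ (Fintype.card F ^ d) - X : E[X]).natDegree = Fintype.card F ^ d := FiniteField.X_pow_card_pow_sub_X_natDegree_eq E (by omega) hq
  refine le_trans (Finset.card_le_card ?_) (((Multiset.toFinset_card_le _).trans (card_roots' _)).trans h2.le)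
  intro s hs
  rw [Finset.mem_filter] at hs
  rw [Multiset.mem_toFinset, mem_roots h1]
  simp [IsRoot, hs.2]

lemma card_bU (m : ℕ) (S : Finset E) (h : ∀ s ∈ S, ∃ d, 1 ≤ d ∧ d ≤ m ∧ s ^ (Fintype.card F ^ d) = s) : S.card ≤ m * Fintype.card F ^ m := by
  have hq : 0 < Fintype.card F := Fintype.card_pos
  have h1 : S ⊆ (Finset.Icc 1 m).biUnion (fun d => Finset.univ.filter (fun s : E => s ^ (Fintype.card F ^ d) = s)) := by
    intro s hs
    obtain ⟨d, h1, h2, h3⟩ := h s hs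
    rw [Finset.mem_biUnion]
    exact ⟨d, Finset.mem_Icc.2 ⟨h1, h2⟩, by simpa using h3⟩
  refine (Finset.card_le_card h1).trans (Finset.card_biUnion_le.trans ?_)
  have h2 : ∀ d ∈ Finset.Icc 1 m, (Finset.univ.filter (fun s : E => s ^ (Fintype.card F ^ d) = s)).card ≤ Fintype.card F ^ m := by
    intro d hd
    rw [Finset.mem_Icc] at hd
    exact (card_fix F d hd.1).trans (Nat.pow_le_pow_right hq hd.2)
  refine (Finset.sum_le_card_nsmul _ _ _ h2).trans ?_
  simp

lemma not_Rg {s : E} (hs : ¬ Rg F s) : ∃ d, d ∣ Module.finrank F E ∧ 1 ≤ d ∧ d ≠ Module.finrank F E ∧ s ^ (Fintype.card F ^ d) = s := by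
  have is : IsIntegral F s := Algebra.IsIntegral.isIntegral s
  refine ⟨(minpoly F s).natDegree, ⟨ks F s, (ks_mul F s).symm⟩, minpoly.natDegree_pos is, hs, ?_⟩
  have h1 := FiniteField.pow_card (IntermediateField.AdjoinSimple.gen F s)
  rw [Module.card_eq_pow_finrank (K := F) (V := IntermediateField.adjoin F {s}), IntermediateField.adjoin.finrank is] at h1
  have := congrArg (algebraMap _ E) h1
  rw [map_pow, IntermediateField.AdjoinSimple.algebraMap_gen] at this
  exact this

/-- fixed space -/
def HH (h : ℕ) : Submodule F E where
  carrier := {s | s ^ (Fintype.card F ^ h) = s}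
  zero_mem' := by
    have : Fintype.card F ≠ 0 := Fintype.card_ne_zero
    simp [this]
  add_mem' := by
    intro a b ha hb
    obtain ⟨p, hp⟩ := CharP.exists F
    obtain ⟨⟨n, hn⟩, hpp, hc⟩ := FiniteField.card F p
    have : CharP E p := charP_of_injective_algebraMap (algebraMap F E).injective p
    have : Fact p.Prime := ⟨hpp⟩
    simp only [Set.mem_ofPred_eq] at *
    rw [hc, ← pow_mul] at ha hb ⊢
    rw [add_pow_char_pow, ha, hb]
  smul_mem' := by
    intro c a ha
    simp only [Set.mem_ofPred_eq] at *
    rw [_root_.smul_pow, ha, FiniteField.pow_card_pow]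

lemma mem_HH (h : ℕ) (s : E) : s ∈ HH F h ↔ s ^ (Fintype.card F ^ h) = s := Iff.rfl

lemma card_HH (h : ℕ) (hh : 1 ≤ h) : Fintype.card (HH F h : Submodule F E) ≤ Fintype.card F ^ h := by
  refine le_trans (le_of_eq ?_) (card_fix (E := E) F h hh)
  rw [Fintype.card_subtype]
  rfl

include hψ in
lemma claimU (hq : 2 * Module.finrank F E ^ 2 < Fintype.card F) (φ : E → ℂ) (hφ : ∀ s, Rg F s → φ s = 0) (h0 : φ 0 = 0)
    (hφ' : ∀ s, Rg F s → fh F ψ φ s = 0) (s : E) : φ s = 0 := by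
  have hn : 0 < Module.finrank F E := Module.finrank_pos
  set n := Module.finrank F E with hnn
  set q := Fintype.card F with hqq
  have hq0 : 0 < q := by omega
  have hE : Fintype.card E = q ^ n := Module.card_eq_pow_finrank (K := F) (V := E)
  set NN : Finset E := Finset.univ.filter (fun s => ¬ Rg F s) with hNN
  have hcN : NN.card ≤ (n / 2) * q ^ (n / 2) := by
    apply card_bU F
    intro s hs
    rw [hNN, Finset.mem_filter] at hs
    obtain ⟨d, ⟨k, hk⟩, h2, h3, h4⟩ := not_Rg F hs.2
    refine ⟨d, h2, ?_, h4⟩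
    rw [← hnn] at hk h3
    rw [Nat.le_div_iff_mul_le (by norm_num), hk]
    apply Nat.mul_le_mul_left
    rcases k with _ | _ | k
    · omega
    · omega
    · omega
  have hA : ∀ s, s ∉ NN → φ s = 0 := fun s hs => hφ s (by simpa [hNN] using hs)
  have hB : ∀ s, s ∉ NN → fh F ψ φ s = 0 := fun s hs => hφ' s (by simpa [hNN] using hs)
  rcases Nat.even_or_odd' n with ⟨h, hh | hh⟩
  swap
  · apply unc F hψ φ NN NN hA hB
    rw [hE]
    have h2 : n / 2 = h := by omega
    rw [h2] at hcN
    calc NN.card * NN.card ≤ (h * q ^ h) * (h * q ^ h) := Nat.mul_le_mul hcN hcN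
      _ = (h * h) * q ^ (2 * h) := by ring
      _ < q * q ^ (2 * h) := by
        apply Nat.mul_lt_mul_of_pos_right _ (by positivity)
        nlinarith
      _ = q ^ n := by rw [hh]; ring
  have hh1 : 1 ≤ h := by omega
  have h2 : n / 2 = h := by omega
  rw [h2] at hcN
  set N' : Finset E := NN.filter (fun s => s ∉ (HH F h : Submodule F E)) with hN'
  have hcN' : N'.card ≤ (n / 3) * q ^ (n / 3) := by
    apply card_bU F
    intro s hs
    rw [hN', Finset.mem_filter, hNN, Finset.mem_filter] at hs
    obtain ⟨d, ⟨k, hk⟩, h2, h3, h4⟩ := not_Rg F hs.1.2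
    refine ⟨d, h2, ?_, h4⟩
    rw [← hnn] at hk h3
    rw [Nat.le_div_iff_mul_le (by norm_num), hk]
    apply Nat.mul_le_mul_left
    rcases k with _ | _ | _ | k
    · omega
    · omega
    · exfalso
      have : d = h := by omega
      subst this
      exact hs.2 h4
    · omega
  set W := LinearMap.BilinForm.orthogonal (Algebra.traceForm F E) (HH F h) with hW
  have hnd := traceForm_nondegenerate F E
  have hrefl : (Algebra.traceForm F E).IsRefl := (Algebra.traceForm_isSymm F).isRefl
  have hWmem : ∀ v, v ∈ W ↔ ∀ s ∈ (HH F h : Submodule F E), Algebra.trace F E (s * v) = 0 := by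
    intro v; rw [hW, LinearMap.BilinForm.mem_orthogonal_iff]; rfl
  have hper : ∀ v r, fh F ψ φ (r + v) = fh F ψ φ r + fh F ψ (fun s => φ s * (ψ (Algebra.trace F E (v * s)) - 1)) r := by
    intro v r
    unfold fh
    rw [← Finset.sum_add_distrib]
    apply Finset.sum_congr rfl; intro s _
    rw [add_mul, map_add, AddChar.map_add_eq_mul]; ring
  have hpow3 : n / 3 + 1 ≤ h := by omega
  have hfv : ∀ v ∈ W, ∀ s, φ s * (ψ (Algebra.trace F E (v * s)) - 1) = 0 := by
    intro v hv
    apply unc F hψ (fun s => φ s * (ψ (Algebra.trace F E (v * s)) - 1)) N' (NN ∪ NN.image (fun x => x - v))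
    · intro s hs
      by_cases h3 : s ∈ (HH F h : Submodule F E)
      · have := (hWmem v).1 hv s h3
        rw [mul_comm v s, this]; simp
      · rw [hA s, zero_mul]
        intro h4; exact hs (by rw [hN', Finset.mem_filter]; exact ⟨h4, h3⟩)
    · intro r hr
      rw [Finset.mem_union, not_or, Finset.mem_image] at hr
      have h3 := hper v r
      rw [hB r hr.1, hB (r + v) (fun h4 => hr.2 ⟨r + v, h4, by ring⟩), zero_add] at h3
      exact h3.symm
    · rw [hE]
      have hB2 : (NN ∪ NN.image (fun x => x - v)).card ≤ 2 * (h * q ^ h) := by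
        refine (Finset.card_union_le _ _).trans ?_
        have := Finset.card_image_le (s := NN) (f := fun x => x - v)
        omega
      calc N'.card * (NN ∪ NN.image (fun x => x - v)).card ≤ ((n / 3) * q ^ (n / 3)) * (2 * (h * q ^ h)) := Nat.mul_le_mul hcN' hB2
        _ = (2 * (n / 3) * h) * q ^ (n / 3 + h) := by ring
        _ ≤ (2 * n * n) * q ^ (n / 3 + h) := by
          apply Nat.mul_le_mul_right
          have h5 : n / 3 ≤ n := Nat.div_le_self _ _
          have h6 : h ≤ n := by omega
          exact Nat.mul_le_mul (Nat.mul_le_mul_left _ h5) h6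
        _ < q * q ^ (n / 3 + h) := by
          apply Nat.mul_lt_mul_of_pos_right _ (by positivity)
          nlinarith
        _ = q ^ (n / 3 + h + 1) := by ring
        _ ≤ q ^ n := Nat.pow_le_pow_right hq0 (by omega)
  have hsupp : ∀ s, s ∉ (HH F h : Submodule F E) → φ s = 0 := by
    intro s hs
    by_contra hne
    apply hs
    have h3 : ∀ v ∈ W, ψ (Algebra.trace F E (v * s)) = 1 := by
      intro v hv
      have := (mul_eq_zero.1 (hfv v hv s)).resolve_left hne
      exact sub_eq_zero.1 this
    have h4 : s ∈ LinearMap.BilinForm.orthogonal (Algebra.traceForm F E) W := by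
      rw [LinearMap.BilinForm.mem_orthogonal_iff]
      intro v hv
      show Algebra.trace F E (v * s) = 0
      by_contra hne'
      obtain ⟨a, ha⟩ := hψ
      apply ha
      have := h3 ((a / Algebra.trace F E (v * s)) • v) (W.smul_mem _ hv)
      rw [smul_mul_assoc, map_smul, smul_eq_mul, div_mul_cancel₀ _ hne'] at this
      exact this
    rwa [hW, LinearMap.BilinForm.orthogonal_orthogonal hnd hrefl] at h4
  have hper2 : ∀ v ∈ W, ∀ r, fh F ψ φ (r + v) = fh F ψ φ r := by
    intro v hv r
    rw [hper v r]
    have : fh F ψ (fun s => φ s * (ψ (Algebra.trace F E (v * s)) - 1)) r = 0 := by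
      unfold fh
      apply Finset.sum_eq_zero; intro s _
      show _ * (φ s * (ψ (Algebra.trace F E (v * s)) - 1)) = 0
      rw [hfv v hv, mul_zero]
    rw [this, add_zero]
  have hcH := card_HH (E := E) F h hh1
  have hcW : q ^ h ≤ Fintype.card W := by
    rw [Module.card_eq_pow_finrank (K := F) (V := W), hW, LinearMap.BilinForm.finrank_orthogonal hnd]
    rw [Module.card_eq_pow_finrank (K := F) (V := (HH F h : Submodule F E))] at hcH
    have h3 : Module.finrank F (HH F h : Submodule F E) ≤ h := (Nat.pow_le_pow_iff_right Fintype.one_lt_card).1 hcH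
    apply Nat.pow_le_pow_right hq0
    omega
  have hWf : Fintype.card W = (Finset.univ.filter (fun x => x ∈ W)).card := Fintype.card_subtype _
  have hsm : 2 * N'.card < q ^ h := by
    calc 2 * N'.card ≤ 2 * ((n / 3) * q ^ (n / 3)) := Nat.mul_le_mul_left _ hcN'
      _ = (2 * (n / 3)) * q ^ (n / 3) := by ring
      _ < q * q ^ (n / 3) := by
        apply Nat.mul_lt_mul_of_pos_right _ (by positivity)
        have h5 : n / 3 ≤ n := Nat.div_le_self _ _
        nlinarith
      _ = q ^ (n / 3 + 1) := by ring
      _ ≤ q ^ h := Nat.pow_le_pow_right hq0 hpow3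
  have hfz : ∀ r, fh F ψ φ r = 0 := by
    by_contra hcon
    push Not at hcon
    obtain ⟨r0, hr0⟩ := hcon
    have hcos : ∀ v ∈ W, r0 + v ∈ NN := by
      intro v hv
      by_contra hc
      exact hr0 (by rw [← hper2 v hv r0]; exact hB _ hc)
    have hWH : W ≤ HH F h := by
      by_contra hnot
      obtain ⟨v0, hv0, hv1⟩ := SetLike.not_le_iff_exists.1 hnot
      have h5 : Finset.univ.filter (fun x => x ∈ W) ⊆ N'.image (fun x => x - r0) ∪ N'.image (fun x => x - v0 - r0) := by
        intro v hv
        rw [Finset.mem_filter] at hv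
        rw [Finset.mem_union, Finset.mem_image, Finset.mem_image]
        by_cases h6 : r0 + v ∈ (HH F h : Submodule F E)
        · right
          refine ⟨r0 + v + v0, ?_, by ring⟩
          rw [hN', Finset.mem_filter]
          refine ⟨by rw [add_assoc]; exact hcos _ (W.add_mem hv.2 hv0), ?_⟩
          intro h7
          exact hv1 (by have := (HH F h : Submodule F E).sub_mem h7 h6; simpa using this)
        · left
          refine ⟨r0 + v, ?_, by ring⟩
          rw [hN', Finset.mem_filter]
          exact ⟨hcos v hv.2, h6⟩
      have h6 := (Finset.card_le_card h5).trans (Finset.card_union_le _ _)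
      have h7 := Finset.card_image_le (s := N') (f := fun x => x - r0)
      have h8 := Finset.card_image_le (s := N') (f := fun x => x - v0 - r0)
      omega
    have hsub : ∀ r, fh F ψ φ r ≠ 0 → r ∈ (HH F h : Submodule F E) := by
      intro r hr
      by_contra hnr
      have h5 : Finset.univ.filter (fun x => x ∈ W) ⊆ N'.image (fun x => x - r) := by
        intro v hv
        rw [Finset.mem_filter] at hv
        rw [Finset.mem_image]
        refine ⟨r + v, ?_, by ring⟩
        rw [hN', Finset.mem_filter]
        refine ⟨?_, ?_⟩
        · by_contra hc
          exact hr (by rw [← hper2 v hv.2 r]; exact hB _ hc)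
        · intro h7
          exact hnr (by have := (HH F h : Submodule F E).sub_mem h7 (hWH hv.2); simpa using this)
      have h6 := Finset.card_le_card h5
      have h7 := Finset.card_image_le (s := N') (f := fun x => x - r)
      omega
    have hEq : W = HH F h := by
      apply Submodule.eq_of_le_of_finrank_le hWH
      have h8 : Fintype.card (HH F h : Submodule F E) ≤ Fintype.card W := hcH.trans hcW
      rw [Module.card_eq_pow_finrank (K := F) (V := (HH F h : Submodule F E)), Module.card_eq_pow_finrank (K := F) (V := W)] at h8
      exact (Nat.pow_le_pow_iff_right Fintype.one_lt_card).1 h8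
    have h9 := fh_inv F hψ φ 0
    rw [h0, mul_zero] at h9
    have h10 : ∀ r, ψ (-Algebra.trace F E (r * 0)) * fh F ψ φ r = if r ∈ W then fh F ψ φ r0 else 0 := by
      intro r
      rw [mul_zero, map_zero, neg_zero, AddChar.map_zero_eq_one, one_mul]
      split_ifs with h11
      · have h12 := hper2 (r - r0) (W.sub_mem h11 (by rw [hEq]; exact hsub r0 hr0)) r0
        rw [add_sub_cancel] at h12
        exact h12
      · by_contra h12
        exact h11 (by rw [hEq]; exact hsub r h12)
    simp_rw [h10] at h9
    rw [← Finset.sum_filter, Finset.sum_const, ← hWf, nsmul_eq_mul] at h9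
    rcases mul_eq_zero.1 h9 with h13 | h13
    · have : Fintype.card W ≠ 0 := Fintype.card_ne_zero
      exact this (by exact_mod_cast h13)
    · exact hr0 h13
  have h14 := fh_inv F hψ φ s
  simp_rw [hfz, mul_zero] at h14
  rw [Finset.sum_const_zero] at h14
  have : (Fintype.card E : ℂ) ≠ 0 := by exact_mod_cast Fintype.card_ne_zero
  exact (mul_eq_zero.1 h14.symm).resolve_left this
end E
end KL

set_option linter.unusedSectionVars false
namespace KL
open scoped Classical
open Polynomial
section E
variable (F : Type) {E : Type} [Field F] [Field E] [Fintype F] [Fintype E] [Algebra F E]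
variable [Fintype (E →ₗ[F] E)]
variable {ψ : AddChar F ℂ} (hψ : ∃ a : F, ψ a ≠ 1)

variable (E) in
lemma cc_conj : (starRingEnd ℂ) (cc F E) = cc F E := by
  rw [cc_eq]; simp

variable (E) in
lemma cc_sq : cc F E * cc F E * Fintype.card E = Fintype.card (E →ₗ[F] E) := by
  have h : cc F E * (starRingEnd ℂ) (cc F E) * Fintype.card E = Fintype.card (E →ₗ[F] E) := by
    rw [hcn]; exact_mod_cast (card_M F E).symm
  rwa [cc_conj] at h

include hψ in
lemma FT_zero (X : E →ₗ[F] E) : FT ψ (NE F (0:E)) X = cc F E * PP F ψ (0:E) X := by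
  have hn : (Module.finrank F E : ℂ) ≠ 0 := by
    have : 0 < Module.finrank F E := Module.finrank_pos
    exact_mod_cast this.ne'
  have hm := mu_ne_zero F E
  have hb : ∀ s, bs F (FT ψ (NE F (0:E))) s = Module.finrank F E * mu F E * cc F E := by
    intro s
    have h1 : bs F (FT ψ (NE F (0:E))) s = ∑ Y, FT ψ (NE F s) Y * NE F (0:E) Y := by
      unfold bs
      rw [FT_adj]
      apply Finset.sum_congr rfl; intro Y _; ring
    have h2 := pairingE F (FT_cusp hψ (NE_cusp F s)) (FT_cls (ψ := ψ) (NE_cls F s)) (0:E)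
    have h3 : FT ψ (NE F s) (LinearMap.mulLeft F (0:E)) = mu F E := by
      unfold FT
      rw [← sum_NE F s]
      apply Finset.sum_congr rfl; intro Y _
      have : LinearMap.mulLeft F (0:E) = 0 := by ext; simp
      rw [this]; simp [tp]
    rw [← h1, h3, ks_zero] at h2
    have h4 := cc_Q0 F E
    have h5 := Qs_ne_zero F (0:E)
    apply mul_left_cancel₀ h5
    rw [h2, ← h4]; ring
  rw [bessel_eq F (FT ψ (NE F (0:E))) _ X]
  · unfold GG PP
    rw [Finset.mul_sum]
    apply Finset.sum_congr rfl; intro s _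
    rw [hb, zero_mul, map_zero, AddChar.map_zero_eq_one]; field_simp
  · have hmc : (starRingEnd ℂ) (mu F E) = mu F E := by rw [mu_eq]; simp
    rw [FT_parseval hψ (NE F (0:E)) (NE_conj F (0:E)), orthE, if_pos rfl, ks_zero, ← cc_sq]
    simp_rw [hb]
    rw [Finset.sum_const, Finset.card_univ, nsmul_eq_mul, RingHom.map_mul, RingHom.map_mul, hmc, cc_conj]
    simp; ring

variable (p : ℕ) [Fact p.Prime] [Algebra (ZMod p) F]

include hψ in
lemma FT_all (hq : 2 * Module.finrank F E * p < Fintype.card F) (hq' : 2 * Module.finrank F E ^ 2 < Fintype.card F) (t : E) (X : E →ₗ[F] E) :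
    FT ψ (NE F t) X = cc F E * PP F ψ t X := by
  rw [← sub_eq_zero]
  refine claimU F hψ hq' (fun s => FT ψ (NE F s) X - cc F E * PP F ψ s X) ?_ ?_ ?_ t
  · intro s hs
    show _ - _ = _
    rw [FT_R F hψ p hs hq, sub_self]
  · show _ - _ = _
    rw [FT_zero F hψ, sub_self]
  · intro r hr
    have h1 : ∑ s, ψ (Algebra.trace F E (r * s)) * FT ψ (NE F s) X = FT ψ (PP F ψ r) X := by
      unfold FT PP
      simp_rw [Finset.mul_sum]
      rw [Finset.sum_comm]
      apply Finset.sum_congr rfl; intro Y _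
      apply Finset.sum_congr rfl; intro s _
      ring
    have h2 : FT ψ (PP F ψ r) X = cc F E * Fintype.card E * NE F (-r) X := by
      have h3 : FT ψ (FT ψ (NE F r)) X = cc F E * FT ψ (PP F ψ r) X := by
        conv_lhs => unfold FT
        rw [show FT ψ (PP F ψ r) X = ∑ Y, ψ (tp Y X) * PP F ψ r Y from rfl, Finset.mul_sum]
        apply Finset.sum_congr rfl; intro Y _
        rw [show (∑ Z, ψ (tp Z Y) * NE F r Z) = FT ψ (NE F r) Y from rfl, FT_R F hψ p hr hq]; ring
      rw [FT_FT hψ, ← cc_sq] at h3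
      have h4 : NE F (-r) X = NE F r (-X) := by
        have := NE_scale F (-1) (by simp) r (-X)
        rw [← this]; simp
      apply mul_left_cancel₀ (cc_ne F E)
      rw [← h3, h4]; ring
    have h5 : ∑ s, ψ (Algebra.trace F E (r * s)) * PP F ψ s X = Fintype.card E * NE F (-r) X := by
      have h6 := fh_inv F hψ (fun s => NE F s X) (-r)
      rw [← h6]
      apply Finset.sum_congr rfl; intro s _
      unfold PP fh
      congr 2
      rw [mul_neg, map_neg, neg_neg, mul_comm]
    unfold fh
    simp_rw [mul_sub]
    rw [Finset.sum_sub_distrib, h1, h2]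
    have h7 : ∑ s, ψ (Algebra.trace F E (r * s)) * (cc F E * PP F ψ s X) = cc F E * ∑ s, ψ (Algebra.trace F E (r * s)) * PP F ψ s X := by
      rw [Finset.mul_sum]; apply Finset.sum_congr rfl; intro s _; ring
    rw [h7, h5]; ring
end E
end KL

set_option linter.unusedSectionVars false
namespace KL
open scoped Classical
open Polynomial

section cv
variable {G H : Type} [Group G] [Fintype G] [Group H] [Fintype H]
/-- k-fold convolution of functions on a group -/
noncomputable def cv {k : ℕ} (w : Fin k → G → ℂ) (x : G) : ℂ :=
  ∑ g : Fin k → G, if (List.ofFn g).prod = x then ∏ i, w i (g i) else 0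

lemma cv_zero (w : Fin 0 → G → ℂ) (x : G) : cv w x = if x = 1 then 1 else 0 := by
  unfold cv
  simp [eq_comm]

lemma cv_succ {k : ℕ} (w : Fin (k+1) → G → ℂ) (x : G) : cv w x = ∑ g, w 0 g * cv (fun i => w i.succ) (g⁻¹ * x) := by
  unfold cv
  rw [← (Fin.consEquiv (fun _ : Fin (k+1) => G)).sum_comp, Fintype.sum_prod_type]
  apply Finset.sum_congr rfl; intro g _
  rw [Finset.mul_sum]
  apply Finset.sum_congr rfl; intro f _
  simp only [Fin.consEquiv_apply, Fin.prod_univ_succ, Fin.cons_zero, Fin.cons_succ, eq_inv_mul_iff_mul_eq]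
  rw [List.ofFn_succ, List.prod_cons, mul_ite, mul_zero]
  rfl

lemma cv_equiv (e : G ≃* H) {k : ℕ} (w : Fin k → H → ℂ) (x : G) : cv w (e x) = cv (fun i g => w i (e g)) x := by
  induction k generalizing x with
  | zero => rw [cv_zero, cv_zero]; simp
  | succ k ih =>
    rw [cv_succ, cv_succ, ← e.toEquiv.sum_comp]
    apply Finset.sum_congr rfl; intro g _
    have := ih (fun i => w i.succ) (g⁻¹ * x)
    rw [← this]
    simp

lemma cv_cls {k : ℕ} (w : Fin k → G → ℂ) (hw : ∀ i g h, w i (g * h * g⁻¹) = w i h) (g x : G) : cv w (g * x * g⁻¹) = cv w x := by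
  have := cv_equiv (MulAut.conj g) w x
  simp only [MulAut.conj_apply, hw] at this
  exact this
end cv

section charpoly
variable {F : Type} [Field F] {V : Type} [AddCommGroup V] [Module F V] [Module.Finite F V]

lemma monic_pow_of_dvd {p : F[X]} (hp : Irreducible p) (pm : p.Monic) (n : ℕ) : ∀ f : F[X], f.natDegree ≤ n → f.Monic → 
    (∀ g, Irreducible g → g ∣ f → g ∣ p) → ∃ m, f = p ^ m := by
  induction n with
  | zero =>
    intro f h1 h2 _
    exact ⟨0, by rw [pow_zero]; exact h2.natDegree_eq_zero.1 (by omega)⟩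
  | succ n ih =>
    intro f h1 h2 h3
    by_cases h4 : IsUnit f
    · exact ⟨0, by rw [pow_zero]; exact h2.eq_one_of_isUnit h4⟩
    · obtain ⟨g, hg, hgf⟩ := WfDvdMonoid.exists_irreducible_factor h4 h2.ne_zero
      have hpg : Associated g p := hg.associated_of_dvd hp (h3 g hg hgf)
      obtain ⟨f', rfl⟩ := hpg.symm.dvd.trans hgf
      have hf' : f'.Monic := pm.of_mul_monic_left h2
      have hd : 0 < p.natDegree := hp.natDegree_pos
      rw [pm.natDegree_mul hf'] at h1
      obtain ⟨m, rfl⟩ := ih f' (by omega) hf' (fun g hg hgf => h3 g hg (hgf.mul_left p))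
      exact ⟨m+1, by rw [pow_succ']⟩

lemma charpoly_prim {p : F[X]} (hp : Irreducible p) (pm : p.Monic) (X : V →ₗ[F] V) (hX : IsNilpotent (aeval X p)) :
    ∃ m, X.charpoly = p ^ m := by
  apply monic_pow_of_dvd hp pm _ _ le_rfl (LinearMap.charpoly_monic X)
  intro g hg hgf
  have := Fact.mk hg
  let b := Module.finBasis F V
  let A := LinearMap.toMatrix b b X
  let K := AdjoinRoot g
  let a : K := AdjoinRoot.root g
  have h1 : (A.map (algebraMap F K)).charpoly.IsRoot a := by
    rw [Matrix.charpoly_map]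
    obtain ⟨u, hu⟩ := hgf
    have h2 : A.charpoly = g * u := by rw [← hu]; exact LinearMap.charpoly_toMatrix X b
    rw [h2]
    rw [IsRoot, eval_map, eval₂_mul]
    have : eval₂ (algebraMap F K) a g = 0 := AdjoinRoot.eval₂_root g
    rw [this, zero_mul]
  rw [← Matrix.charpoly_toLin', ← Module.End.hasEigenvalue_iff_isRoot_charpoly] at h1
  obtain ⟨v, hv⟩ := h1.exists_hasEigenvector
  obtain ⟨j, hj⟩ := hX
  have h3 : aeval (Matrix.toLin' (A.map (algebraMap F K))) ((p ^ j).map (algebraMap F K)) = 0 := by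
    have h4 : aeval (A.map (algebraMap F K)) (p ^ j) = 0 := by
      have h5 : aeval A (p ^ j) = 0 := by
        have : aeval A (p ^ j) = LinearMap.toMatrixAlgEquiv b (aeval X (p ^ j)) := by
          rw [← aeval_algHom_apply]; rfl
        rw [this, map_pow, hj, map_zero]
      have : aeval (A.map (algebraMap F K)) (p ^ j) = (Algebra.ofId F K).mapMatrix (aeval A (p ^ j)) := by
        rw [← aeval_algHom_apply]; rfl
      rw [this, h5, map_zero]
    have h6 : aeval (Matrix.toLinAlgEquiv' (A.map (algebraMap F K))) ((p ^ j).map (algebraMap F K)) = Matrix.toLinAlgEquiv' (aeval (A.map (algebraMap F K)) ((p ^ j).map (algebraMap F K))) := by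
      rw [← aeval_algHom_apply]
    rw [aeval_map_algebraMap, aeval_map_algebraMap, h4, map_zero] at h6
    rw [aeval_map_algebraMap]
    exact h6
  have h7 := Module.End.aeval_apply_of_hasEigenvector (p := (p ^ j).map (algebraMap F K)) hv
  rw [h3, LinearMap.zero_apply, eq_comm, smul_eq_zero] at h7
  have h8 := h7.resolve_right hv.2
  rw [eval_map, eval₂_pow] at h8
  have h9 : aeval (AdjoinRoot.root g) p = 0 := eq_zero_of_pow_eq_zero h8
  rw [AdjoinRoot.aeval_eq, AdjoinRoot.mk_eq_zero] at h9
  exact h9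
end charpoly
end KL

set_option linter.unusedSectionVars false
namespace KL
open scoped Classical
open Polynomial

section rv
variable {F : Type} [Field F]
/-- reversed polynomial -/
noncomputable def rv (P : F[X]) : F[X] := ∑ i ∈ Finset.range (P.natDegree + 1), C (P.coeff i) * X ^ (P.natDegree - i)

lemma aeval_rv {A : Type} [Ring A] [Algebra F A] (P : F[X]) (x y : A) (h : x * y = 1) : aeval x (rv P) = x ^ P.natDegree * aeval y P := by
  unfold rv
  rw [aeval_eq_sum_range (p := P), Finset.mul_sum, map_sum]
  apply Finset.sum_congr rfl; intro i hi
  have hi : i ≤ P.natDegree := by have := Finset.mem_range.1 hi; omega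
  rw [map_mul, aeval_C, map_pow, aeval_X, mul_smul_comm, Algebra.smul_def]
  congr 1
  obtain ⟨j, hj⟩ := Nat.exists_eq_add_of_le' hi
  rw [hj, Nat.add_sub_cancel, pow_add, mul_assoc]
  have : ∀ i : ℕ, x ^ i * y ^ i = 1 := by
    intro i
    induction i with
    | zero => simp
    | succ i ih => rw [pow_succ, pow_succ', mul_assoc, ← mul_assoc x, h, one_mul, ih]
  rw [this, mul_one]

lemma rv_deg (P : F[X]) : (rv P).natDegree ≤ P.natDegree := by
  unfold rv
  apply natDegree_sum_le_of_forall_le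
  intro i _
  exact (natDegree_C_mul_X_pow_le _ _).trans (Nat.sub_le _ _)

lemma rv_ne (P : F[X]) (hP : P.Monic) : rv P ≠ 0 := by
  intro h
  have h1 := congrArg (fun f => coeff f 0) h
  simp only [rv, finsetSum_coeff, coeff_C_mul, coeff_X_pow, coeff_zero] at h1
  rw [Finset.sum_eq_single P.natDegree] at h1
  · simp [hP] at h1
  · intro i hi hne
    have := Finset.mem_range.1 hi
    rw [if_neg (by omega), mul_zero]
  · intro h; simp at h

variable {E : Type} [Field E] [Algebra F E] [FiniteDimensional F E]

lemma rv_minpoly_dvd (r : E) (hr : r ≠ 0) : minpoly F r ∣ rv (minpoly F r⁻¹) := by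
  apply minpoly.dvd
  rw [aeval_rv _ r r⁻¹ (mul_inv_cancel₀ hr), minpoly.aeval, mul_zero]

lemma deg_inv_le (r : E) (hr : r ≠ 0) : (minpoly F r).natDegree ≤ (minpoly F r⁻¹).natDegree :=
  (natDegree_le_of_dvd (rv_minpoly_dvd r hr) (rv_ne _ (minpoly.monic (IsIntegral.of_finite F _)))).trans (rv_deg _)

lemma deg_inv (r : E) (hr : r ≠ 0) : (minpoly F r⁻¹).natDegree = (minpoly F r).natDegree := by
  apply le_antisymm _ (deg_inv_le r hr)
  have := deg_inv_le (F := F) r⁻¹ (inv_ne_zero hr)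
  rwa [inv_inv] at this

lemma rv_eq (r : E) (hr : r ≠ 0) : ∃ u : F, u ≠ 0 ∧ rv (minpoly F r⁻¹) = C u * minpoly F r := by
  obtain ⟨f, hf⟩ := rv_minpoly_dvd (F := F) r hr
  have h0 := rv_ne (minpoly F r⁻¹) (minpoly.monic (IsIntegral.of_finite F _))
  have hf0 : f ≠ 0 := by rintro rfl; rw [mul_zero] at hf; exact h0 hf
  have h1 := rv_deg (minpoly F r⁻¹)
  rw [hf, natDegree_mul (minpoly.ne_zero (IsIntegral.of_finite F _)) hf0, deg_inv r hr] at h1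
  have h2 : f.natDegree = 0 := by omega
  rw [natDegree_eq_zero] at h2
  obtain ⟨u, rfl⟩ := h2
  refine ⟨u, ?_, by rw [hf, mul_comm]⟩
  rintro rfl; simp at hf0

end rv

variable (F : Type) {E : Type} [Field F] [Field E] [Fintype F] [Fintype E] [Algebra F E]

lemma NE_inv (r : E) (hr : r ≠ 0) (h : (E →ₗ[F] E)ˣ) : NE F r⁻¹ ((h⁻¹ : (E →ₗ[F] E)ˣ) : E →ₗ[F] E) = NE F r (h : E →ₗ[F] E) := by
  obtain ⟨u, hu, he⟩ := rv_eq (F := F) r hr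
  have h1 := aeval_rv (minpoly F r⁻¹) (h : E →ₗ[F] E) ((h⁻¹ : (E →ₗ[F] E)ˣ) : E →ₗ[F] E) h.mul_inv
  rw [he, map_mul, aeval_C] at h1
  set B := aeval (h : E →ₗ[F] E) (minpoly F r)
  set A := aeval ((h⁻¹ : (E →ₗ[F] E)ˣ) : E →ₗ[F] E) (minpoly F r⁻¹) with hA
  set d := (minpoly F r⁻¹).natDegree
  have hinj : ∀ x : E, ((h : E →ₗ[F] E)^d) x = 0 → x = 0 := by
    intro x hx
    have : ((((h⁻¹ : (E →ₗ[F] E)ˣ) : E →ₗ[F] E)^d) * ((h : E →ₗ[F] E)^d)) x = 0 := by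
      rw [Module.End.mul_apply, hx, map_zero]
    rwa [← Units.val_pow_eq_pow_val, ← Units.val_pow_eq_pow_val, ← Units.val_mul, inv_pow, inv_mul_cancel, Units.val_one, Module.End.one_apply] at this
  have hpt : ∀ x, u • B x = ((h : E →ₗ[F] E)^d) (A x) := by
    intro x
    have := LinearMap.congr_fun h1 x
    simpa [Module.End.mul_apply] using this
  have hk : LinearMap.ker A = LinearMap.ker B := by
    ext x
    rw [LinearMap.mem_ker, LinearMap.mem_ker]
    constructor
    · intro hx
      have := hpt x
      rw [hx, map_zero, smul_eq_zero] at this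
      exact this.resolve_left hu
    · intro hx
      have := hpt x
      rw [hx, smul_zero] at this
      exact hinj _ this.symm
  have hcomm : Commute ((h : E →ₗ[F] E)^d) A := by
    apply Commute.pow_left
    have h2 : Commute ((h⁻¹ : (E →ₗ[F] E)ˣ) : E →ₗ[F] E) A := by
      have := (Commute.all (X : F[X]) (minpoly F r⁻¹)).map (aeval ((h⁻¹ : (E →ₗ[F] E)ˣ) : E →ₗ[F] E))
      rwa [aeval_X] at this
    exact Commute.units_inv_left_iff.1 h2
  have hn : IsNilpotent A ↔ IsNilpotent B := by
    have hu' : IsUnit ((h : E →ₗ[F] E)^d) := h.isUnit.pow d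
    rw [← hu'.isNilpotent_unit_mul_of_commute_iff hcomm.symm, ← h1, ← Algebra.smul_def]
    constructor
    · intro hh
      have := hh.smul u⁻¹
      rwa [smul_smul, inv_mul_cancel₀ hu, one_smul] at this
    · intro hh
      exact hh.smul u
  unfold NE Np
  rw [← hA, hk, deg_inv (F := F) r hr]
  simp only [hn]
  rfl

lemma NE_det (t : E) (X : E →ₗ[F] E) (h : NE F t X ≠ 0) : LinearMap.det X = Algebra.norm F t := by
  have hp : Irreducible (minpoly F t) := minpoly.irreducible (IsIntegral.of_finite F _)
  have pm : (minpoly F t).Monic := minpoly.monic (IsIntegral.of_finite F _)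
  have hX : IsNilpotent (aeval X (minpoly F t)) := by
    by_contra h1; exact h (NE_eq_zero F h1)
  obtain ⟨m, hm⟩ := charpoly_prim hp pm X hX
  obtain ⟨m', hm'⟩ := charpoly_prim hp pm (LinearMap.mulLeft F t) ⟨1, by rw [pow_one, aeval_mulLeft, minpoly.aeval]; ext; simp⟩
  have h1 := LinearMap.charpoly_natDegree X
  have h2 := LinearMap.charpoly_natDegree (LinearMap.mulLeft F t)
  rw [hm, natDegree_pow] at h1
  rw [hm', natDegree_pow] at h2
  have h3 : m = m' := Nat.eq_of_mul_eq_mul_right hp.natDegree_pos (h1.trans h2.symm)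
  rw [LinearMap.det_eq_sign_charpoly_coeff, hm, h3, ← hm', ← LinearMap.det_eq_sign_charpoly_coeff]
  rfl
end KL

set_option linter.unusedSectionVars false
namespace KL
open scoped Classical
open Polynomial

lemma sum_units {M : Type} [Monoid M] [Fintype M] [Fintype Mˣ] (f : M → ℂ) (h : ∀ x, ¬ IsUnit x → f x = 0) : ∑ u : Mˣ, f u = ∑ x, f x := by
  apply Fintype.sum_of_injective (fun u : Mˣ => (u : M)) Units.val_injective
  · intro x hx
    apply h
    rintro ⟨u, rfl⟩
    exact hx ⟨u, rfl⟩
  · intro _; rfl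

variable (F : Type) {E : Type} [Field F] [Field E] [Fintype F] [Fintype E] [Algebra F E]

/-- weight on the linear group -/
noncomputable def wM (α : Fˣ →* ℂˣ) (ψ : AddChar F ℂ) (g : (E →ₗ[F] E)ˣ) : ℂ :=
  (α (Units.map (LinearMap.det : (E →ₗ[F] E) →* F) g) : ℂ) * ψ (LinearMap.trace F E g)

/-- weight on the field -/
noncomputable def vE (α : Fˣ →* ℂˣ) (ψ : AddChar F ℂ) (t : Eˣ) : ℂ :=
  (α (Units.map (Algebra.norm F : E →* F) t) : ℂ) * ψ (Algebra.trace F E t)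

variable [Fintype (E →ₗ[F] E)]

lemma NE_det_unit (t : Eˣ) (g : (E →ₗ[F] E)ˣ) (h : NE F (t:E) (g : E →ₗ[F] E) ≠ 0) :
    Units.map (LinearMap.det : (E →ₗ[F] E) →* F) g = Units.map (Algebra.norm F : E →* F) t := by
  ext
  exact NE_det F (t:E) g h

lemma NE_nonunit (t : Eˣ) (X : E →ₗ[F] E) (h : ¬ IsUnit X) : NE F (t:E) X = 0 := by
  by_contra h1
  apply h
  have := NE_det F (t:E) X h1
  rw [LinearMap.isUnit_iff_isUnit_det, this]
  exact t.isUnit.map _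

lemma NE_zero_unit (h : (E →ₗ[F] E)ˣ) : NE F (0:E) (h : E →ₗ[F] E) = 0 := by
  by_contra h1
  have h2 := NE_det F (0:E) h h1
  have h3 : IsUnit (LinearMap.det (h : E →ₗ[F] E)) := (LinearMap.isUnit_iff_isUnit_det _).1 h.isUnit
  rw [h2, Algebra.norm_zero] at h3
  exact not_isUnit_zero h3

lemma step_inner {ψ : AddChar F ℂ} (hψ : ∃ a, ψ a ≠ 1) (p : ℕ) [Fact p.Prime] [Algebra (ZMod p) F]
    (hq : 2 * Module.finrank F E * p < Fintype.card F) (hq' : 2 * Module.finrank F E ^ 2 < Fintype.card F)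
    (α : Fˣ →* ℂˣ) (t : Eˣ) (h : (E →ₗ[F] E)ˣ) :
    ∑ g : (E →ₗ[F] E)ˣ, wM F α ψ g * NE F (t:E) ((g * h : (E →ₗ[F] E)ˣ) : E →ₗ[F] E) =
      cc F E * ∑ r : Eˣ, vE F α ψ (t * r⁻¹) * NE F (r:E) (h : E →ₗ[F] E) := by
  have h1 : ∑ g : (E →ₗ[F] E)ˣ, ψ (tp (g : E →ₗ[F] E) ((h⁻¹ : (E →ₗ[F] E)ˣ) : E →ₗ[F] E)) * NE F (t:E) (g : E →ₗ[F] E)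
      = cc F E * ∑ r : Eˣ, ψ (Algebra.trace F E (t * r⁻¹)) * NE F (r:E) (h : E →ₗ[F] E) := by
    rw [sum_units (fun X : E →ₗ[F] E => ψ (tp X ((h⁻¹ : (E →ₗ[F] E)ˣ) : E →ₗ[F] E)) * NE F (t:E) X)
      (fun X hX => by rw [NE_nonunit F t X hX, mul_zero])]
    have := FT_all F hψ p hq hq' (t:E) ((h⁻¹ : (E →ₗ[F] E)ˣ) : E →ₗ[F] E)
    unfold FT at this
    rw [this]
    unfold PP
    rw [← sum_units]
    · congr 1
      rw [← Equiv.sum_comp (Equiv.inv Eˣ)]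
      apply Finset.sum_congr rfl; intro r _
      rw [Equiv.inv_apply, Units.val_inv_eq_inv_val, NE_inv F (r:E) r.ne_zero]
    · intro x hx
      have : x = 0 := by by_contra h; exact hx (isUnit_iff_ne_zero.2 h)
      rw [this, NE_zero_unit, mul_zero]
  rw [← Equiv.sum_comp (Equiv.mulRight h⁻¹)]
  have h2 : ∀ g : (E →ₗ[F] E)ˣ, wM F α ψ (Equiv.mulRight h⁻¹ g) * NE F (t:E) ((Equiv.mulRight h⁻¹ g * h : (E →ₗ[F] E)ˣ) : E →ₗ[F] E)
     = ((α (Units.map (Algebra.norm F : E →* F) t * (Units.map (LinearMap.det : (E →ₗ[F] E) →* F) h)⁻¹) : ℂˣ) : ℂ) * (ψ (tp (g : E →ₗ[F] E) ((h⁻¹ : (E →ₗ[F] E)ˣ) : E →ₗ[F] E)) * NE F (t:E) (g : E →ₗ[F] E)) := by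
    intro g
    simp only [Equiv.coe_mulRight, inv_mul_cancel_right]
    by_cases h3 : NE F (t:E) (g : E →ₗ[F] E) = 0
    · rw [h3]; simp
    · rw [← NE_det_unit F t g h3]
      unfold wM
      rw [MonoidHom.map_mul (Units.map _), MonoidHom.map_inv (Units.map (LinearMap.det : (E →ₗ[F] E) →* F)), mul_assoc]
      rfl
  rw [Finset.sum_congr rfl (fun g _ => h2 g), ← Finset.mul_sum, h1, mul_left_comm]
  congr 1
  rw [Finset.mul_sum]
  apply Finset.sum_congr rfl; intro r _
  by_cases h3 : NE F (r:E) (h : E →ₗ[F] E) = 0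
  · rw [h3]; simp
  · rw [NE_det_unit F r h h3]
    unfold vE
    rw [MonoidHom.map_mul (Units.map _), MonoidHom.map_inv (Units.map (Algebra.norm F : E →* F)), mul_assoc]
    simp only [Units.val_mul, Units.val_inv_eq_inv_val]

lemma RR_all {ψ : AddChar F ℂ} (hψ : ∃ a, ψ a ≠ 1) (p : ℕ) [Fact p.Prime] [Algebra (ZMod p) F]
    (hq : 2 * Module.finrank F E * p < Fintype.card F) (hq' : 2 * Module.finrank F E ^ 2 < Fintype.card F)
    {k : ℕ} (α : Fin k → Fˣ →* ℂˣ) (t : Eˣ) :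
    ∑ g : (E →ₗ[F] E)ˣ, cv (fun i => wM (E := E) F (α i) ψ) g * NE F (t:E) (g : E →ₗ[F] E) =
      cc F E ^ k * Qs F (0:E) * cv (fun i => vE (E := E) F (α i) ψ) t := by
  induction k generalizing t with
  | zero =>
    simp only [cv_zero, ite_mul, one_mul, zero_mul, Finset.sum_ite_eq', Finset.mem_univ, if_true, pow_zero, mul_ite, mul_one, mul_zero]
    have h1 : ((1 : (E →ₗ[F] E)ˣ) : E →ₗ[F] E) = LinearMap.mulLeft F (1:E) := by ext; simp
    rw [h1, NE_lm']
    have h2 : aeval (1:E) (minpoly F (t:E)) = 0 ↔ t = 1 := by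
      constructor
      · intro h
        have h3 := minpoly.eq_of_irreducible_of_monic (minpoly.irreducible (IsIntegral.of_finite F (t:E))) h (minpoly.monic (IsIntegral.of_finite F _))
        have h4 := minpoly.aeval F (t:E)
        rw [h3, minpoly.one, map_sub, aeval_X, map_one, sub_eq_zero] at h4
        exact Units.ext h4
      · rintro rfl
        rw [Units.val_one, minpoly.aeval]
    simp only [h2]
    split_ifs with h3
    · rw [h3, Units.val_one]
      have h4 : (minpoly F (1:E)).natDegree = (minpoly F (0:E)).natDegree := by
        rw [minpoly_zero_natDegree, minpoly.one]; exact natDegree_X_sub_C (1:F)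
      have h5 := ks_mul F (1:E)
      rw [h4, minpoly_zero_natDegree, one_mul, ← ks_zero] at h5
      unfold Qs
      rw [h4, h5]
    · rfl
  | succ k ih =>
    have h1 : ∀ g : (E →ₗ[F] E)ˣ, cv (fun i => wM (E := E) F (α i) ψ) g * NE F (t:E) (g : E →ₗ[F] E) =
        ∑ a : (E →ₗ[F] E)ˣ, wM F (α 0) ψ a * cv (fun i => wM (E := E) F (α i.succ) ψ) (a⁻¹ * g) * NE F (t:E) (g : E →ₗ[F] E) := by
      intro g
      rw [cv_succ, Finset.sum_mul]
    rw [Finset.sum_congr rfl (fun g _ => h1 g), Finset.sum_comm]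
    have h2 : ∀ a : (E →ₗ[F] E)ˣ, ∑ g : (E →ₗ[F] E)ˣ, wM F (α 0) ψ a * cv (fun i => wM (E := E) F (α i.succ) ψ) (a⁻¹ * g) * NE F (t:E) (g : E →ₗ[F] E) =
        ∑ h : (E →ₗ[F] E)ˣ, cv (fun i => wM (E := E) F (α i.succ) ψ) h * (wM F (α 0) ψ a * NE F (t:E) ((a * h : (E →ₗ[F] E)ˣ) : E →ₗ[F] E)) := by
      intro a
      rw [← Equiv.sum_comp (Equiv.mulLeft a)]
      apply Finset.sum_congr rfl; intro h _
      simp only [Equiv.coe_mulLeft, inv_mul_cancel_left]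
      ring
    rw [Finset.sum_congr rfl (fun g _ => h2 g), Finset.sum_comm]
    simp only [← Finset.mul_sum, step_inner F hψ p hq hq']
    have h3 : ∀ h : (E →ₗ[F] E)ˣ, cv (fun i => wM (E := E) F (α i.succ) ψ) h * (cc F E * ∑ r : Eˣ, vE F (α 0) ψ (t * r⁻¹) * NE F (r:E) (h : E →ₗ[F] E))
       = ∑ r : Eˣ, (cc F E * vE F (α 0) ψ (t * r⁻¹)) * (cv (fun i => wM (E := E) F (α i.succ) ψ) h * NE F (r:E) (h : E →ₗ[F] E)) := by
      intro h
      rw [Finset.mul_sum, Finset.mul_sum]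
      apply Finset.sum_congr rfl; intro r _
      ring
    rw [Finset.sum_congr rfl (fun g _ => h3 g), Finset.sum_comm]
    simp only [← Finset.mul_sum, ih (fun i => α i.succ)]
    rw [cv_succ, Finset.mul_sum, ← ((Equiv.inv Eˣ).trans (Equiv.mulLeft t)).sum_comp]
    apply Finset.sum_congr rfl; intro r _
    simp only [Equiv.trans_apply, Equiv.inv_apply, Equiv.coe_mulLeft, mul_inv_rev, inv_inv]
    rw [mul_comm r t⁻¹, mul_inv_cancel_left, mul_comm r⁻¹ t]
    ring

lemma wM_cls (α : Fˣ →* ℂˣ) (ψ : AddChar F ℂ) (g h : (E →ₗ[F] E)ˣ) : wM F α ψ (g * h * g⁻¹) = wM F α ψ h := by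
  unfold wM
  have h1 : Units.map (LinearMap.det : (E →ₗ[F] E) →* F) (g * h * g⁻¹) = Units.map (LinearMap.det : (E →ₗ[F] E) →* F) h := by
    rw [MonoidHom.map_mul, MonoidHom.map_mul, MonoidHom.map_inv, mul_comm, inv_mul_cancel_left]
  have h2 : LinearMap.trace F E ((g * h * g⁻¹ : (E →ₗ[F] E)ˣ) : E →ₗ[F] E) = LinearMap.trace F E (h : E →ₗ[F] E) := by
    rw [Units.val_mul, LinearMap.trace_mul_comm, ← Units.val_mul, inv_mul_cancel_left]
  rw [h1, h2]

lemma cv_conj_eq {ψ : AddChar F ℂ} {k : ℕ} (α : Fin k → Fˣ →* ℂˣ) (ξ : Eˣ) (hξ : Rg F (ξ:E)) (g h : (E →ₗ[F] E)ˣ)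
    (hg : aeval (g : E →ₗ[F] E) (minpoly F (ξ:E)) = 0) (hh : aeval (h : E →ₗ[F] E) (minpoly F (ξ:E)) = 0) :
    cv (fun i => wM (E := E) F (α i) ψ) h = cv (fun i => wM (E := E) F (α i) ψ) g := by
  have hne : ∀ X : E →ₗ[F] E, aeval X (minpoly F (ξ:E)) = 0 → ∃ a : E ≃ₗ[F] E, a.conj (LinearMap.mulLeft F (ξ:E)) = X := by
    intro X hX
    have h1 := card_conj F hξ X hX
    have h2 : 0 < Nat.card {a : E ≃ₗ[F] E // a.conj (LinearMap.mulLeft F (ξ:E)) = X} := by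
      rw [h1]
      have := Fintype.one_lt_card (α := E)
      omega
    obtain ⟨⟨a, ha⟩⟩ := (Nat.card_pos_iff.1 h2).1
    exact ⟨a, ha⟩
  obtain ⟨a, ha⟩ := hne _ hg
  obtain ⟨b, hb⟩ := hne _ hh
  let e : (E →ₗ[F] E)ˣ := LinearMap.GeneralLinearGroup.ofLinearEquiv (a.symm.trans b)
  have he : h = e * g * e⁻¹ := by
    rw [eq_mul_inv_iff_mul_eq]
    apply Units.ext
    rw [Units.val_mul, Units.val_mul, ← ha, ← hb]
    ext x
    simp [e, LinearEquiv.conj_apply]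
  rw [he, cv_cls _ (fun i => wM_cls F (α i) ψ)]

lemma cv_large {ψ : AddChar F ℂ} (hψ : ∃ a, ψ a ≠ 1) (p : ℕ) [Fact p.Prime] [Algebra (ZMod p) F]
    (hq : 2 * Module.finrank F E * p < Fintype.card F) (hq' : 2 * Module.finrank F E ^ 2 < Fintype.card F)
    {k : ℕ} (α : Fin (k+1) → Fˣ →* ℂˣ) (ξ : Eˣ) (hξ : Rg F (ξ:E)) (g : (E →ₗ[F] E)ˣ) (hg : aeval (g : E →ₗ[F] E) (minpoly F (ξ:E)) = 0) :
    cv (fun i => wM (E := E) F (α i) ψ) g =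
      cc F E ^ k * cv (fun i => vE (E := E) F (α i) ψ) ξ := by
  have h1 := RR_all F hψ p hq hq' α ξ
  have h2 : ∀ h : (E →ₗ[F] E)ˣ, cv (fun i => wM (E := E) F (α i) ψ) h * NE F (ξ:E) (h : E →ₗ[F] E) = 
     cv (fun i => wM (E := E) F (α i) ψ) g * NE F (ξ:E) (h : E →ₗ[F] E) := by
    intro h
    rw [hξ.NE_eq]
    split_ifs with h3
    · rw [mul_one, mul_one]
      exact cv_conj_eq F α ξ hξ g h hg h3
    · simp
  rw [Finset.sum_congr rfl (fun g _ => h2 g), ← Finset.mul_sum, sum_units (fun X => NE F (ξ:E) X) (NE_nonunit F ξ), sum_NE, ← cc_Q0] at h1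
  have h3 := Qs_ne_zero F (0:E)
  have h4 := cc_ne F E
  apply mul_right_cancel₀ (mul_ne_zero h4 h3)
  rw [h1]; ring
end KL

set_option linter.unusedSectionVars false
namespace KL
open scoped Classical
open Polynomial

lemma psi_sum {F : Type} [Field F] (ψ : AddChar F ℂ) {ι : Type} (s : Finset ι) (f : ι → F) : ψ (∑ i ∈ s, f i) = ∏ i ∈ s, ψ (f i) := by
  induction s using Finset.induction_on with
  | empty => simp
  | insert a s ha ih => rw [Finset.sum_insert ha, Finset.prod_insert ha, AddChar.map_add_eq_mul, ih]

/-- weight on matrices -/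
noncomputable def wMat {F : Type} [Field F] {ι : Type} [Fintype ι] [DecidableEq ι] (α : Fˣ →* ℂˣ) (ψ : AddChar F ℂ) (g : (Matrix ι ι F)ˣ) : ℂ :=
  (α (Units.map (Matrix.detMonoidHom) g) : ℂ) * ψ (Matrix.trace (g : Matrix ι ι F))

lemma mK_eq {F : Type} [Field F] [Fintype F] [DecidableEq F] {ι : Type} [Fintype ι] [DecidableEq ι] {k : ℕ}
    (α : Fin k → Fˣ →* ℂˣ) (ψ : AddChar F ℂ) (x : (Matrix ι ι F)ˣ) :
    matrixKloosterman α ψ (x : Matrix ι ι F) = cv (fun i => wMat (α i) ψ) x := by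
  unfold matrixKloosterman cv wMat
  apply Finset.sum_congr
  · congr!
  intro g _
  simp only [Units.val_inj, Finset.prod_mul_distrib, Matrix.trace_sum, psi_sum]

lemma fK_eq {F : Type} [Field F] [Fintype F] {k : ℕ}
    (α : Fin k → Fˣ →* ℂˣ) (ψ : AddChar F ℂ)
    (E : Type) [Field E] [Fintype E] [DecidableEq E] [Algebra F E] (ξ : Eˣ) :
    fieldKloosterman α ψ E (ξ:E) = cv (fun i => vE (E := E) F (α i) ψ) ξ := by
  unfold fieldKloosterman cv vE
  apply Finset.sum_congr
  · congr!
  intro g _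
  simp only [Units.val_inj, Finset.prod_mul_distrib, map_sum, psi_sum, List.prod_ofFn]

section
variable {F : Type} [Field F] [Fintype F] [DecidableEq F] {n : ℕ} (x : (Matrix (Fin n) (Fin n) F)ˣ)
    (hx : Irreducible (Matrix.charpoly (x : Matrix (Fin n) (Fin n) F)))
    {E : Type} [Field E] [Fintype E] [DecidableEq E] [Algebra F E]
    (hE : Module.finrank F E = n)
    {ξ : E}
    (hξ : Polynomial.aeval ξ (Matrix.charpoly (x : Matrix (Fin n) (Fin n) F)) = 0)
include hξ

lemma xi_ne_zero : ξ ≠ 0 := by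
  rintro rfl
  have h2 := Matrix.det_eq_sign_charpoly_coeff (x : Matrix (Fin n) (Fin n) F)
  rw [aeval_def, eval₂_at_zero, _root_.map_eq_zero] at hξ
  rw [hξ, mul_zero] at h2
  have h3 := (Matrix.isUnit_iff_isUnit_det _).1 x.isUnit
  rw [h2] at h3
  exact not_isUnit_zero h3

include hx
lemma xi_minpoly : minpoly F ξ = Matrix.charpoly (x : Matrix (Fin n) (Fin n) F) :=
  (minpoly.eq_of_irreducible_of_monic hx hξ (Matrix.charpoly_monic _)).symm

include hE
lemma xi_Rg : Rg F ξ := by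
  unfold Rg
  rw [xi_minpoly x hx hξ, Matrix.charpoly_natDegree_eq_dim, Fintype.card_fin, hE]
end

lemma cv_large' (F : Type) {E : Type} [Field F] [Field E] [Fintype F] [Fintype E] [Algebra F E] [Fintype (E →ₗ[F] E)]
    [i1 : Fintype (E →ₗ[F] E)ˣ] [i2 : Fintype Eˣ]
    {ψ : AddChar F ℂ} (hψ : ∃ a, ψ a ≠ 1) (p : ℕ) [Fact p.Prime] [Algebra (ZMod p) F]
    (hq : 2 * Module.finrank F E * p < Fintype.card F) (hq' : 2 * Module.finrank F E ^ 2 < Fintype.card F)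
    {k : ℕ} (α : Fin (k+1) → Fˣ →* ℂˣ) (ξ : Eˣ) (hξ : Rg F (ξ:E)) (g : (E →ₗ[F] E)ˣ) (hg : aeval (g : E →ₗ[F] E) (minpoly F (ξ:E)) = 0) :
    @cv _ _ i1 _ (fun i => wM (E := E) F (α i) ψ) g =
      cc F E ^ k * @cv _ _ i2 _ (fun i => vE (E := E) F (α i) ψ) ξ := by
  have h := cv_large F hψ p hq hq' α ξ hξ g hg
  convert h

theorem main_large
    {F : Type} [Field F] [Fintype F] [DecidableEq F]
    (ψ : AddChar F ℂ) (hψ : ∃ a : F, ψ a ≠ 1)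
    {n k : ℕ} (hk : 1 ≤ k) (α : Fin k → Fˣ →* ℂˣ)
    (x : (Matrix (Fin n) (Fin n) F)ˣ)
    (hx : Irreducible (Matrix.charpoly (x : Matrix (Fin n) (Fin n) F)))
    (E : Type) [Field E] [Fintype E] [DecidableEq E] [Algebra F E]
    (hE : Module.finrank F E = n)
    (ξ : E)
    (hξ : Polynomial.aeval ξ (Matrix.charpoly (x : Matrix (Fin n) (Fin n) F)) = 0) 
    (p : ℕ) [Fact p.Prime] [Algebra (ZMod p) F]
    (hq : 2 * n * p < Fintype.card F) (hq' : 2 * n ^ 2 < Fintype.card F) :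
    matrixKloosterman α ψ (x : Matrix (Fin n) (Fin n) F)
    = (-1 : ℂ) ^ ((k - 1) * (n + 1)) *
        (Fintype.card F : ℂ) ^ ((k - 1) * (n * (n - 1) / 2)) *
        fieldKloosterman α ψ E ξ := by
  obtain ⟨k, rfl⟩ : ∃ k', k = k' + 1 := ⟨k - 1, by omega⟩
  have h0 := xi_ne_zero x hξ
  have hR := xi_Rg x hx hE hξ
  have hm := xi_minpoly x hx hξ
  have : Finite (E →ₗ[F] E) := Finite.of_injective (fun f => (f : E → E)) DFunLike.coe_injective
  have := Fintype.ofFinite (E →ₗ[F] E)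
  lift ξ to Eˣ using isUnit_iff_ne_zero.2 h0
  rw [mK_eq, fK_eq]
  let b : Module.Basis (Fin n) F E := Module.finBasisOfFinrankEq F E hE
  let e : (E →ₗ[F] E)ˣ ≃* (Matrix (Fin n) (Fin n) F)ˣ := Units.mapEquiv (LinearMap.toMatrixAlgEquiv b).toMulEquiv
  obtain ⟨g, rfl⟩ := e.surjective x
  rw [cv_equiv]
  have h1 : ∀ (i : Fin (k+1)) (g : (E →ₗ[F] E)ˣ), wMat (α i) ψ (e g) = wM F (α i) ψ g := by
    intro i g
    have h2 : ((e g : (Matrix (Fin n) (Fin n) F)ˣ) : Matrix (Fin n) (Fin n) F) = LinearMap.toMatrix b b (g : E →ₗ[F] E) := rfl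
    unfold wMat wM
    have h3 : Units.map (Matrix.detMonoidHom) (e g) = Units.map (LinearMap.det : (E →ₗ[F] E) →* F) g := by
      ext
      rw [Units.coe_map, Units.coe_map, h2]
      exact LinearMap.det_toMatrix b _
    rw [h3, h2, ← LinearMap.trace_eq_matrix_trace]
  simp only [h1]
  have h2 : aeval (g : E →ₗ[F] E) (minpoly F (ξ:E)) = 0 := by
    have h2 : ((e g : (Matrix (Fin n) (Fin n) F)ˣ) : Matrix (Fin n) (Fin n) F) = LinearMap.toMatrix b b (g : E →ₗ[F] E) := rfl
    rw [hm, h2, LinearMap.charpoly_toMatrix]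
    exact LinearMap.aeval_self_charpoly _
  refine (cv_large' F hψ p (by rwa [hE]) (by rwa [hE]) α ξ hR g h2).trans ?_
  congr 1
  unfold cc
  rw [hE, mul_pow, Nat.add_sub_cancel, ← pow_mul, ← pow_mul, mul_comm k, mul_comm k]
  congr 1
  have hn : 0 < n := by rw [← hE]; exact Module.finrank_pos (R := F) (M := E)
  obtain ⟨n, rfl⟩ : ∃ n', n = n' + 1 := ⟨n - 1, by omega⟩
  rw [Nat.add_sub_cancel, pow_mul, pow_mul, pow_add, pow_add]
  norm_num
end KL

set_option linter.unusedSectionVars false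
namespace KL
open scoped Classical
open Polynomial

/-- an algebraic integer divisible by arbitrarily large integers is zero -/
lemma eq_zero_of_dvdO {z : ℂ} (h : ∀ N : ℕ, ∃ m : ℕ, N < m ∧ DvdO m z) : z = 0 := by
  by_contra hz
  obtain ⟨m0, -, h0⟩ := h 0
  have hi := h0.isIntegral
  have hc : (minpoly ℤ z).coeff 0 ≠ 0 := by
    intro hc
    have h1 : minpoly ℚ z = (minpoly ℤ z).map (algebraMap ℤ ℚ) := minpoly.isIntegrallyClosed_eq_field_fractions' ℚ hi
    have h2 := minpoly.coeff_zero_ne_zero (A := ℚ) (x := z) hi.tower_top hz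
    rw [h1, coeff_map, hc, map_zero] at h2
    exact h2 rfl
  set c := (minpoly ℤ z).coeff 0 with hcdef
  obtain ⟨m, hm, hd⟩ := h c.natAbs
  have h1 : DvdO m (c : ℂ) := by
    have h2 := minpoly.aeval ℤ z
    rw [← divX_mul_X_add (minpoly ℤ z), map_add, map_mul, aeval_X, aeval_C] at h2
    have h3 : (c : ℂ) = - (aeval z (divX (minpoly ℤ z))) * z := by
      have : algebraMap ℤ ℂ ((minpoly ℤ z).coeff 0) = (c : ℂ) := rfl
      rw [this] at h2
      linear_combination h2
    rw [h3]
    refine DvdO.mul' (IsIntegral.neg ?_) hd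
    rw [aeval_eq_sum_range]
    exact IsIntegral.sum _ (fun i _ => (hi.pow i).smul _)
  obtain ⟨w, hw, hcw⟩ := h1
  have hm0 : (m : ℚ) ≠ 0 := by
    have : m ≠ 0 := by omega
    exact_mod_cast this
  have hwq : w = algebraMap ℚ ℂ ((c : ℚ) / m) := by
    have hm1 : (m : ℂ) ≠ 0 := by exact_mod_cast hm0
    push_cast at hcw
    simp only [map_div₀, map_intCast, map_natCast]
    rw [eq_div_iff hm1, hcw]; ring
  rw [hwq, isIntegral_algebraMap_iff (algebraMap ℚ ℂ).injective, IsIntegrallyClosed.isIntegral_iff] at hw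
  obtain ⟨y, hy⟩ := hw
  have h4 : c = m * y := by
    have : (c : ℚ) = m * y := by
      have hy' : (y : ℚ) = c / m := hy
      rw [hy']; field_simp
    exact_mod_cast this
  have h5 : (m : ℤ) ∣ c := ⟨y, h4⟩
  have h6 := Int.natAbs_dvd_natAbs.2 h5
  have h7 := Nat.le_of_dvd (Int.natAbs_pos.2 hc) h6
  simp at h7
  omega

lemma fix_dvd {G A : Type} [Group G] [Finite G] [Fintype A] (act : G → A → A) (h1 : ∀ a, act 1 a = a)
    (hm : ∀ g h a, act (g * h) a = act g (act h a)) (h : A → ℂ) (hi : ∀ g a, h (act g a) = h a)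
    (hIntg : ∀ a, IsIntegral ℤ (h a)) (m : ℕ) (hp : m.Prime) (hG : Nat.card G = m) :
    DvdO m (∑ a, h a - ∑ a, if ∀ g, act g a = a then h a else 0) := by
  rw [← Finset.sum_sub_distrib]
  have hfix : ∀ g a, (∀ g', act g' (act g a) = act g a) ↔ ∀ g', act g' a = a := by
    intro g a
    constructor
    · intro H g'
      have h2 := H (g' * g⁻¹)
      have h3 := H g⁻¹
      rw [← hm, inv_mul_cancel, h1] at h3
      rw [← hm, inv_mul_cancel_right, ← h3] at h2
      exact h2
    · intro H g'; rw [H g, H g']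
  refine orb_dvd act h1 hm _ ?_ ?_ m ?_
  · intro g a
    simp only [hfix, hi]
  · intro a
    refine (hIntg a).sub ?_
    split_ifs
    · exact hIntg a
    · exact isIntegral_zero
  · intro a ha
    have hnf : ¬ ∀ g, act g a = a := by
      intro H; apply ha; rw [if_pos H, sub_self]
    refine ⟨1, ?_⟩
    let S : Subgroup G := { carrier := {g | act g a = a}
                            one_mem' := h1 a
                            mul_mem' := by intro g g' hg hg'; show act _ a = a; rw [hm, hg', hg]
                            inv_mem' := by
                              intro g hg
                              show act _ a = a
                              have : act g⁻¹ (act g a) = a := by rw [← hm, inv_mul_cancel, h1]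
                              rwa [show act g a = a from hg] at this }
    have hS : Nat.card {g // act g a = a} = Nat.card S := rfl
    have hd : Nat.card S ∣ m := hG ▸ Subgroup.card_subgroup_dvd_card S
    rcases (Nat.dvd_prime hp).1 hd with h2 | h2
    · rw [hS, h2, hG]; simp
    · exfalso
      apply hnf
      have : S = ⊤ := Subgroup.eq_top_of_card_eq S (h2.trans hG.symm)
      intro g
      have : g ∈ S := by rw [this]; trivial
      exact this

lemma cv_dvd {Γ G₀ G₁ : Type} [Group Γ] [Finite Γ] [Group G₀] [Fintype G₀] [Group G₁] [Fintype G₁]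
    (act : Γ →* MulAut G₁) (j : G₀ →* G₁) (hj : Function.Injective j) (hf : ∀ a, (∀ g, act g a = a) ↔ a ∈ Set.range j)
    {k : ℕ} (w₀ : Fin k → G₀ → ℂ) (w₁ : Fin k → G₁ → ℂ) (hw : ∀ i a, w₁ i (j a) = w₀ i a)
    (hinv : ∀ i g a, w₁ i (act g a) = w₁ i a) (hIntg : ∀ i a, IsIntegral ℤ (w₁ i a)) (m : ℕ) (hp : m.Prime) (hΓ : Nat.card Γ = m)
    (x : G₀) : DvdO m (cv w₁ (j x) - cv w₀ x) := by
  have hjx : ∀ g, act g (j x) = j x := (hf _).2 ⟨x, rfl⟩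
  have key := fix_dvd (G := Γ) (A := Fin k → G₁) (fun g a i => act g (a i)) (by intro a; simp) (by intro g h a; simp)
    (fun a => if (List.ofFn a).prod = j x then ∏ i, w₁ i (a i) else 0) (by
      intro g a
      have h1 : (List.ofFn fun i => act g (a i)).prod = act g (List.ofFn a).prod := by
        rw [map_list_prod, List.map_ofFn]; rfl
      simp only [hinv, h1]
      have h2 : act g (List.ofFn a).prod = j x ↔ (List.ofFn a).prod = j x := by
        constructor
        · intro h; apply (act g).injective; rw [h, hjx]
        · intro h; rw [h, hjx]
      simp only [h2]) (by
      intro a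
      split_ifs
      · exact IsIntegral.prod _ (fun i _ => hIntg i _)
      · exact isIntegral_zero) m hp hΓ
  have h2 : cv w₀ x = ∑ a : Fin k → G₁, if (∀ g, (fun i => act g (a i)) = a) then (if (List.ofFn a).prod = j x then ∏ i, w₁ i (a i) else 0) else 0 := by
    unfold cv
    apply Fintype.sum_of_injective (fun a : Fin k → G₀ => fun i => j (a i))
    · intro a b h
      funext i
      exact hj (congrFun h i)
    · intro a ha
      rw [if_neg]
      intro H
      apply ha
      have : ∀ i, ∃ b, j b = a i := by
        intro i
        exact (hf (a i)).1 (fun g => congrFun (H g) i)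
      choose b hb using this
      exact ⟨b, funext hb⟩
    · intro a
      rw [if_pos (fun g => funext fun i => (hf _).2 ⟨a i, rfl⟩ g)]
      have h1 : (List.ofFn fun i => j (a i)).prod = j (List.ofFn a).prod := by
        rw [map_list_prod, List.map_ofFn]; rfl
      simp only [h1, hj.eq_iff, hw]
  rw [h2]
  exact key
end KL

set_option linter.unusedSectionVars false
namespace KL
open scoped Classical
open Polynomial

section
variable {F : Type} [Field F] [Fintype F]

lemma alpha_int (α : Fˣ →* ℂˣ) (u : Fˣ) : IsIntegral ℤ ((α u : ℂˣ) : ℂ) := by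
  have h1 : ((α u : ℂˣ) : ℂ) ^ Fintype.card Fˣ = 1 := by
    rw [← Units.val_pow_eq_pow_val, ← map_pow, pow_card_eq_one, map_one, Units.val_one]
  exact IsIntegral.of_pow Fintype.card_pos (h1 ▸ isIntegral_one)

lemma unit_pow_m (m : ℕ) (hm : m ≡ 1 [MOD (Fintype.card F - 1)]) (u : Fˣ) : u ^ m = u := by
  rw [← Fintype.card_units] at hm
  have := pow_eq_pow_iff_modEq (x := u) (n := m) (m := 1)
  rw [pow_one] at this
  exact this.2 (hm.of_dvd (orderOf_dvd_card))

section mat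
variable {L : Type} [Field L] [Fintype L] [Algebra F L] {ι : Type} [Fintype ι] [DecidableEq ι]

/-- characters pulled back by norm -/
noncomputable def aL (L : Type) [Field L] [Fintype L] [Algebra F L] (α : Fˣ →* ℂˣ) : Lˣ →* ℂˣ := α.comp (Units.map (Algebra.norm F : L →* F))
/-- additive characters pulled back by trace -/
noncomputable def pL (L : Type) [Field L] [Fintype L] [Algebra F L] (ψ : AddChar F ℂ) : AddChar L ℂ := ψ.compAddMonoidHom (Algebra.trace F L).toAddMonoidHom

lemma pL_apply (ψ : AddChar F ℂ) (a : L) : pL L ψ a = ψ (Algebra.trace F L a) := rfl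
lemma aL_apply (α : Fˣ →* ℂˣ) (a : Lˣ) : aL L α a = α (Units.map (Algebra.norm F : L →* F) a) := rfl

/-- Galois action on invertible matrices -/
noncomputable def actM : (L ≃ₐ[F] L) →* MulAut (Matrix ι ι L)ˣ where
  toFun σ := Units.mapEquiv (σ.mapMatrix (m := ι)).toMulEquiv
  map_one' := by
    ext g : 1
    apply Units.ext
    ext i j
    rfl
  map_mul' σ τ := by
    ext g : 1
    apply Units.ext
    ext i j
    rfl

/-- base change on invertible matrices -/
noncomputable def jM : (Matrix ι ι F)ˣ →* (Matrix ι ι L)ˣ := Units.map (algebraMap F L).mapMatrix.toMonoidHom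

lemma jM_val (x : (Matrix ι ι F)ˣ) : ((jM x : (Matrix ι ι L)ˣ) : Matrix ι ι L) = (x : Matrix ι ι F).map (algebraMap F L) := rfl
lemma actM_val (σ : L ≃ₐ[F] L) (x : (Matrix ι ι L)ˣ) : ((actM σ x : (Matrix ι ι L)ˣ) : Matrix ι ι L) = (x : Matrix ι ι L).map σ := rfl

theorem mat_dvd [Fintype (Matrix ι ι F)ˣ] [Fintype (Matrix ι ι L)ˣ] (m : ℕ) (hp : m.Prime) (hL : Module.finrank F L = m)
    (hm : m ≡ 1 [MOD (Fintype.card F - 1)]) (hm1 : (m : F) = 1) {k : ℕ} (α : Fin k → Fˣ →* ℂˣ) (ψ : AddChar F ℂ) (x : (Matrix ι ι F)ˣ) :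
    DvdO m (cv (fun i => wMat (aL L (α i)) (pL L ψ)) (jM x : (Matrix ι ι L)ˣ) - cv (fun i => wMat (α i) ψ) x) := by
  apply cv_dvd (actM (F := F) (L := L) (ι := ι)) jM
  · intro a b h
    apply Units.ext
    have h1 := congrArg (fun u : (Matrix ι ι L)ˣ => (u : Matrix ι ι L)) h
    simp only [jM_val] at h1
    exact Matrix.map_injective (algebraMap F L).injective h1
  · intro a
    constructor
    · intro h
      have h1 : ∀ i j, ∃ b, algebraMap F L b = (a : Matrix ι ι L) i j := by
        intro i j
        have := (IsGalois.mem_range_algebraMap_iff_fixed (F := F) (E := L) ((a : Matrix ι ι L) i j)).2 (by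
          intro σ
          have h2 := congrArg (fun u : (Matrix ι ι L)ˣ => (u : Matrix ι ι L) i j) (h σ)
          exact h2)
        exact this
      choose b hb using h1
      let B : Matrix ι ι F := Matrix.of fun i j => b i j
      have hB : B.map (algebraMap F L) = a := by ext i j; exact hb i j
      have hu : IsUnit B := by
        rw [Matrix.isUnit_iff_isUnit_det, isUnit_iff_ne_zero]
        intro h0
        have h3 : ((a : Matrix ι ι L)).det = algebraMap F L B.det := by
          rw [← hB]; exact ((algebraMap F L).map_det B).symm
        rw [h0, map_zero] at h3
        have h4 := (Matrix.isUnit_iff_isUnit_det _).1 a.isUnit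
        rw [h3] at h4
        exact not_isUnit_zero h4
      obtain ⟨u, hu⟩ := hu
      refine ⟨u, Units.ext ?_⟩
      rw [jM_val, hu, hB]
    · rintro ⟨b, rfl⟩ σ
      apply Units.ext
      rw [actM_val, jM_val]
      ext i j
      simp
  · intro i a
    unfold wMat
    rw [aL_apply, pL_apply, jM_val]
    have h1 : Units.map (Algebra.norm F : L →* F) (Units.map Matrix.detMonoidHom (jM a)) = Units.map Matrix.detMonoidHom a := by
      have h2 : (Units.map Matrix.detMonoidHom (jM a) : Lˣ) = Units.map (algebraMap F L : F →* L) (Units.map Matrix.detMonoidHom a) := by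
        ext
        exact ((algebraMap F L).map_det (a : Matrix ι ι F)).symm
      rw [h2]
      conv_rhs => rw [← unit_pow_m m hm (Units.map Matrix.detMonoidHom a)]
      ext
      simp only [Units.coe_map, Units.val_pow_eq_pow_val, MonoidHom.coe_coe]
      rw [Algebra.norm_algebraMap, hL]
    have h3 : Matrix.trace ((a : Matrix ι ι F).map (algebraMap F L)) = algebraMap F L (Matrix.trace (a : Matrix ι ι F)) := by
      simp [Matrix.trace]
    rw [h1, h3, Algebra.trace_algebraMap, hL, nsmul_eq_mul, hm1, one_mul]
  · intro i σ a
    unfold wMat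
    rw [aL_apply, pL_apply, aL_apply, pL_apply, actM_val]
    have h1 : Units.map (Algebra.norm F : L →* F) (Units.map Matrix.detMonoidHom (actM σ a)) = Units.map (Algebra.norm F : L →* F) (Units.map Matrix.detMonoidHom a) := by
      ext
      simp only [Units.coe_map]
      have : Matrix.detMonoidHom ((actM σ a : (Matrix ι ι L)ˣ) : Matrix ι ι L) = σ (Matrix.detMonoidHom (a : Matrix ι ι L)) := (σ.toRingEquiv.toRingHom.map_det (a : Matrix ι ι L)).symm
      rw [this]
      exact Algebra.norm_eq_of_algEquiv σ _
    have h3 : Matrix.trace ((a : Matrix ι ι L).map σ) = σ (Matrix.trace (a : Matrix ι ι L)) := by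
      simp [Matrix.trace]
    rw [h1, h3, Algebra.trace_eq_of_algEquiv]
  · intro i a
    unfold wMat
    rw [aL_apply, pL_apply]
    exact (alpha_int _ _).mul (isIntegral_psi ψ _)
  · exact hp
  · rw [IsGalois.card_aut_eq_finrank, hL]
end mat

section fld
variable {E K : Type} [Field E] [Fintype E] [Algebra F E] [Field K] [Fintype K] [Algebra F K] [Algebra E K] [IsScalarTower F E K]

/-- Galois action on units -/
noncomputable def actE : (K ≃ₐ[E] K) →* MulAut Kˣ where
  toFun σ := Units.mapEquiv (σ : K ≃ₐ[E] K).toMulEquiv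
  map_one' := by
    ext g : 1
    apply Units.ext
    rfl
  map_mul' σ τ := by
    ext g : 1
    apply Units.ext
    rfl

lemma actE_val (σ : K ≃ₐ[E] K) (x : Kˣ) : ((actE σ x : Kˣ) : K) = σ x := rfl

/-- base change on units -/
noncomputable def jE : Eˣ →* Kˣ := Units.map (algebraMap E K).toMonoidHom
lemma jE_val (x : Eˣ) : ((jE x : Kˣ) : K) = algebraMap E K x := rfl

theorem fld_dvd [Fintype Eˣ] [Fintype Kˣ] (m : ℕ) (hp : m.Prime) (hL : Module.finrank E K = m)
    (hm : m ≡ 1 [MOD (Fintype.card F - 1)]) (hm1 : (m : F) = 1) {k : ℕ} (α : Fin k → Fˣ →* ℂˣ) (ψ : AddChar F ℂ) (x : Eˣ) :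
    DvdO m (cv (fun i => vE (E := K) F (α i) ψ) (jE x : Kˣ) - cv (fun i => vE (E := E) F (α i) ψ) x) := by
  apply cv_dvd (actE (E := E) (K := K)) jE
  · intro a b h
    apply Units.ext
    have h1 := congrArg (fun u : Kˣ => (u : K)) h
    simp only [jE_val] at h1
    exact (algebraMap E K).injective h1
  · intro a
    constructor
    · intro h
      obtain ⟨b, hb⟩ := (IsGalois.mem_range_algebraMap_iff_fixed (F := E) (E := K) (a : K)).2 (by
          intro σ
          have h2 := congrArg (fun u : Kˣ => (u : K)) (h σ)
          exact h2)
      have hu : b ≠ 0 := by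
        rintro rfl
        rw [map_zero] at hb
        exact a.ne_zero hb.symm
      refine ⟨Units.mk0 b hu, Units.ext ?_⟩
      rw [jE_val]; exact hb
    · rintro ⟨b, rfl⟩ σ
      apply Units.ext
      rw [actE_val, jE_val]
      simp
  · intro i a
    unfold vE
    have h1 : Units.map (Algebra.norm F : K →* F) (jE a) = Units.map (Algebra.norm F : E →* F) a := by
      conv_rhs => rw [← unit_pow_m m hm (Units.map (Algebra.norm F : E →* F) a)]
      ext
      simp only [Units.coe_map, Units.val_pow_eq_pow_val, MonoidHom.coe_coe]
      rw [jE_val, ← Algebra.norm_norm (R := F) (S := E), Algebra.norm_algebraMap, hL, map_pow]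
    rw [h1, jE_val, ← Algebra.trace_trace (R := F) (S := E), Algebra.trace_algebraMap, hL, map_nsmul, nsmul_eq_mul, hm1, one_mul]
  · intro i σ a
    unfold vE
    have h1 : Units.map (Algebra.norm F : K →* F) (actE σ a) = Units.map (Algebra.norm F : K →* F) a := by
      ext
      simp only [Units.coe_map]
      exact Algebra.norm_eq_of_algEquiv (σ.restrictScalars F) _
    have h3 : Algebra.trace F K (actE σ a : Kˣ) = Algebra.trace F K (a : K) := 
      Algebra.trace_eq_of_algEquiv (σ.restrictScalars F) _
    rw [h1, h3]
  · intro i a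
    unfold vE
    exact (alpha_int _ _).mul (isIntegral_psi ψ _)
  · exact hp
  · rw [IsGalois.card_aut_eq_finrank, hL]
end fld
end
end KL

set_option linter.unusedSectionVars false
namespace KL
open scoped Classical
open Polynomial

section
variable {F : Type} [Field F] [Fintype F]

lemma irr_map {L E K : Type} [Field L] [Fintype L] [Field E] [Fintype E] [Field K] [Fintype K]
    [Algebra F L] [Algebra F E] [Algebra F K] [Algebra L K] [Algebra E K] [IsScalarTower F L K] [IsScalarTower F E K]
    (ξ : E) (m : ℕ) (hL : Module.finrank F L = m) (hc : Nat.Coprime (minpoly F ξ).natDegree m) :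
    Irreducible ((minpoly F ξ).map (algebraMap F L)) := by
  have hm : minpoly F (algebraMap E K ξ) = minpoly F ξ := minpoly.algebraMap_eq (algebraMap E K).injective ξ
  set z := algebraMap E K ξ with hz
  have iz : IsIntegral L z := Algebra.IsIntegral.isIntegral z
  have izF : IsIntegral F z := Algebra.IsIntegral.isIntegral z
  have h1 : Module.finrank F (IntermediateField.adjoin L {z}) = m * (minpoly L z).natDegree := by
    rw [← Module.finrank_mul_finrank F L, hL, IntermediateField.adjoin.finrank iz]
  let y : IntermediateField.adjoin L {z} := IntermediateField.AdjoinSimple.gen L z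
  have hy : minpoly F y = minpoly F z := by
    haveI : IsScalarTower F (IntermediateField.adjoin L {z}) K := IsScalarTower.of_algebraMap_eq (fun a => by
      rw [IsScalarTower.algebraMap_apply F L K, IsScalarTower.algebraMap_apply F L (IntermediateField.adjoin L {z})]
      rfl)
    have := minpoly.algebraMap_eq (A := F) (algebraMap (IntermediateField.adjoin L {z}) K).injective y
    rw [← this]; rfl
  have h2 : (minpoly F y).natDegree ∣ Module.finrank F (IntermediateField.adjoin L {z}) :=
    minpoly.degree_dvd (Algebra.IsIntegral.isIntegral y)
  rw [hy, h1, hm] at h2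
  have h3 := hc.dvd_of_dvd_mul_left h2
  have h4 : minpoly L z ∣ (minpoly F ξ).map (algebraMap F L) := by
    rw [← hm]; exact minpoly.dvd_map_of_isScalarTower F L z
  have h5 := Nat.le_of_dvd (minpoly.natDegree_pos iz) h3
  have mo : (minpoly F ξ).Monic := minpoly.monic (Algebra.IsIntegral.isIntegral ξ)
  have h6 : (minpoly F ξ).map (algebraMap F L) = minpoly L z := 
    (eq_of_monic_of_dvd_of_natDegree_le (minpoly.monic iz) (mo.map _) h4 (by rw [natDegree_map]; exact h5))
  rw [h6]
  exact minpoly.irreducible iz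

theorem descent_step (ψ : AddChar F ℂ) (hψ : ∃ a : F, ψ a ≠ 1)
    {n k : ℕ} (hk : 1 ≤ k) (α : Fin k → Fˣ →* ℂˣ)
    (x : (Matrix (Fin n) (Fin n) F)ˣ)
    (hx : Irreducible (Matrix.charpoly (x : Matrix (Fin n) (Fin n) F)))
    {L E K : Type} [Field L] [Fintype L] [Field E] [Fintype E] [Field K] [Fintype K]
    [Algebra F L] [Algebra F E] [Algebra F K] [Algebra L K] [Algebra E K] [IsScalarTower F L K] [IsScalarTower F E K]
    (hE : Module.finrank F E = n) (ξ : E)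
    (hξ : Polynomial.aeval ξ (Matrix.charpoly (x : Matrix (Fin n) (Fin n) F)) = 0) 
    (p : ℕ) [Fact p.Prime] [Algebra (ZMod p) L] (m : ℕ) (hp : m.Prime)
    (hL : Module.finrank F L = m) (hK : Module.finrank E K = m)
    (hm : m ≡ 1 [MOD (Fintype.card F - 1)]) (hm1 : (m : F) = 1) (hmn : n < m)
    (hq : 2 * n * p < Fintype.card L) (hq' : 2 * n ^ 2 < Fintype.card L) :
    DvdO m (matrixKloosterman α ψ (x : Matrix (Fin n) (Fin n) F)
    - (-1 : ℂ) ^ ((k - 1) * (n + 1)) *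
        (Fintype.card F : ℂ) ^ ((k - 1) * (n * (n - 1) / 2)) *
        fieldKloosterman α ψ E ξ) := by
  have hmin := xi_minpoly x hx hξ
  have hnz := xi_ne_zero x hξ
  have hn0 : 0 < n := hE ▸ Module.finrank_pos (R := F) (M := E)
  have hLK : Module.finrank L K = n := by
    have h1 := Module.finrank_mul_finrank F L K
    have h2 := Module.finrank_mul_finrank F E K
    rw [hL] at h1; rw [hE, hK] at h2
    rw [← h2, mul_comm] at h1
    exact Nat.eq_of_mul_eq_mul_right hp.pos h1
  have hcp : Matrix.charpoly ((jM x : (Matrix (Fin n) (Fin n) L)ˣ) : Matrix (Fin n) (Fin n) L) = (Matrix.charpoly (x : Matrix (Fin n) (Fin n) F)).map (algebraMap F L) := by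
    rw [jM_val]; exact Matrix.charpoly_map _ _
  have hdeg : (Matrix.charpoly (x : Matrix (Fin n) (Fin n) F)).natDegree = n := by
    rw [Matrix.charpoly_natDegree_eq_dim, Fintype.card_fin]
  have hirr : Irreducible (Matrix.charpoly ((jM x : (Matrix (Fin n) (Fin n) L)ˣ) : Matrix (Fin n) (Fin n) L)) := by
    rw [hcp, ← hmin]
    apply irr_map (K := K) ξ m hL
    rw [hmin, hdeg]
    exact ((Nat.Prime.coprime_iff_not_dvd hp).2 (fun h => absurd (Nat.le_of_dvd hn0 h) (by omega))).symm
  have hroot : aeval (algebraMap E K ξ) (Matrix.charpoly ((jM x : (Matrix (Fin n) (Fin n) L)ˣ) : Matrix (Fin n) (Fin n) L)) = 0 := by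
    rw [hcp, aeval_map_algebraMap, aeval_algebraMap_apply, hξ, map_zero]
  have hpl : ∃ a : L, pL L ψ a ≠ 1 := by
    obtain ⟨a, ha⟩ := hψ
    obtain ⟨b, hb⟩ := Algebra.trace_surjective F L a
    exact ⟨b, by rw [pL_apply, hb]; exact ha⟩
  have main := main_large (pL L ψ) hpl hk (fun i => aL L (α i)) (jM x) hirr K hLK (algebraMap E K ξ) hroot p hq hq'
  have hM := mat_dvd (L := L) m hp hL hm hm1 α ψ x
  have hF := fld_dvd (E := E) (K := K) m hp hK hm hm1 α ψ (Units.mk0 ξ hnz)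
  have eM : matrixKloosterman α ψ (x : Matrix (Fin n) (Fin n) F) = cv (fun i => wMat (α i) ψ) x := mK_eq α ψ x
  have eML := mK_eq (fun i => aL L (α i)) (pL L ψ) (jM x : (Matrix (Fin n) (Fin n) L)ˣ)
  have eF := fK_eq α ψ E (Units.mk0 ξ hnz)
  have eK := fK_eq (fun i => aL L (α i)) (pL L ψ) K (jE (Units.mk0 ξ hnz))
  have ev : (fun i => vE (E := K) L (aL L (α i)) (pL L ψ)) = fun i => vE (E := K) F (α i) ψ := by
    funext i t
    unfold vE
    rw [aL_apply, pL_apply, Algebra.trace_trace]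
    congr 3
    ext
    simp only [Units.coe_map]
    rw [Algebra.norm_norm]
  rw [ev] at eK
  rw [jE_val] at eK
  rw [Units.val_mk0] at eF eK
  rw [eML] at main
  rw [eK] at main
  rw [main] at hM
  have hfi : IsIntegral ℤ (fieldKloosterman α ψ E ξ) := by
    unfold fieldKloosterman
    refine IsIntegral.sum _ (fun t _ => ?_)
    split_ifs
    · exact (IsIntegral.prod _ (fun i _ => alpha_int _ _)).mul (isIntegral_psi ψ _)
    · exact isIntegral_zero
  have hcard : Fintype.card L = Fintype.card F ^ m := by rw [Module.card_eq_pow_finrank (K := F) (V := L), hL]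
  haveI : Fact m.Prime := ⟨hp⟩
  set A := (k - 1) * (n * (n - 1) / 2)
  have hdv : (m : ℤ) ∣ ((Fintype.card L : ℤ) ^ A - (Fintype.card F : ℤ) ^ A) := by
    rw [← ZMod.intCast_zmod_eq_zero_iff_dvd, hcard]
    push_cast
    rw [ZMod.pow_card, sub_self]
  have hd := dvdO_int hdv
  have hIntg : IsIntegral ℤ ((-1 : ℂ) ^ ((k - 1) * (n + 1))) := (isIntegral_one.neg).pow _
  have hintq : IsIntegral ℤ ((Fintype.card L : ℂ) ^ A) := IsIntegral.pow (by exact_mod_cast isInt_int (Fintype.card L)) _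
  rw [← eF] at hF
  have t1 := DvdO.mul' (hIntg.mul hintq) hF
  have t2 := (DvdO.mul' hIntg hd).mul hfi
  rw [eM]
  convert (t1.add t2).sub hM using 1
  push_cast
  ring

theorem main_all [DecidableEq F] (ψ : AddChar F ℂ) (hψ : ∃ a : F, ψ a ≠ 1)
    {n k : ℕ} (hk : 1 ≤ k) (α : Fin k → Fˣ →* ℂˣ)
    (x : (Matrix (Fin n) (Fin n) F)ˣ)
    (hx : Irreducible (Matrix.charpoly (x : Matrix (Fin n) (Fin n) F)))
    (E : Type) [Field E] [Fintype E] [DecidableEq E] [Algebra F E]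
    (hE : Module.finrank F E = n)
    (ξ : E)
    (hξ : Polynomial.aeval ξ (Matrix.charpoly (x : Matrix (Fin n) (Fin n) F)) = 0) :
    matrixKloosterman α ψ (x : Matrix (Fin n) (Fin n) F)
    = (-1 : ℂ) ^ ((k - 1) * (n + 1)) *
        (Fintype.card F : ℂ) ^ ((k - 1) * (n * (n - 1) / 2)) *
        fieldKloosterman α ψ E ξ := by
  rw [← sub_eq_zero]
  apply eq_zero_of_dvdO
  intro N
  obtain ⟨p, hpc⟩ := CharP.exists F
  haveI := hpc
  haveI hpp : Fact p.Prime := ⟨CharP.char_is_prime F p⟩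
  have hq2 : 1 < Fintype.card F := Fintype.one_lt_card
  have hk0 : p * (Fintype.card F - 1) ≠ 0 := mul_ne_zero hpp.out.ne_zero (by omega)
  obtain ⟨m, hm, hmN, hmod⟩ := Nat.exists_prime_gt_modEq_one (N + n + 2 * n * p + 2 * n ^ 2) hk0
  haveI : NeZero m := ⟨hm.ne_zero⟩
  have hm1 : (m : F) = 1 := by
    have h1 : m ≡ 1 [MOD p] := hmod.of_dvd (dvd_mul_right _ _)
    have h2 := (CharP.natCast_eq_natCast F p).2 h1
    rwa [Nat.cast_one] at h2
  have hm2 : m ≡ 1 [MOD (Fintype.card F - 1)] := hmod.of_dvd (dvd_mul_left _ _)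
  haveI : CharP E p := charP_of_injective_algebraMap (algebraMap F E).injective p
  let L := FiniteField.Extension F p m
  let K := FiniteField.Extension E p m
  letI : Fintype L := Fintype.ofFinite L
  letI : Fintype K := Fintype.ofFinite K
  have hL : Module.finrank F L = m := FiniteField.finrank_extension F p m
  have hK : Module.finrank E K = m := FiniteField.finrank_extension E p m
  letI : Algebra F K := ((algebraMap E K).comp (algebraMap F E)).toAlgebra
  haveI : IsScalarTower F E K := IsScalarTower.of_algebraMap_eq' rfl
  have hFK : Module.finrank F L ∣ Module.finrank F K := by
    rw [← Module.finrank_mul_finrank F E K, hL, hK]; exact dvd_mul_left _ _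
  obtain ⟨f⟩ := FiniteField.nonempty_algHom_of_finrank_dvd hFK
  letI : Algebra L K := f.toRingHom.toAlgebra
  haveI : IsScalarTower F L K := IsScalarTower.of_algebraMap_eq' (by
    ext a
    exact (f.commutes a).symm)
  have hcard : Fintype.card L = Fintype.card F ^ m := by rw [Module.card_eq_pow_finrank (K := F) (V := L), hL]
  have hlt : m < Fintype.card L := by
    rw [hcard]; exact Nat.lt_pow_self hq2
  refine ⟨m, by omega, ?_⟩
  have := descent_step ψ hψ hk α x hx (L := L) (E := E) (K := K) hE ξ hξ p m hm hL hK hm2 hm1 (by omega) (by omega) (by omega)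
  convert this using 3
  congr!
end
end KL

/-- twisted version for regular elliptic elements:
`K(α,ψ,x) = (-1)^((k-1)(n+1)) q^((k-1)n(n-1)/2) K_E(α,ψ,ξ)`. -/
theorem matrix_kloosterman_regular_elliptic
    {F : Type} [Field F] [Fintype F] [DecidableEq F]
    (ψ : AddChar F ℂ) (hψ : ∃ a : F, ψ a ≠ 1)
    {n k : ℕ} (hk : 1 ≤ k) (α : Fin k → Fˣ →* ℂˣ)
    (x : (Matrix (Fin n) (Fin n) F)ˣ)
    (hx : Irreducible (Matrix.charpoly (x : Matrix (Fin n) (Fin n) F)))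
    (E : Type) [Field E] [Fintype E] [DecidableEq E] [Algebra F E]
    (hE : Module.finrank F E = n)
    (ξ : E)
    (hξ : Polynomial.aeval ξ (Matrix.charpoly (x : Matrix (Fin n) (Fin n) F)) = 0) :
    matrixKloosterman α ψ (x : Matrix (Fin n) (Fin n) F)
    = (-1 : ℂ) ^ ((k - 1) * (n + 1)) *
        (Fintype.card F : ℂ) ^ ((k - 1) * (n * (n - 1) / 2)) *
        fieldKloosterman α ψ E ξ := by
  exact KL.main_all ψ hψ hk α x hx E hE ξ hξ
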